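/- Assume all the measures dv_g and ν_a are simple; set φ = X_{e₁}, ψ_r = u_{a_{r,e₁}}^{s(a_{r,e₁})}, α_r = (∫ g(∇_g ψ_r, ∇_g φ) dv_g)/(∫ |∇_g φ|^n_g dv_g)^{2/n}, and β_r = (n+1)∫ φψ_r dv_g. Then there exists r ∈ (−1,1) such that α_r − 2^{2/n} β_r = 0; more precisely, r ↦ α_r − 2^{2/n}β_r is continuous on (−1,1), tends to σ − 2^{2/n}I < 0 as r → 1 and to 2^{2/n}I − σ > 0 as r → −1, where σ = (∫|∇_g φ|²_g dv_g)/(∫|∇_g φ|^n_g dv_g)^{2/n} and I = (n+1)∫ φ² dv_g. -/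

import Mathlib

open MeasureTheory Metric Real Filter Set
open scoped RealInnerProductSpace ENNReal NNReal Topology Classical

noncomputable section

/-- Ambient Euclidean space `ℝ^{n+1}`. -/
abbrev Eu (n : ℕ) : Type := EuclideanSpace ℝ (Fin (n + 1))

/-- The unit sphere `S^n ⊆ ℝ^{n+1}` as a subset of the ambient space. -/
def sphSet (n : ℕ) : Set (Eu n) := Metric.sphere (0 : Eu n) 1

/-- The canonical (round) volume measure of `S^n`, viewed as a measure on the
ambient space `ℝ^{n+1}` supported on the unit sphere. -/
def sphMeasure (n : ℕ) : Measure (Eu n) :=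
  Measure.map Subtype.val ((volume : Measure (Eu n)).toSphere)

/-- `σ_n`, the volume of the round unit `n`-sphere. -/
def sigmaVol (n : ℕ) : ℝ := (sphMeasure n Set.univ).toReal

/-- The constant `K_n`. -/
def Kconst (n : ℕ) : ℝ :=
  ((n + 1 : ℝ) / n) *
    ((Real.Gamma n * Real.Gamma ((n + 1) / 2)) /
      (Real.Gamma (n + 1 / 2) * Real.Gamma (n / 2))) ^ ((2 : ℝ) / n)

/-- The linear coordinate function `X_s(x) = s · x`. -/
def Xfun {n : ℕ} (s x : Eu n) : ℝ := ⟪s, x⟫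

/-- The tangential gradient on the sphere of (the restriction of) an ambient function:
`∇_{S^n} f (x) = ∇f(x) - ⟨∇f(x), x⟩ x`. -/
def gradS {n : ℕ} (f : Eu n → ℝ) (x : Eu n) : Eu n :=
  gradient f x - ⟪gradient f x, x⟫ • x

/-- A conformal factor `w` represents the metric `g = w² g₀` on `S^n`; it is admissible if it
is smooth and positive on the sphere. -/
def IsConformalFactor (n : ℕ) (w : Eu n → ℝ) : Prop :=
  ContDiff ℝ (⊤ : ℕ∞) w ∧ ∀ x ∈ sphSet n, 0 < w x

/-- The Riemannian measure `dv_g` of the conformal metric `g = w² g₀`, i.e. `w^n dv_{g₀}`. -/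
def confMeasure (n : ℕ) (w : Eu n → ℝ) : Measure (Eu n) :=
  (sphMeasure n).withDensity fun x => ENNReal.ofReal (w x ^ n)

/-- The volume of `(S^n, g)`, `g = w² g₀`. -/
def confVol (n : ℕ) (w : Eu n → ℝ) : ℝ := (confMeasure n w Set.univ).toReal

/-- The Dirichlet energy `∫ |∇_g u|²_g dv_g` of the restriction to `S^n` of `V`,
for `g = w² g₀`: it equals `∫ w^{n-2} |∇_{g₀} V|²_{g₀} dv_{g₀}`. -/
def dirichlet (n : ℕ) (w : Eu n → ℝ) (V : Eu n → ℝ) : ℝ :=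
  ∫ x, w x ^ (n - 2) * ‖gradS V x‖ ^ 2 ∂(sphMeasure n)

/-- `∫ u² dv_g`. -/
def l2sq (n : ℕ) (w : Eu n → ℝ) (V : Eu n → ℝ) : ℝ :=
  ∫ x, (V x) ^ 2 ∂(confMeasure n w)

/-- Mean value zero w.r.t. `dv_g`. -/
def MeanZero (n : ℕ) (w : Eu n → ℝ) (V : Eu n → ℝ) : Prop :=
  ∫ x, V x ∂(confMeasure n w) = 0

/-- The second nonzero eigenvalue `λ₂(S^n, g)` of the Laplace–Beltrami operator of
`g = w² g₀`, defined via the Courant–Fischer min-max characterization over two-dimensional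
spaces of mean-zero test functions (restrictions of smooth ambient functions). -/
def lambda2 (n : ℕ) (w : Eu n → ℝ) : ℝ :=
  sInf { Λ : ℝ | ∃ V W : Eu n → ℝ, ContDiff ℝ (⊤ : ℕ∞) V ∧ ContDiff ℝ (⊤ : ℕ∞) W ∧
    MeanZero n w V ∧ MeanZero n w W ∧
    (∀ a b : ℝ, (∀ x ∈ sphSet n, a * V x + b * W x = 0) → a = 0 ∧ b = 0) ∧
    Λ = sSup { q : ℝ | ∃ a b : ℝ, ¬(a = 0 ∧ b = 0) ∧
      q = dirichlet n w (fun x => a * V x + b * W x) /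
          l2sq n w (fun x => a * V x + b * W x) } }

/-- The conformal transformation `d_ξ` of the closed unit ball. -/
def dMap {n : ℕ} (ξ : Eu n) (x : Eu n) : Eu n :=
  (1 + 2 * ⟪ξ, x⟫ + ‖x‖ ^ 2 * ‖ξ‖ ^ 2)⁻¹ •
    ((1 - ‖ξ‖ ^ 2) • x + (1 + 2 * ⟪ξ, x⟫ + ‖x‖ ^ 2) • ξ)

/-- The reflection `R_p(x) = x - 2(p·x)p`. -/
def Refl {n : ℕ} (p x : Eu n) : Eu n := x - (2 * ⟪p, x⟫) • p

/-- The spherical cap `a_{r,p} = d_{rp}(a_{0,p})`. -/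
def cap (n : ℕ) (r : ℝ) (p : Eu n) : Set (Eu n) :=
  dMap (r • p) '' {x ∈ sphSet n | 0 < ⟪p, x⟫}

/-- The conformal reflection `τ_{a_{r,p}} = d_{rp} ∘ R_p ∘ d_{-rp}`. -/
def tauMap {n : ℕ} (r : ℝ) (p : Eu n) : Eu n → Eu n :=
  dMap (r • p) ∘ Refl p ∘ dMap (-(r • p))

/-- The measure `μ_{a_{r,p}}`, equal to `dv_g + (τ_a)^* dv_g` on `a` and `0` on `a^*`. -/
def capMeasure (n : ℕ) (w : Eu n → ℝ) (r : ℝ) (p : Eu n) : Measure (Eu n) :=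
  (confMeasure n w + Measure.map (tauMap r p) (confMeasure n w)).restrict (cap n r p)

/-- `d_ξ` renormalizes the finite measure `μ`: `∫ X_s ∘ d_ξ dμ = 0` for all `s ∈ S^n`. -/
def Renormalizes {n : ℕ} (ξ : Eu n) (μ : Measure (Eu n)) : Prop :=
  ∀ s ∈ sphSet n, ∫ x, Xfun s (dMap ξ x) ∂μ = 0

/-- The quadratic form `Q(s) = ∫ X_s² dν` of a measure `ν`. -/
def Qform {n : ℕ} (ν : Measure (Eu n)) (s : Eu n) : ℝ := ∫ x, (⟪s, x⟫ : ℝ) ^ 2 ∂ν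

/-- The maximal eigenvalue of the quadratic form `Q`. -/
def maxEig (n : ℕ) (ν : Measure (Eu n)) : ℝ :=
  sSup { q : ℝ | ∃ s : Eu n, ‖s‖ = 1 ∧ q = Qform ν s }

/-- `ν` is simple with (unit) maximal direction `s₀`: the eigenspace of the maximal
eigenvalue of `Q` is the line spanned by `s₀`. -/
def IsMaxDir {n : ℕ} (ν : Measure (Eu n)) (s₀ : Eu n) : Prop :=
  ‖s₀‖ = 1 ∧ ∀ s : Eu n, Qform ν s = maxEig n ν * ‖s‖ ^ 2 ↔ ∃ c : ℝ, s = c • s₀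

/-- `ν` is multiple: the eigenspace of the maximal eigenvalue of `Q` has dimension ≥ 2. -/
def IsMultiple {n : ℕ} (ν : Measure (Eu n)) : Prop :=
  ∃ s t : Eu n, Qform ν s = maxEig n ν * ‖s‖ ^ 2 ∧ Qform ν t = maxEig n ν * ‖t‖ ^ 2 ∧
    LinearIndependent ℝ ![s, t]

/-- The test function `u_a^s` (for `a = a_{r,p}` with renormalization point `ξ`):
`X_s ∘ d_ξ` on `a` and `X_s ∘ d_ξ ∘ τ_a` on `a^*`. -/
def testFun (n : ℕ) (ξ : Eu n) (r : ℝ) (p : Eu n) (s : Eu n) (x : Eu n) : ℝ :=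
  if 0 < ⟪p, dMap (-(r • p)) x⟫ then Xfun s (dMap ξ x) else Xfun s (dMap ξ (tauMap r p x))

/-- The first coordinate vector `e₁ ∈ ℝ^{n+1}`. -/
def e1 (n : ℕ) : Eu n := EuclideanSpace.single 0 1

/-- If `p x` is a polynomial of uniformly bounded degree and `∫ (p x)(t)` is a constant `c` for all
small positive `t`, then it is `c` at `t = 1` as well. -/
theorem integral_eval_one_eq_of_small {α : Type*} [MeasurableSpace α] (μ : Measure α) (k : ℕ)
    (p : α → Polynomial ℝ) (hdeg : ∀ x, (p x).natDegree ≤ k) (c ε : ℝ) (hε : 0 < ε)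
    (hp : ∀ t ∈ Ioo 0 ε, Integrable (fun x => (p x).eval t) μ ∧ ∫ x, (p x).eval t ∂μ = c) :
    ∫ x, (p x).eval 1 ∂μ = c := by
  set v : ℕ → ℝ := fun i => ε * ((i + 1) / (k + 2)) with hv
  have hvinj : Set.InjOn v (Finset.range (k + 1)) := by
    intro i _ j _ hij
    have h2 : (k + 2 : ℝ) ≠ 0 := by positivity
    simp only [hv] at hij
    have := mul_left_cancel₀ hε.ne' hij
    field_simp at this
    exact_mod_cast add_right_cancel this
  have hvmem : ∀ i ∈ Finset.range (k + 1), v i ∈ Ioo 0 ε := by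
    intro i hi
    have hi' : (i : ℝ) + 1 < k + 2 := by
      have : i < k + 1 := Finset.mem_range.1 hi
      exact_mod_cast (by omega : i + 1 < k + 2)
    refine ⟨by simp only [hv]; positivity, ?_⟩
    simp only [hv]
    have : ((i : ℝ) + 1) / (k + 2) < 1 := by rw [div_lt_one (by positivity)]; exact hi'
    nlinarith
  have key : ∀ x, (p x).eval 1 = ∑ i ∈ Finset.range (k + 1),
      (p x).eval (v i) * (Lagrange.basis (Finset.range (k + 1)) v i).eval 1 := by
    intro x
    have hlt : (p x).degree < (Finset.range (k + 1)).card := by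
      rw [Finset.card_range]
      refine lt_of_le_of_lt Polynomial.degree_le_natDegree ?_
      exact_mod_cast Nat.lt_succ_of_le (hdeg x)
    conv_lhs => rw [Lagrange.eq_interpolate hvinj hlt]
    simp [Lagrange.interpolate_apply, Polynomial.eval_finsetSum]
  have hsum : ∑ i ∈ Finset.range (k + 1),
      (Lagrange.basis (Finset.range (k + 1)) v i).eval 1 = 1 := by
    rw [← Polynomial.eval_finsetSum, Lagrange.sum_basis hvinj (by simp)]
    simp
  simp_rw [key]
  rw [integral_finsetSum]
  · rw [Finset.sum_congr rfl fun i hi => by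
      rw [integral_mul_const, (hp _ (hvmem i hi)).2], ← Finset.mul_sum, hsum, mul_one]
  · intro i hi
    exact (hp _ (hvmem i hi)).1.mul_const _

/-- `det (1 + t A)` is polynomial in `t`. -/
theorem exists_polynomial_eval_eq_det {D : ℕ}
    (A : EuclideanSpace ℝ (Fin D) →L[ℝ] EuclideanSpace ℝ (Fin D)) :
    ∃ Q : Polynomial ℝ, Q.natDegree ≤ D ∧
      ∀ t : ℝ, Q.eval t = (ContinuousLinearMap.id ℝ _ + t • A).det := by
  set b := (EuclideanSpace.basisFun (Fin D) ℝ).toBasis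
  set M := LinearMap.toMatrix b b (A : EuclideanSpace ℝ (Fin D) →ₗ[ℝ] EuclideanSpace ℝ (Fin D))
    with hM
  refine ⟨(Polynomial.X • M.map Polynomial.C + (1 : Matrix (Fin D) (Fin D) ℝ).map Polynomial.C).det,
    by simpa using Polynomial.natDegree_det_X_add_C_le M 1, fun t => ?_⟩
  rw [← Polynomial.coe_evalRingHom, RingHom.map_det]
  change _ = LinearMap.det _
  rw [← LinearMap.det_toMatrix b]
  congr 1
  ext i j
  have hMij : M i j = (A (EuclideanSpace.single j 1)) i := by
    simp [hM, LinearMap.toMatrix_apply, b]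
  rw [LinearMap.toMatrix_apply]
  by_cases hij : i = j
  · subst hij
    simp [hMij, b]
    ring
  · have hb : b j = EuclideanSpace.single j 1 := by simp [b]
    have hr : ∀ y, b.repr y i = y i := by simp [b]
    simp [hMij, hb, hr, hij, mul_comm t]

theorem exists_polynomial_eval_eq_aeval {D : ℕ} (P : MvPolynomial (Fin D) ℝ)
    (x y : EuclideanSpace ℝ (Fin D)) :
    ∃ Q : Polynomial ℝ, Q.natDegree ≤ P.totalDegree ∧
      ∀ t : ℝ, Q.eval t = MvPolynomial.aeval (fun i => (x + t • y) i) P := by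
  refine ⟨MvPolynomial.aeval
    (fun i => Polynomial.C (x i) + Polynomial.C (y i) * Polynomial.X) P, ?_, fun t => ?_⟩
  · simpa using MvPolynomial.aeval_natDegree_le (m := P.totalDegree) (n := 1) P le_rfl _
      (fun i => by compute_degree)
  · have h := MvPolynomial.comp_aeval_apply
      (fun i => Polynomial.C (x i) + Polynomial.C (y i) * Polynomial.X)
      (Polynomial.aeval t) P
    simp only [Polynomial.coe_aeval_eq_eval] at h
    rw [h]
    congr 2
    ext i
    simp [mul_comm (y i)]

/-- Small perturbations of the identity of compact support permute a ball containing the support,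
and preserve the orientation. -/
theorem small_perturbation {D : ℕ}
    {V : EuclideanSpace ℝ (Fin D) → EuclideanSpace ℝ (Fin D)} (hV : ContDiff ℝ 1 V) {R : ℝ}
    (hR : ∀ x, R ≤ ‖x‖ → V x = 0) :
    ∃ ε > (0 : ℝ), ∀ t ∈ Ioo 0 ε, Function.Injective (fun x => x + t • V x) ∧
      (fun x => x + t • V x) '' ball 0 R = ball 0 R ∧
      ∀ x, 0 < (ContinuousLinearMap.id ℝ _ + t • fderiv ℝ V x).det := by
  have hsupp : HasCompactSupport V := by
    refine HasCompactSupport.intro (isCompact_closedBall 0 R) fun x hx => hR x ?_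
    simp only [mem_closedBall, dist_zero_right, not_le] at hx
    exact hx.le
  obtain ⟨C, hC⟩ := hV.lipschitzWith_of_hasCompactSupport hsupp (by simp)
  have hbd : ∀ x, ‖fderiv ℝ V x‖ ≤ C := fun x => norm_fderiv_le_of_lipschitz ℝ hC
  have hdet : ∀ᶠ B in 𝓝 (0 : EuclideanSpace ℝ (Fin D) →L[ℝ] EuclideanSpace ℝ (Fin D)),
      0 < (ContinuousLinearMap.id ℝ _ + B).det := by
    have hc : Continuous fun B : EuclideanSpace ℝ (Fin D) →L[ℝ] EuclideanSpace ℝ (Fin D) =>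
        (ContinuousLinearMap.id ℝ _ + B).det :=
      ContinuousLinearMap.continuous_det.comp (continuous_const.add continuous_id)
    refine hc.continuousAt.eventually (lt_mem_nhds ?_)
    have : (ContinuousLinearMap.id ℝ (EuclideanSpace ℝ (Fin D)) + 0).det = 1 := by
      rw [add_zero]; exact LinearMap.det_id
    simp only [this]; exact one_pos
  obtain ⟨δ, hδ, hδB⟩ := Metric.eventually_nhds_iff.1 hdet
  refine ⟨min (1 / (C + 1)) (δ / (C + 1)), by positivity, fun t ht => ?_⟩
  have ht0 : 0 < t := ht.1
  have hC1 : (0 : ℝ) < C + 1 := by positivity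
  have ht1 : t * (C + 1) < 1 := (lt_div_iff₀ hC1).1 (ht.2.trans_le (min_le_left _ _))
  have ht2 : t * (C + 1) < δ := (lt_div_iff₀ hC1).1 (ht.2.trans_le (min_le_right _ _))
  have happrox : ApproximatesLinearOn (fun x => x + t • V x)
      ((ContinuousLinearEquiv.refl ℝ (EuclideanSpace ℝ (Fin D)) :
        EuclideanSpace ℝ (Fin D) ≃L[ℝ] EuclideanSpace ℝ (Fin D)) :
        EuclideanSpace ℝ (Fin D) →L[ℝ] EuclideanSpace ℝ (Fin D)) univ (t.toNNReal * C) := by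
    intro x _ y _
    have : x + t • V x - (y + t • V y) - (x - y) = t • (V x - V y) := by
      rw [smul_sub]; abel
    simp only [ContinuousLinearEquiv.coe_coe, ContinuousLinearEquiv.coe_refl', id_eq]
    rw [this, norm_smul, Real.norm_of_nonneg ht0.le, NNReal.coe_mul, Real.coe_toNNReal _ ht0.le,
      mul_assoc]
    gcongr
    exact hC.norm_sub_le x y
  have hc : Subsingleton (EuclideanSpace ℝ (Fin D)) ∨
      t.toNNReal * C < ‖((ContinuousLinearEquiv.refl ℝ (EuclideanSpace ℝ (Fin D))).symm :
        EuclideanSpace ℝ (Fin D) →L[ℝ] EuclideanSpace ℝ (Fin D))‖₊⁻¹ := by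
    rcases subsingleton_or_nontrivial (EuclideanSpace ℝ (Fin D)) with h | h
    · exact Or.inl h
    · right
      have : ‖((ContinuousLinearEquiv.refl ℝ (EuclideanSpace ℝ (Fin D))).symm :
        EuclideanSpace ℝ (Fin D) →L[ℝ] EuclideanSpace ℝ (Fin D))‖₊ = 1 := by
        apply NNReal.eq
        simp
      rw [this, inv_one, ← NNReal.coe_lt_coe, NNReal.coe_mul, Real.coe_toNNReal _ ht0.le]
      simp only [NNReal.coe_one]
      nlinarith
  have hinj : Function.Injective (fun x => x + t • V x) := by
    rw [← Set.injOn_univ]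
    exact happrox.injOn hc
  have hsurj := happrox.surjective hc
  refine ⟨hinj, ?_, fun x => hδB ?_⟩
  · have hout : ∀ x, R ≤ ‖x‖ → x + t • V x = x := fun x hx => by rw [hR x hx]; simp
    ext y
    simp only [mem_image, mem_ball, dist_zero_right]
    constructor
    · rintro ⟨x, hx, rfl⟩
      by_contra! hy
      have : x + t • V x = x := hinj (hout _ hy)
      rw [this] at hy
      linarith
    · intro hy
      obtain ⟨x, hx⟩ := hsurj y
      refine ⟨x, ?_, hx⟩
      by_contra! hxR
      simp only [hout x hxR] at hx
      rw [hx] at hxR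
      linarith
  · rw [dist_zero_right, norm_smul, Real.norm_of_nonneg ht0.le]
    nlinarith [hbd x]

theorem setIntegral_aeval_comp_mul_det {D : ℕ}
    {G : EuclideanSpace ℝ (Fin D) → EuclideanSpace ℝ (Fin D)} (hG : ContDiff ℝ 1 G) {R : ℝ}
    (hR : ∀ x, R ≤ ‖x‖ → G x = x) (P : MvPolynomial (Fin D) ℝ) :
    ∫ x in ball 0 R, MvPolynomial.aeval (fun i => G x i) P * (fderiv ℝ G x).det =
      ∫ x in ball (0 : EuclideanSpace ℝ (Fin D)) R, MvPolynomial.aeval (fun i => x i) P := by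
  set V : EuclideanSpace ℝ (Fin D) → EuclideanSpace ℝ (Fin D) := fun x => G x - x with hVdef
  have hV : ContDiff ℝ 1 V := hG.sub contDiff_id
  have hVR : ∀ x, R ≤ ‖x‖ → V x = 0 := fun x hx => by simp [hVdef, hR x hx]
  obtain ⟨ε, hε, hsmall⟩ := small_perturbation hV hVR
  choose Q hQdeg hQ using fun x => exists_polynomial_eval_eq_aeval P x (V x)
  choose Q' hQ'deg hQ' using fun x => exists_polynomial_eval_eq_det (fderiv ℝ V x)
  have hVfd : ∀ x, fderiv ℝ G x = ContinuousLinearMap.id ℝ _ + (1 : ℝ) • fderiv ℝ V x := by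
    intro x
    have : fderiv ℝ V x = fderiv ℝ G x - ContinuousLinearMap.id ℝ _ := by
      rw [hVdef, fderiv_fun_sub (hG.differentiable (by simp) x) differentiableAt_fun_id]
      simp
    rw [this]; simp
  have hpoly : Continuous fun x : EuclideanSpace ℝ (Fin D) =>
      MvPolynomial.aeval (fun i => x i) P := by
    simp only [MvPolynomial.aeval_eq_eval]
    exact (MvPolynomial.continuous_eval P).comp (PiLp.continuous_ofLp 2 _)
  have hfinal := integral_eval_one_eq_of_small
    (volume.restrict (ball (0 : EuclideanSpace ℝ (Fin D)) R)) (P.totalDegree + D)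
    (fun x => Q x * Q' x)
    (fun x => Polynomial.natDegree_mul_le.trans (add_le_add (hQdeg x) (hQ'deg x)))
    (∫ x in ball (0 : EuclideanSpace ℝ (Fin D)) R, MvPolynomial.aeval (fun i => x i) P) ε hε
    (fun t ht => ?_)
  · rw [← hfinal]
    refine integral_congr_ae (Eventually.of_forall fun x => ?_)
    simp only [Polynomial.eval_mul, hQ, hQ', ← hVfd]
    simp [hVdef]
  · obtain ⟨hinj, himg, hdet⟩ := hsmall t ht
    simp only [Polynomial.eval_mul, hQ, hQ']
    have hfd : ∀ x ∈ ball (0 : EuclideanSpace ℝ (Fin D)) R,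
        HasFDerivWithinAt (fun x => x + t • V x)
          (ContinuousLinearMap.id ℝ _ + t • fderiv ℝ V x) (ball 0 R) x := fun x _ =>
      ((hasFDerivAt_id x).add
        ((hV.differentiable (by simp) x).hasFDerivAt.const_smul t)).hasFDerivWithinAt
    constructor
    · have hcont : Continuous fun x => MvPolynomial.aeval (fun i => (x + t • V x) i) P *
          (ContinuousLinearMap.id ℝ _ + t • fderiv ℝ V x).det := by
        refine (hpoly.comp (continuous_id.add (hV.continuous.const_smul t))).mul ?_
        exact ContinuousLinearMap.continuous_det.comp
          (continuous_const.add ((hV.continuous_fderiv (by simp)).const_smul t))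
      exact (hcont.continuousOn.integrableOn_compact (isCompact_closedBall 0 R)).mono_set
        ball_subset_closedBall
    · have := integral_image_eq_integral_abs_det_fderiv_smul volume measurableSet_ball hfd
        hinj.injOn (fun y => MvPolynomial.aeval (fun i => y i) P)
      rw [himg] at this
      rw [this]
      refine integral_congr_ae (Eventually.of_forall fun x => ?_)
      simp only [abs_of_pos (hdet x), smul_eq_mul]
      ring

/-- A `C¹` self-map of `ℝ^D` that is the identity outside a ball has degree one. -/
theorem setIntegral_comp_mul_det {D : ℕ}
    {G : EuclideanSpace ℝ (Fin D) → EuclideanSpace ℝ (Fin D)} (hG : ContDiff ℝ 1 G) {R : ℝ}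
    (hR : ∀ x, R ≤ ‖x‖ → G x = x) {h : EuclideanSpace ℝ (Fin D) → ℝ} (hh : Continuous h) :
    ∫ x in ball 0 R, h (G x) * (fderiv ℝ G x).det =
      ∫ x in ball (0 : EuclideanSpace ℝ (Fin D)) R, h x := by
  set B : Set (EuclideanSpace ℝ (Fin D)) := ball 0 R with hB
  have hdetc : Continuous fun x => (fderiv ℝ G x).det :=
    ContinuousLinearMap.continuous_det.comp (hG.continuous_fderiv (by simp))
  have hint : ∀ {k : EuclideanSpace ℝ (Fin D) → ℝ}, Continuous k → IntegrableOn k B :=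
    fun hk => (hk.continuousOn.integrableOn_compact (isCompact_closedBall 0 R)).mono_set
      ball_subset_closedBall
  set K : Set (EuclideanSpace ℝ (Fin D)) := closedBall 0 R ∪ G '' closedBall 0 R with hK
  have hKc : IsCompact K :=
    (isCompact_closedBall 0 R).union ((isCompact_closedBall 0 R).image hG.continuous)
  set φ : MvPolynomial (Fin D) ℝ →ₐ[ℝ] C(EuclideanSpace ℝ (Fin D), ℝ) :=
    MvPolynomial.aeval (fun i => ⟨fun x => x i, by fun_prop⟩) with hφ
  have hφx : ∀ P x, φ P x = MvPolynomial.aeval (fun i => x i) P := by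
    intro P x
    have h := MvPolynomial.comp_aeval_apply
      (fun i => (⟨fun x => x i, by fun_prop⟩ : C(EuclideanSpace ℝ (Fin D), ℝ)))
      (ContinuousMap.evalAlgHom ℝ ℝ x) P
    simpa using h
  have hsep : φ.range.SeparatesPoints := by
    intro x y hxy
    obtain ⟨i, hi⟩ : ∃ i, x i ≠ y i := by
      by_contra! hcon
      exact hxy (PiLp.ext hcon)
    refine ⟨_, ⟨φ (MvPolynomial.X i), ⟨MvPolynomial.X i, rfl⟩, rfl⟩, ?_⟩
    simpa [hφ] using hi
  set Z : ℝ := ∫ x in B, |(fderiv ℝ G x).det| with hZ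
  have hZ0 : 0 ≤ Z := integral_nonneg fun x => abs_nonneg _
  set Y : ℝ := (volume : Measure (EuclideanSpace ℝ (Fin D))).real B with hY
  have hY0 : 0 ≤ Y := measureReal_nonneg
  have hclose : ∀ δ > (0 : ℝ), |(∫ x in B, h (G x) * (fderiv ℝ G x).det) - ∫ x in B, h x|
      ≤ δ * (Z + Y) := by
    intro δ hδ
    obtain ⟨g, ⟨P, rfl⟩, hg⟩ :=
      ContinuousMap.exists_mem_subalgebra_near_continuous_of_isCompact_of_separatesPoints
        hsep ⟨h, hh⟩ hKc hδ
    have hP := setIntegral_aeval_comp_mul_det hG hR P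
    simp only [← hφx] at hP
    have hmain : (∫ x in B, h (G x) * (fderiv ℝ G x).det) - ∫ x in B, h x =
        (∫ x in B, (h (G x) - φ P (G x)) * (fderiv ℝ G x).det) - ∫ x in B, (h x - φ P x) := by
      have hc1 : Continuous fun x => h (G x) * (fderiv ℝ G x).det :=
        (hh.comp hG.continuous).mul hdetc
      have hc2 : Continuous fun x => φ P (G x) * (fderiv ℝ G x).det :=
        ((φ P).continuous.comp hG.continuous).mul hdetc
      simp only [sub_mul]
      rw [integral_sub (hint hc1) (hint hc2), integral_sub (hint hh) (hint (φ P).continuous), hP]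
      ring
    rw [hmain]
    refine (abs_sub _ _).trans ?_
    have h1 : |∫ x in B, (h (G x) - φ P (G x)) * (fderiv ℝ G x).det| ≤ δ * Z := by
      rw [← Real.norm_eq_abs, hZ, ← integral_const_mul]
      refine norm_integral_le_of_norm_le (hint (hdetc.abs.const_smul δ)) ?_
      filter_upwards [ae_restrict_mem measurableSet_ball] with x hx
      rw [norm_mul, Real.norm_eq_abs (fderiv ℝ G x).det]
      refine mul_le_mul_of_nonneg_right ?_ (abs_nonneg _)
      rw [norm_sub_rev]
      exact (hg _ (Or.inr ⟨x, ball_subset_closedBall hx, rfl⟩)).le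
    have h2 : |∫ x in B, (h x - φ P x)| ≤ δ * Y := by
      rw [← Real.norm_eq_abs, hB]
      refine norm_setIntegral_le_of_norm_le_const measure_ball_lt_top fun x hx => ?_
      rw [norm_sub_rev]
      exact (hg _ (Or.inl (ball_subset_closedBall hx))).le
    linarith
  have : |(∫ x in B, h (G x) * (fderiv ℝ G x).det) - ∫ x in B, h x| ≤ 0 := by
    refine le_of_forall_pos_le_add fun η hη => ?_
    have := hclose (η / (Z + Y + 1)) (by positivity)
    refine this.trans ?_
    rw [zero_add, div_mul_eq_mul_div, div_le_iff₀ (by positivity)]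
    nlinarith
  exact sub_eq_zero.1 (abs_nonpos_iff.1 this)

/-- The image under a `C¹` map of Lebesgue measure weighted by the absolute Jacobian determinant,
restricted to a set where the Jacobian does not vanish, has an integer valued density. -/
theorem exists_nat_density {D : ℕ}
    {f : EuclideanSpace ℝ (Fin D) → EuclideanSpace ℝ (Fin D)} (hf : ContDiff ℝ 1 f)
    {s : Set (EuclideanSpace ℝ (Fin D))} (hs : MeasurableSet s)
    (hdet : ∀ x ∈ s, (fderiv ℝ f x).det ≠ 0)
    (hfin : ∫⁻ x in s, ENNReal.ofReal |(fderiv ℝ f x).det| ≠ ⊤) :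
    ∃ N : EuclideanSpace ℝ (Fin D) → ℕ, Integrable (fun y => (N y : ℝ)) ∧
      ∀ h : EuclideanSpace ℝ (Fin D) → ℝ, Continuous h →
        ∫ x in s, h (f x) * |(fderiv ℝ f x).det| = ∫ y, h y * N y := by
  have hder : ∀ x, HasFDerivAt f (fderiv ℝ f x) x := fun x =>
    (hf.differentiable (by simp) x).hasFDerivAt
  have hdetc : Continuous fun x => (fderiv ℝ f x).det :=
    ContinuousLinearMap.continuous_det.comp (hf.continuous_fderiv (by simp))
  have hr : ∀ A : EuclideanSpace ℝ (Fin D) →L[ℝ] EuclideanSpace ℝ (Fin D), ∃ r : ℝ≥0, r ≠ 0 ∧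
      (A.det ≠ 0 → ∀ u, ApproximatesLinearOn f A u r → InjOn f u) := by
    intro A
    by_cases hA : A.det = 0
    · exact ⟨1, one_ne_zero, fun h => (h hA).elim⟩
    · set B := A.toContinuousLinearEquivOfDetNeZero hA with hB
      have hBA : (B : EuclideanSpace ℝ (Fin D) →L[ℝ] EuclideanSpace ℝ (Fin D)) = A := by
        ext x; simp [hB]
      rcases subsingleton_or_nontrivial (EuclideanSpace ℝ (Fin D)) with hsub | hnon
      · exact ⟨1, one_ne_zero, fun _ u _ => fun x _ y _ _ => Subsingleton.elim _ _⟩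
      · have hpos : 0 < ‖(B.symm : EuclideanSpace ℝ (Fin D) →L[ℝ] EuclideanSpace ℝ (Fin D))‖₊⁻¹ :=
          inv_pos.2 B.nnnorm_symm_pos
        refine ⟨‖(B.symm : EuclideanSpace ℝ (Fin D) →L[ℝ] EuclideanSpace ℝ (Fin D))‖₊⁻¹ / 2,
          (half_pos hpos).ne', fun _ u hu => ?_⟩
        rw [← hBA] at hu
        exact hu.injOn (Or.inr (half_lt_self hpos))
  choose r hr0 hrinj using hr
  obtain ⟨t, A, htd, htm, htc, htA, htex⟩ :=
    exists_partition_approximatesLinearOn_of_hasFDerivWithinAt f s (fun x => fderiv ℝ f x)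
      (fun x _ => (hder x).hasFDerivWithinAt) r hr0
  have hinj : ∀ n, InjOn f (s ∩ t n) := by
    intro n
    rcases s.eq_empty_or_nonempty with h0 | h0
    · simp [h0]
    · obtain ⟨y, hy, hAy⟩ := htex h0 n
      exact hrinj (A n) (hAy ▸ hdet y hy) _ (htA n)
  have hsm : ∀ n, MeasurableSet (s ∩ t n) := fun n => hs.inter (htm n)
  have him : ∀ n, MeasurableSet (f '' (s ∩ t n)) := fun n =>
    measurable_image_of_fderivWithin (hsm n) (fun x _ => (hder x).hasFDerivWithinAt) (hinj n)
  set M : EuclideanSpace ℝ (Fin D) → ℝ≥0∞ := fun y => ∑' n, (f '' (s ∩ t n)).indicator 1 y with hM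
  have hMm : Measurable M := Measurable.tsum fun n => measurable_one.indicator (him n)
  have hsU : s = ⋃ n, s ∩ t n := by
    rw [← inter_iUnion]; exact (inter_eq_left.2 htc).symm
  have key : ∀ g : EuclideanSpace ℝ (Fin D) → ℝ≥0∞, Measurable g →
      ∫⁻ x in s, ENNReal.ofReal |(fderiv ℝ f x).det| * g (f x) = ∫⁻ y, M y * g y := by
    intro g hg
    conv_lhs => rw [hsU]
    rw [lintegral_iUnion hsm (fun i j hij => (htd hij).mono inter_subset_right inter_subset_right)]
    simp only [hM, ← ENNReal.tsum_mul_right]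
    rw [lintegral_tsum (f := fun n y => (f '' (s ∩ t n)).indicator 1 y * g y)
      fun n => ((measurable_one.indicator (him n)).mul hg).aemeasurable]
    congr 1
    ext n
    rw [← lintegral_image_eq_lintegral_abs_det_fderiv_mul volume (hsm n)
      (fun x _ => (hder x).hasFDerivWithinAt) (hinj n) g, ← lintegral_indicator (him n)]
    congr 1
    ext y
    by_cases hy : y ∈ f '' (s ∩ t n) <;> simp [hy]
  have hMfin : ∫⁻ y, M y ≠ ⊤ := by
    have := key 1 measurable_one
    simp only [Pi.one_apply, mul_one] at this
    rwa [← this]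
  have hMnat : ∀ y, M y ≠ ⊤ → ∃ k : ℕ, M y = k := by
    intro y hy
    have : M y = ((({n | y ∈ f '' (s ∩ t n)} : Set ℕ).encard : ℕ∞) : ℝ≥0∞) := by
      rw [← ENNReal.tsum_set_one]
      exact (tsum_subtype {n | y ∈ f '' (s ∩ t n)} fun _ => (1 : ℝ≥0∞)).symm ▸ rfl
    rw [this] at hy ⊢
    obtain ⟨k, hk⟩ := ENat.ne_top_iff_exists.1
      (fun h : ({n | y ∈ f '' (s ∩ t n)} : Set ℕ).encard = ⊤ => hy (by rw [h]; rfl))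
    exact ⟨k, by rw [← hk]; rfl⟩
  have hnn : ∀ᵐ y, (⌊(M y).toReal⌋₊ : ℝ) = (M y).toReal := by
    filter_upwards [ae_lt_top hMm hMfin] with y hy
    obtain ⟨k, hk⟩ := hMnat y hy.ne
    simp [hk]
  have hMint : Integrable fun y => (M y).toReal :=
    integrable_toReal_of_lintegral_ne_top hMm.aemeasurable hMfin
  refine ⟨fun y => ⌊(M y).toReal⌋₊, hMint.congr (hnn.mono fun y hy => hy.symm), fun h hh => ?_⟩
  have hmeas : Measure.map f ((volume.restrict s).withDensity
      fun x => ENNReal.ofReal |(fderiv ℝ f x).det|) = volume.withDensity M := by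
    refine Measure.ext_of_lintegral _ fun g hg => ?_
    rw [lintegral_map hg hf.continuous.measurable, lintegral_withDensity_eq_lintegral_mul _
      (by exact ENNReal.measurable_ofReal.comp hdetc.abs.measurable)
      (show Measurable fun x => g (f x) from hg.comp hf.continuous.measurable),
      lintegral_withDensity_eq_lintegral_mul _ hMm hg]
    exact key g hg
  have h1 : ∫ x in s, h (f x) * |(fderiv ℝ f x).det| = ∫ y, h y ∂(volume.withDensity M) := by
    rw [← hmeas, integral_map hf.continuous.aemeasurable hh.aestronglyMeasurable,
      integral_withDensity_eq_integral_toReal_smul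
        (by exact ENNReal.measurable_ofReal.comp hdetc.abs.measurable)
        (Eventually.of_forall fun x => ENNReal.ofReal_lt_top)]
    refine integral_congr_ae (Eventually.of_forall fun x => ?_)
    simp [ENNReal.toReal_ofReal, mul_comm]
  rw [h1, integral_withDensity_eq_integral_toReal_smul hMm (ae_lt_top hMm hMfin)]
  refine integral_congr_ae (hnn.mono fun y hy => ?_)
  simp only [smul_eq_mul, hy, mul_comm]

theorem exists_int_density {D : ℕ}
    {f : EuclideanSpace ℝ (Fin D) → EuclideanSpace ℝ (Fin D)} (hf : ContDiff ℝ 1 f)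
    {A : Set (EuclideanSpace ℝ (Fin D))} (hA : MeasurableSet A) (hAb : Bornology.IsBounded A) :
    ∃ N : EuclideanSpace ℝ (Fin D) → ℤ, Integrable (fun y => (N y : ℝ)) ∧
      ∀ h : EuclideanSpace ℝ (Fin D) → ℝ, Continuous h → HasCompactSupport h →
        ∫ x in A, h (f x) * (fderiv ℝ f x).det = ∫ y, h y * N y := by
  have hdetc : Continuous fun x => (fderiv ℝ f x).det :=
    ContinuousLinearMap.continuous_det.comp (hf.continuous_fderiv (by simp))
  have hint : ∀ k : EuclideanSpace ℝ (Fin D) → ℝ, Continuous k → IntegrableOn k A := by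
    intro k hk
    obtain ⟨R, hR⟩ := hAb.subset_closedBall 0
    exact (hk.continuousOn.integrableOn_compact (isCompact_closedBall 0 R)).mono_set hR
  set P : Set (EuclideanSpace ℝ (Fin D)) := {x | 0 < (fderiv ℝ f x).det} with hP
  set Q : Set (EuclideanSpace ℝ (Fin D)) := {x | (fderiv ℝ f x).det < 0} with hQ
  have hPm : MeasurableSet P := (isOpen_lt continuous_const hdetc).measurableSet
  have hQm : MeasurableSet Q := (isOpen_lt hdetc continuous_const).measurableSet
  have hfin : ∀ B ⊆ A, ∫⁻ x in B, ENNReal.ofReal |(fderiv ℝ f x).det| ≠ ⊤ := by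
    intro B hB
    have := ((hint _ hdetc.abs).mono_set hB).lintegral_lt_top
    exact this.ne
  obtain ⟨N₁, hN₁, h₁⟩ := exists_nat_density hf (hA.inter hPm) (fun x hx => (ne_of_gt hx.2))
    (hfin _ inter_subset_left)
  obtain ⟨N₂, hN₂, h₂⟩ := exists_nat_density hf (hA.inter hQm) (fun x hx => (ne_of_lt hx.2))
    (hfin _ inter_subset_left)
  refine ⟨fun y => N₁ y - N₂ y, by push_cast; exact hN₁.sub hN₂, fun h hh hc => ?_⟩
  obtain ⟨C, hC⟩ := hh.bounded_above_of_compact_support hc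
  have hi : ∀ {N : EuclideanSpace ℝ (Fin D) → ℕ}, Integrable (fun y => (N y : ℝ)) →
      Integrable fun y => h y * N y := fun hN =>
    hN.bdd_mul hh.aestronglyMeasurable (Eventually.of_forall hC)
  push_cast
  simp only [mul_sub]
  rw [integral_sub (hi hN₁) (hi hN₂), ← h₁ h hh, ← h₂ h hh]
  have hF : Continuous fun x => h (f x) * (fderiv ℝ f x).det := (hh.comp hf.continuous).mul hdetc
  have hFa : Continuous fun x => h (f x) * |(fderiv ℝ f x).det| :=
    (hh.comp hf.continuous).mul hdetc.abs
  rw [inter_comm A P, inter_comm A Q, ← Measure.restrict_restrict hPm,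
    ← Measure.restrict_restrict hQm, ← integral_indicator hPm, ← integral_indicator hQm,
    ← integral_sub (((hint _ hFa).integrable).indicator hPm)
      (((hint _ hFa).integrable).indicator hQm)]
  refine integral_congr_ae (Eventually.of_forall fun x => ?_)
  simp only [indicator, hP, hQ, mem_ofPred_eq]
  rcases lt_trichotomy (fderiv ℝ f x).det 0 with h0 | h0 | h0
  · simp [h0, h0.not_gt, abs_of_neg h0]
  · simp [h0]
  · simp [h0, h0.not_gt, abs_of_pos h0]

theorem exists_contDiff_approx_on_sphere {D : ℕ}
    {v : EuclideanSpace ℝ (Fin D) → EuclideanSpace ℝ (Fin D)}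
    (hv : ContinuousOn v (sphere 0 1)) {δ : ℝ} (hδ : 0 < δ) :
    ∃ q : EuclideanSpace ℝ (Fin D) → EuclideanSpace ℝ (Fin D), ContDiff ℝ (⊤ : ℕ∞) q ∧
      ∀ x ∈ sphere 0 1, ‖q x - v x‖ ≤ δ := by
  set A : Subalgebra ℝ C(EuclideanSpace ℝ (Fin D), ℝ) :=
    { carrier := {f | ContDiff ℝ (⊤ : ℕ∞) f}
      mul_mem' := fun {f g} hf hg =>
        mem_ofPred.2 ((mem_ofPred.1 hf : ContDiff ℝ (⊤ : ℕ∞) f).mul (mem_ofPred.1 hg))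
      add_mem' := fun {f g} hf hg =>
        mem_ofPred.2 ((mem_ofPred.1 hf : ContDiff ℝ (⊤ : ℕ∞) f).add (mem_ofPred.1 hg))
      algebraMap_mem' := fun r => mem_ofPred.2 (contDiff_const (c := r)) } with hA
  have hsep : A.SeparatesPoints := by
    intro x y hxy
    obtain ⟨i, hi⟩ : ∃ i, x i ≠ y i := by
      by_contra! hcon
      exact hxy (PiLp.ext hcon)
    have hc : ContDiff ℝ (⊤ : ℕ∞) fun z : EuclideanSpace ℝ (Fin D) => z i := by fun_prop
    have hm : (⟨fun z => z i, by fun_prop⟩ : C(EuclideanSpace ℝ (Fin D), ℝ)) ∈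
        ({f | ContDiff ℝ (⊤ : ℕ∞) f} : Set C(EuclideanSpace ℝ (Fin D), ℝ)) := mem_ofPred.2 hc
    exact ⟨fun z => z i, ⟨_, hm, rfl⟩, hi⟩
  have happ : ∀ i : Fin D, ∃ f : EuclideanSpace ℝ (Fin D) → ℝ, ContDiff ℝ (⊤ : ℕ∞) f ∧
      ∀ x ∈ sphere 0 1, ‖f x - v x i‖ ≤ δ / (D + 1) := by
    intro i
    have hc : Continuous fun x : sphere (0 : EuclideanSpace ℝ (Fin D)) 1 => v x i := by
      have h := continuousOn_iff_continuous_domRestrict.1 hv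
      exact (show Continuous fun z : EuclideanSpace ℝ (Fin D) => z i by fun_prop).comp h
    obtain ⟨g, hg⟩ := ContinuousMap.exists_restrict_eq (Metric.isClosed_sphere)
      (⟨_, hc⟩ : C(sphere (0 : EuclideanSpace ℝ (Fin D)) 1, ℝ))
    obtain ⟨f, hfA, hf⟩ :=
      ContinuousMap.exists_mem_subalgebra_near_continuous_of_isCompact_of_separatesPoints
        hsep g (isCompact_sphere (0 : EuclideanSpace ℝ (Fin D)) 1)
        (show 0 < δ / ((D : ℝ) + 1) by positivity)
    refine ⟨f, mem_ofPred.1 hfA, fun x hx => ?_⟩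
    have : g x = v x i := DFunLike.congr_fun hg ⟨x, hx⟩
    rw [← this]
    exact (hf x hx).le
  choose f hf hfv using happ
  refine ⟨fun x => WithLp.toLp 2 fun i => f i x, ?_, fun x hx => ?_⟩
  · rw [contDiff_euclidean]
    exact fun i => hf i
  · refine abs_le_of_sq_le_sq' ?_ hδ.le |>.2
    rw [EuclideanSpace.norm_sq_eq]
    have hD : (0 : ℝ) < (D : ℝ) + 1 := by positivity
    calc ∑ i, ‖((WithLp.toLp 2 fun i => f i x) - v x : EuclideanSpace ℝ (Fin D)) i‖ ^ 2
        ≤ ∑ i : Fin D, (δ / (D + 1)) ^ 2 := by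
          refine Finset.sum_le_sum fun i _ => ?_
          have := hfv i x hx
          gcongr
          simpa using this
      _ = D * (δ / (D + 1)) ^ 2 := by simp
      _ ≤ δ ^ 2 := by
          rw [div_pow, mul_div_assoc', div_le_iff₀ (by positivity)]
          nlinarith [sq_nonneg δ, mul_nonneg (sq_nonneg δ) hD.le,
            mul_nonneg (sq_nonneg δ) (Nat.cast_nonneg D : (0 : ℝ) ≤ D),
            mul_nonneg (mul_nonneg (sq_nonneg δ) (Nat.cast_nonneg D : (0 : ℝ) ≤ D))
              (Nat.cast_nonneg D : (0 : ℝ) ≤ D)]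

theorem det_neg_continuousLinearMap {D : ℕ}
    (L : EuclideanSpace ℝ (Fin D) →L[ℝ] EuclideanSpace ℝ (Fin D)) :
    (-L).det = (-1) ^ D * L.det := by
  have := LinearMap.det_smul (-1 : ℝ)
    (L : EuclideanSpace ℝ (Fin D) →ₗ[ℝ] EuclideanSpace ℝ (Fin D))
  rw [finrank_euclideanSpace_fin] at this
  rw [← this, neg_one_smul]
  rfl

/-- For an even map `w`, the degree integral over a ball is an even multiple of the one over a
half-ball. -/
theorem setIntegral_comp_mul_det_of_even {D : ℕ} (hD : 0 < D)
    {w : EuclideanSpace ℝ (Fin D) → EuclideanSpace ℝ (Fin D)} (hw : ContDiff ℝ 1 w)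
    (hev : ∀ x, w (-x) = w x) {h : EuclideanSpace ℝ (Fin D) → ℝ} (hh : Continuous h) :
    ∫ x in ball 0 1, h (w x) * (fderiv ℝ w x).det =
      (1 + (-1) ^ D) * ∫ x in ball 0 1 ∩ {x | 0 < x ⟨0, hD⟩},
        h (w x) * (fderiv ℝ w x).det := by
  set F : EuclideanSpace ℝ (Fin D) → ℝ := fun x => h (w x) * (fderiv ℝ w x).det with hF
  have hdetc : Continuous fun x => (fderiv ℝ w x).det :=
    ContinuousLinearMap.continuous_det.comp (hw.continuous_fderiv (by simp))
  have hFc : Continuous F := (hh.comp hw.continuous).mul hdetc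
  have hFint : IntegrableOn F (ball 0 1) :=
    (hFc.continuousOn.integrableOn_compact (isCompact_closedBall 0 1)).mono_set
      ball_subset_closedBall
  have hFneg : ∀ x, F (-x) = (-1) ^ D * F x := by
    intro x
    have hd : fderiv ℝ w (-x) = -fderiv ℝ w x := by
      have h1 : HasFDerivAt w (fderiv ℝ w (-x)) (-x) :=
        (hw.differentiable (by simp) (-x)).hasFDerivAt
      have h2 := h1.comp x (hasFDerivAt_id x).neg
      have h2' : HasFDerivAt w ((fderiv ℝ w (-x)).comp (-ContinuousLinearMap.id ℝ _)) x := by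
        have h3 : (w ∘ Neg.neg) = w := by ext1 y; simp [hev]
        rwa [h3] at h2
      rw [h2'.fderiv]
      ext y
      simp
    simp only [hF, hd, hev, det_neg_continuousLinearMap]
    ring
  have hcoord : Continuous fun x : EuclideanSpace ℝ (Fin D) => x ⟨0, hD⟩ := by fun_prop
  set H : Set (EuclideanSpace ℝ (Fin D)) := {x | 0 < x ⟨0, hD⟩} with hH
  have hHm : MeasurableSet H := (isOpen_lt continuous_const hcoord).measurableSet
  have hsplit := integral_inter_add_sdiff (f := F) (μ := volume) hHm hFint
  have hnull : volume {x : EuclideanSpace ℝ (Fin D) | x ⟨0, hD⟩ = 0} = 0 := by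
    set ℓ : EuclideanSpace ℝ (Fin D) →ₗ[ℝ] ℝ :=
      ((EuclideanSpace.proj (⟨0, hD⟩ : Fin D) : EuclideanSpace ℝ (Fin D) →L[ℝ] ℝ) :
        EuclideanSpace ℝ (Fin D) →ₗ[ℝ] ℝ) with hℓ
    have := Measure.addHaar_submodule volume (LinearMap.ker ℓ) (by
      rw [Ne, LinearMap.ker_eq_top]
      intro h0
      have := LinearMap.congr_fun h0 (EuclideanSpace.single ⟨0, hD⟩ 1)
      simp [hℓ] at this)
    convert this using 2
    ext x
    simp [hℓ]
  have hneg : ∫ x in ball 0 1 \ H, F x = ∫ x in Neg.neg ⁻¹' (ball 0 1 ∩ H), F x := by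
    refine setIntegral_congr_set (eventuallyEq_set.2 ?_)
    filter_upwards [compl_mem_ae_iff.2 hnull] with x hx
    have hx' : x ⟨0, hD⟩ ≠ 0 := fun h => hx (mem_ofPred.2 h)
    simp only [Set.mem_sdiff, mem_preimage, mem_inter_iff, mem_ball, dist_zero_right, norm_neg, hH,
      mem_ofPred_eq, PiLp.neg_apply, Left.neg_pos_iff, not_lt]
    constructor
    · rintro ⟨a, b⟩; exact ⟨a, lt_of_le_of_ne b hx'⟩
    · rintro ⟨a, b⟩; exact ⟨a, b.le⟩
  rw [← hsplit, hneg]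
  have h4 := (Measure.measurePreserving_neg (volume : Measure (EuclideanSpace ℝ (Fin D)))
    ).setIntegral_preimage_emb
    (Homeomorph.neg (EuclideanSpace ℝ (Fin D))).measurableEmbedding (fun x => F (-x)) (ball 0 1 ∩ H)
  simp only [neg_neg] at h4
  rw [h4]
  simp only [hFneg]
  rw [integral_const_mul]
  ring

/-- There is no even nowhere vanishing tangent vector field on a sphere. -/
theorem no_even_tangent_field {D : ℕ} (hD : 0 < D)
    (v : EuclideanSpace ℝ (Fin D) → EuclideanSpace ℝ (Fin D))
    (hv : ContinuousOn v (sphere 0 1)) (hev : ∀ x ∈ sphere 0 1, v (-x) = v x)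
    (htan : ∀ x ∈ sphere (0 : EuclideanSpace ℝ (Fin D)) 1, (⟪v x, x⟫ : ℝ) = 0)
    (hne : ∀ x ∈ sphere 0 1, v x ≠ 0) : False := by
  have hsne : (sphere (0 : EuclideanSpace ℝ (Fin D)) 1).Nonempty :=
    ⟨EuclideanSpace.single ⟨0, hD⟩ 1, by simp⟩
  obtain ⟨x₀, hx₀, hmin⟩ := (isCompact_sphere (0 : EuclideanSpace ℝ (Fin D)) 1).exists_isMinOn
    hsne hv.norm
  have hδ : 0 < ‖v x₀‖ / 2 := half_pos (norm_pos_iff.2 (hne x₀ hx₀))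
  obtain ⟨q₀, hq₀, hq₀v⟩ := exists_contDiff_approx_on_sphere hv hδ
  set q : EuclideanSpace ℝ (Fin D) → EuclideanSpace ℝ (Fin D) :=
    fun x => (1 / 2 : ℝ) • (q₀ x + q₀ (-x)) with hq
  have hqs : ContDiff ℝ (⊤ : ℕ∞) q := (hq₀.add (hq₀.comp contDiff_neg)).const_smul _
  have hqev : ∀ x, q (-x) = q x := fun x => by simp [hq, add_comm]
  have hqv : ∀ x ∈ sphere 0 1, ‖q x - v x‖ < ‖v x‖ := by
    intro x hx
    have hx' : -x ∈ sphere (0 : EuclideanSpace ℝ (Fin D)) 1 := by simpa using hx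
    have h1 := hq₀v x hx
    have h2 := hq₀v (-x) hx'
    rw [hev x hx] at h2
    have h3 : ‖v x₀‖ ≤ ‖v x‖ := hmin hx
    have h4 : q x - v x = (1 / 2 : ℝ) • ((q₀ x - v x) + (q₀ (-x) - v x)) := by
      simp only [hq]; module
    rw [h4, norm_smul]
    have := norm_add_le (q₀ x - v x) (q₀ (-x) - v x)
    norm_num
    linarith
  set w : EuclideanSpace ℝ (Fin D) → EuclideanSpace ℝ (Fin D) :=
    fun x => ‖x‖ ^ 2 • q x - (⟪q x, x⟫ : ℝ) • x with hw
  have hws : ContDiff ℝ (⊤ : ℕ∞) w :=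
    ((contDiff_norm_sq ℝ).smul hqs).sub ((hqs.inner ℝ contDiff_id).smul contDiff_id)
  have hwev : ∀ x, w (-x) = w x := fun x => by simp [hw, hqev]
  have hwtan : ∀ x, (⟪w x, x⟫ : ℝ) = 0 := fun x => by
    simp only [hw, inner_sub_left, inner_smul_left, real_inner_self_eq_norm_sq]
    simp
    ring
  have hwne : ∀ x ∈ sphere 0 1, w x ≠ 0 := by
    intro x hx h0
    have hx1 : ‖x‖ = 1 := by simpa using hx
    have h1 : q x = (⟪q x, x⟫ : ℝ) • x := by
      have := sub_eq_zero.1 h0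
      simpa [hx1] using this
    have h2 : (⟪q x, v x⟫ : ℝ) = 0 := by
      rw [h1, inner_smul_left, real_inner_comm (v x), htan x hx, mul_zero]
    have h3 := hqv x hx
    have h4 := norm_sub_sq_real (q x) (v x)
    rw [h2] at h4
    nlinarith [norm_nonneg (q x - v x), norm_nonneg (v x), sq_nonneg ‖q x‖]
  have hopen : IsOpen {x | w x ≠ 0} := isOpen_ne_fun hws.continuous continuous_const
  obtain ⟨δ, hδ0, hδ⟩ := (isCompact_sphere (0 : EuclideanSpace ℝ (Fin D)) 1
    ).exists_thickening_subset_open hopen fun x hx => mem_ofPred.2 (hwne x hx)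
  have hann : ∀ x, 1 ≤ ‖x‖ → ‖x‖ < 1 + δ → w x ≠ 0 := by
    intro x h1 h2
    refine mem_ofPred.1 (hδ ((mem_thickening_iff).2 ⟨‖x‖⁻¹ • x, ?_, ?_⟩))
    · have : ‖x‖ ≠ 0 := by positivity
      simp [norm_smul, this]
    · have h0 : 0 < ‖x‖ := by linarith
      have : x - ‖x‖⁻¹ • x = (1 - ‖x‖⁻¹) • x := by module
      rw [dist_eq_norm, this, norm_smul, Real.norm_of_nonneg, sub_mul, inv_mul_cancel₀ h0.ne']
      · linarith
      · rw [sub_nonneg]; exact inv_le_one_of_one_le₀ h1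
  set R : ℝ := 1 + δ / 2 with hR
  let η : ContDiffBump (0 : EuclideanSpace ℝ (Fin D)) := ⟨1, R, one_pos, by linarith⟩
  have hηs : ContDiff ℝ 1 η := η.contDiff
  set G : EuclideanSpace ℝ (Fin D) → EuclideanSpace ℝ (Fin D) :=
    fun x => (1 - η x) • x + η x • w x with hG
  have hws1 : ContDiff ℝ 1 w := hws.of_le (by simp)
  have hGs : ContDiff ℝ 1 G :=
    ((contDiff_const.sub hηs).smul contDiff_id).add (hηs.smul hws1)
  have hGR : ∀ x, R ≤ ‖x‖ → G x = x := fun x hx => by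
    have : η x = 0 := η.zero_of_le_dist (by simpa using hx)
    simp [hG, this]
  have hG1 : ∀ x, ‖x‖ ≤ 1 → G x = w x := fun x hx => by
    have : η x = 1 := η.one_of_mem_closedBall (by simpa [η] using hx)
    simp [hG, this]
  have hGne : ∀ x, 1 ≤ ‖x‖ → G x ≠ 0 := by
    intro x hx h0
    rcases le_or_gt R ‖x‖ with h | h
    · rw [hGR x h] at h0
      simp [h0] at hx
      linarith
    · have h1 : (⟪G x, x⟫ : ℝ) = 0 := by rw [h0, inner_zero_left]
      simp only [hG, inner_add_left, inner_smul_left, hwtan, real_inner_self_eq_norm_sq] at h1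
      have h2 : 1 - η x = 0 := by
        have : ‖x‖ ≠ 0 := by positivity
        simpa [this] using h1
      have h3 : G x = w x := by simp [hG, (sub_eq_zero.1 h2).symm]
      exact hann x hx (by linarith) (h3 ▸ h0)
  have hcomp : IsCompact (closedBall (0 : EuclideanSpace ℝ (Fin D)) R \ ball 0 1) :=
    (isCompact_closedBall 0 R).diff isOpen_ball
  obtain ⟨c, hc0, hc⟩ : ∃ c > 0, ∀ x ∈ closedBall (0 : EuclideanSpace ℝ (Fin D)) R \ ball 0 1,
      c ≤ ‖G x‖ := by
    rcases (closedBall (0 : EuclideanSpace ℝ (Fin D)) R \ ball 0 1).eq_empty_or_nonempty with h | h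
    · exact ⟨1, one_pos, by simp [h]⟩
    · obtain ⟨y, hy, hym⟩ := hcomp.exists_isMinOn h hGs.continuous.norm.continuousOn
      exact ⟨‖G y‖, norm_pos_iff.2 (hGne y (by simpa using hy.2)), fun x hx => hym hx⟩
  have hAb : Bornology.IsBounded
      (ball (0 : EuclideanSpace ℝ (Fin D)) 1 ∩ {x | 0 < x ⟨0, hD⟩}) :=
    isBounded_ball.subset inter_subset_left
  have hAm : MeasurableSet (ball (0 : EuclideanSpace ℝ (Fin D)) 1 ∩ {x | 0 < x ⟨0, hD⟩}) :=
    measurableSet_ball.inter (isOpen_lt continuous_const (by fun_prop)).measurableSet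
  obtain ⟨N, hN, hNh⟩ := exists_int_density hws1 hAm hAb
  have hmain : ∀ h : EuclideanSpace ℝ (Fin D) → ℝ, Continuous h → HasCompactSupport h →
      tsupport h ⊆ ball 0 (min c 1) → ∫ x, h x = ∫ y, (1 + (-1) ^ D) * (h y * N y) := by
    intro h hh hcs hsub
    have hz : ∀ x, min c 1 ≤ ‖x‖ → h x = 0 := fun x hx => by
      by_contra h0
      have := hsub (subset_tsupport h (Function.mem_support.2 h0))
      simp only [mem_ball, dist_zero_right] at this
      linarith
    rw [integral_const_mul, ← hNh h hh hcs, ← setIntegral_comp_mul_det_of_even hD hws1 hwev hh]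
    have h1 : ∫ x, h x = ∫ x in ball 0 R, h x := by
      rw [setIntegral_eq_integral_of_forall_compl_eq_zero]
      intro x hx
      simp only [mem_ball, dist_zero_right, not_lt] at hx
      exact hz x ((min_le_right _ _).trans (by linarith))
    rw [h1, ← setIntegral_comp_mul_det hGs hGR hh]
    have h2 : ∫ x in ball 0 R, h (G x) * (fderiv ℝ G x).det =
        ∫ x in ball 0 1, h (G x) * (fderiv ℝ G x).det := by
      refine setIntegral_eq_of_subset_of_forall_sdiff_eq_zero measurableSet_ball
        (ball_subset_ball (by linarith)) fun x hx => ?_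
      rw [hz (G x) ((min_le_left _ _).trans (hc x ⟨ball_subset_closedBall hx.1, hx.2⟩)), zero_mul]
    rw [h2]
    refine setIntegral_congr_fun measurableSet_ball fun x hx => ?_
    have h3 : G =ᶠ[𝓝 x] w := by
      filter_upwards [isOpen_ball.mem_nhds hx] with y hy
      exact hG1 y (by simpa using (mem_ball.1 hy).le)
    simp only [h3.fderiv_eq, h3.eq_of_nhds]
  have hae := (isOpen_ball (x := (0 : EuclideanSpace ℝ (Fin D))) (ε := min c 1)
    ).ae_eq_zero_of_integral_contDiff_smul_eq_zero (μ := volume)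
    (f := fun y => 1 - (1 + (-1) ^ D) * (N y : ℝ)) ?_ ?_
  · have hpos : 0 < volume (ball (0 : EuclideanSpace ℝ (Fin D)) (min c 1)) :=
      measure_ball_pos _ _ (by positivity)
    have hfr : ∃ᵐ y, y ∈ ball (0 : EuclideanSpace ℝ (Fin D)) (min c 1) :=
      frequently_ae_mem_iff.2 hpos.ne'
    obtain ⟨y, hyb, hyi⟩ := (hfr.and_eventually hae).exists
    have hy := hyi hyb
    have hy' : (1 : ℤ) = (1 + (-1) ^ D) * N y := by exact_mod_cast sub_eq_zero.1 hy
    have : Even (1 + (-1 : ℤ) ^ D) := by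
      rcases neg_one_pow_eq_or ℤ D with h | h <;> simp [h]
    have := this.mul_right (N y)
    rw [← hy'] at this
    exact absurd this (by decide)
  · exact ((locallyIntegrable_const _).sub (hN.const_mul _).locallyIntegrable).locallyIntegrableOn _
  · intro h hh hcs hsub
    have hi1 : Integrable h := hh.continuous.integrable_of_hasCompactSupport hcs
    obtain ⟨C, hC⟩ := hh.continuous.bounded_above_of_compact_support hcs
    have hi2 : Integrable fun y => (1 + (-1) ^ D) * (h y * N y) :=
      (hN.bdd_mul hh.continuous.aestronglyMeasurable (Eventually.of_forall hC)).const_mul _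
    have := hmain h hh.continuous hcs hsub
    rw [← sub_eq_zero, ← integral_sub hi1 hi2] at this
    rw [← this]
    refine integral_congr_ae (Eventually.of_forall fun y => ?_)
    simp only [smul_eq_mul]
    ring

theorem no_even_tangent_field_of_finiteDimensional {V : Type*} [NormedAddCommGroup V]
    [InnerProductSpace ℝ V] [FiniteDimensional ℝ V] [Nontrivial V] (v : V → V)
    (hv : ContinuousOn v (sphere 0 1)) (hev : ∀ x ∈ sphere 0 1, v (-x) = v x)
    (htan : ∀ x ∈ sphere (0 : V) 1, (⟪v x, x⟫ : ℝ) = 0)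
    (hne : ∀ x ∈ sphere 0 1, v x ≠ 0) : False := by
  set L := (stdOrthonormalBasis ℝ V).repr with hL
  have hmem : ∀ y, y ∈ sphere (0 : EuclideanSpace ℝ (Fin (Module.finrank ℝ V))) 1 →
      L.symm y ∈ sphere (0 : V) 1 := fun y hy => by
    simpa using hy
  refine no_even_tangent_field (D := Module.finrank ℝ V) Module.finrank_pos
    (fun y => L (v (L.symm y))) ?_ ?_ ?_ ?_
  · exact L.continuous.comp_continuousOn (hv.comp L.symm.continuous.continuousOn hmem)
  · intro y hy
    simp only [map_neg, hev _ (hmem y hy)]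
  · intro y hy
    have := htan _ (hmem y hy)
    rw [← L.inner_map_map, L.apply_symm_apply] at this
    exact this
  · intro y hy h0
    exact hne _ (hmem y hy) (by simpa using h0)

/-- A homotopy of maps from the sphere to itself cannot join a constant map to a map `f` with
`f (-p) = R_p (f p)`. -/
theorem no_reflection_equivariant_homotopy {E : Type*} [NormedAddCommGroup E]
    [InnerProductSpace ℝ E] [FiniteDimensional ℝ E] (S : ℝ → E → E) (s₀ : E)
    (hS : ContinuousOn (fun q : ℝ × E => S q.1 q.2) (Icc (-1) 0 ×ˢ sphere 0 1))
    (hne : ∀ t ∈ Icc (-1 : ℝ) 0, ∀ p ∈ sphere 0 1, S t p ≠ 0) (hs₀ : s₀ ≠ 0)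
    (hconst : ∀ p ∈ sphere 0 1, S (-1) p = s₀)
    (hrefl : ∀ p ∈ sphere 0 1, S 0 (-p) = S 0 p - (2 * (⟪p, S 0 p⟫ : ℝ)) • p) : False := by
  let V := WithLp 2 (E × ℝ)
  have hnorm : ∀ P ∈ sphere (0 : V) 1, ‖P.fst‖ ^ 2 + P.snd ^ 2 = 1 := by
    intro P hP
    have := WithLp.prod_norm_sq_eq_of_L2 P
    rw [mem_sphere_zero_iff_norm.1 hP] at this
    simpa using this.symm
  set u : V → E := fun P => if P.fst = 0 then s₀ else S (-P.snd) (‖P.fst‖⁻¹ • P.fst) with hu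
  set f : V → V := fun P => WithLp.toLp 2
    (u P - ((⟪u P, P.fst⟫ : ℝ) / (1 + P.snd)) • P.fst, -(⟪u P, P.fst⟫ : ℝ)) with hf
  set H : Set V := sphere 0 1 ∩ {P | 0 ≤ P.snd} with hH
  set H' : Set V := sphere 0 1 ∩ {P | P.snd ≤ 0} with hH'
  have hdir : ∀ P : V, P.fst ≠ 0 → ‖P.fst‖⁻¹ • P.fst ∈ sphere (0 : E) 1 := by
    intro P h0
    have : ‖P.fst‖ ≠ 0 := by simpa using h0
    simp [norm_smul, this]
  have hK : IsCompact (Icc (-1 : ℝ) 0 ×ˢ sphere (0 : E) 1) :=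
    isCompact_Icc.prod (isCompact_sphere 0 1)
  have hfst : Continuous fun P : V => P.fst := continuous_fst.comp (WithLp.prod_continuous_ofLp 2 E ℝ)
  have hsnd : Continuous fun P : V => P.snd := continuous_snd.comp (WithLp.prod_continuous_ofLp 2 E ℝ)
  have hHIcc : ∀ P ∈ H, -P.snd ∈ Icc (-1 : ℝ) 0 := by
    rintro P ⟨h1, h2⟩
    have h2 : 0 ≤ P.snd := h2
    constructor <;> nlinarith [hnorm P h1, sq_nonneg ‖P.fst‖]
  have hucont : ContinuousOn u H := by
    intro P hP
    by_cases h0 : P.fst = 0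
    · have hz : P.snd = 1 := by
        have h2 : 0 ≤ P.snd := hP.2
        have := hnorm P hP.1
        rw [h0] at this
        simp at this
        rcases this with h | h <;> linarith
      rw [ContinuousWithinAt, Metric.tendsto_nhdsWithin_nhds]
      intro ε hε
      obtain ⟨δ, hδ, hSδ⟩ := Metric.uniformContinuousOn_iff.1
        (hK.uniformContinuousOn_of_continuous hS) ε hε
      obtain ⟨δ', hδ', hsδ⟩ := Metric.continuous_iff.1 hsnd P δ hδ
      refine ⟨δ', hδ', fun Q hQ hQP => ?_⟩
      have h1 := hsδ Q hQP
      have huP : u P = s₀ := by simp [hu, h0]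
      by_cases hQ0 : Q.fst = 0
      · simp [hu, hQ0, h0, hε]
      · rw [huP, ← hconst _ (hdir Q hQ0)]
        simp only [hu, hQ0, if_false]
        refine hSδ (-Q.snd, ‖Q.fst‖⁻¹ • Q.fst) ⟨hHIcc Q hQ, hdir Q hQ0⟩
          (-1, ‖Q.fst‖⁻¹ • Q.fst) ⟨by simp, hdir Q hQ0⟩ ?_
        rw [Prod.dist_eq, dist_self]
        simp only [hδ, max_lt_iff, and_true]
        rw [hz] at h1
        rwa [dist_neg_neg]
    · have h1 : ContinuousOn (fun Q : V => S (-Q.snd) (‖Q.fst‖⁻¹ • Q.fst)) (H ∩ {Q | Q.fst ≠ 0}) := by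
        refine hS.comp (f := fun Q : V => (-Q.snd, ‖Q.fst‖⁻¹ • Q.fst)) ?_ fun Q hQ =>
          ⟨hHIcc Q hQ.1, hdir Q hQ.2⟩
        refine hsnd.neg.continuousOn.prodMk ?_
        refine ContinuousOn.smul (hfst.norm.continuousOn.inv₀ fun Q hQ => ?_) hfst.continuousOn
        simpa using hQ.2
      have hopen : {Q : V | Q.fst ≠ 0} ∈ 𝓝 P :=
        (isOpen_ne_fun hfst continuous_const).mem_nhds h0
      have h2 := (h1 P ⟨hP, h0⟩)
      rw [continuousWithinAt_inter hopen] at h2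
      refine h2.congr_of_eventuallyEq ?_ (by simp [hu, h0])
      filter_upwards [mem_nhdsWithin_of_mem_nhds hopen] with Q hQ
      have hQ : Q.fst ≠ 0 := hQ
      simp [hu, hQ]
  have hfcont : ContinuousOn f H := by
    have hin : ContinuousOn (fun P : V => (⟪u P, P.fst⟫ : ℝ)) H := hucont.inner hfst.continuousOn
    refine (WithLp.prod_continuous_toLp 2 E ℝ).comp_continuousOn (ContinuousOn.prodMk ?_ hin.neg)
    refine hucont.sub (ContinuousOn.smul (hin.div (by fun_prop) fun P hP => ?_) hfst.continuousOn)
    have h2 : 0 ≤ P.snd := hP.2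
    positivity
  have hune : ∀ P ∈ H, u P ≠ 0 := by
    intro P hP
    by_cases h0 : P.fst = 0
    · simpa [hu, h0] using hs₀
    · simpa [hu, h0] using hne _ (hHIcc P hP) _ (hdir P h0)
  have hfne : ∀ P ∈ H, f P ≠ 0 := by
    intro P hP h0
    have h1 : (f P).snd = 0 := by rw [h0]; rfl
    have h2 : (f P).fst = 0 := by rw [h0]; rfl
    replace h1 : (⟪u P, P.fst⟫ : ℝ) = 0 := neg_eq_zero.1 h1
    change u P - ((⟪u P, P.fst⟫ : ℝ) / (1 + P.snd)) • P.fst = 0 at h2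
    rw [h1] at h2
    simp only [zero_div, zero_smul, sub_zero] at h2
    exact hune P hP h2
  have hftan : ∀ P ∈ H, (⟪f P, P⟫ : ℝ) = 0 := by
    intro P hP
    have h2 : 0 ≤ P.snd := hP.2
    rw [WithLp.prod_inner_apply]
    change (⟪u P - ((⟪u P, P.fst⟫ : ℝ) / (1 + P.snd)) • P.fst, P.fst⟫ : ℝ) +
      (⟪-(⟪u P, P.fst⟫ : ℝ), P.snd⟫ : ℝ) = 0
    rw [inner_sub_left, inner_smul_left, real_inner_self_eq_norm_sq,
      eq_sub_of_add_eq (hnorm P hP.1)]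
    simp only [conj_trivial, RCLike.inner_apply]
    field_simp
    ring
  have hnegH : ∀ P ∈ H', -P ∈ H := by
    rintro P ⟨h1, h2⟩
    have h2 : P.snd ≤ 0 := h2
    refine ⟨by simpa using h1, ?_⟩
    change 0 ≤ -P.snd
    linarith
  have hagree : ∀ P ∈ H, P.snd = 0 → f (-P) = f P := by
    intro P hP hz
    have hn := hnorm P hP.1
    have hn1 : ‖P.fst‖ = 1 := by
      rw [hz] at hn
      nlinarith [norm_nonneg P.fst]
    have h0 : P.fst ≠ 0 := by
      intro h; rw [h] at hn1; simp at hn1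
    have hu1 : u P = S 0 P.fst := by simp [hu, h0, hz, hn1]
    have hu2 : u (-P) = S 0 (-P.fst) := by
      have : (-P).fst = -P.fst := rfl
      have : (-P).snd = -P.snd := rfl
      simp [hu, h0, hz, hn1, *]
    have hr := hrefl P.fst (by simpa using hn1)
    have h3 : (⟪u (-P), (-P).fst⟫ : ℝ) = ⟪u P, P.fst⟫ := by
      have : (-P).fst = -P.fst := rfl
      rw [hu1, hu2, hr, this, inner_neg_right, inner_sub_left, inner_smul_left,
        real_inner_self_eq_norm_sq, hn1, real_inner_comm]
      simp
      ring
    simp only [hf, h3]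
    congr 2
    rw [hu2, hr, hu1]
    have e1 : (-P).fst = -P.fst := rfl
    have e2 : (-P).snd = -P.snd := rfl
    rw [e1, e2, hz, real_inner_comm]
    simp only [neg_zero, add_zero, div_one]
    module
  set v : V → V := fun P => if 0 ≤ P.snd then f P else f (-P) with hvdef
  have hvH : ∀ P ∈ H, v P = f P := fun P hP => if_pos hP.2
  have hvH' : ∀ P ∈ H', v P = f (-P) := by
    rintro P hP
    by_cases h : 0 ≤ P.snd
    · rw [hvH P ⟨hP.1, h⟩, hagree P ⟨hP.1, h⟩ (le_antisymm hP.2 h)]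
    · exact if_neg h
  have hunion : sphere (0 : V) 1 = H ∪ H' := by
    ext P
    constructor
    · intro h
      rcases le_total 0 P.snd with h1 | h1
      · exact Or.inl ⟨h, h1⟩
      · exact Or.inr ⟨h, h1⟩
    · rintro (h | h) <;> exact h.1
  have : Nontrivial V :=
    ⟨⟨0, WithLp.toLp 2 (0, 1), fun h => by
      have := congrArg WithLp.snd h
      simp at this⟩⟩
  refine no_even_tangent_field_of_finiteDimensional v ?_ ?_ ?_ ?_
  · rw [hunion]
    refine ContinuousOn.union_of_isClosed (hfcont.congr hvH) ?_ ?_ ?_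
    · refine ContinuousOn.congr ?_ hvH'
      exact hfcont.comp continuous_neg.continuousOn hnegH
    · exact isClosed_sphere.inter (isClosed_le continuous_const hsnd)
    · exact isClosed_sphere.inter (isClosed_le hsnd continuous_const)
  · intro P hP
    rw [hunion] at hP
    rcases hP with hP | hP
    · have h1 : -P ∈ H' := ⟨by simpa using hP.1, by
        have h2 : 0 ≤ P.snd := hP.2
        change -P.snd ≤ 0
        linarith⟩
      rw [hvH P hP, hvH' _ h1, neg_neg]
    · rw [hvH' P hP, hvH _ (hnegH P hP)]
  · intro P hP
    rw [hunion] at hP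
    rcases hP with hP | hP
    · rw [hvH P hP, hftan P hP]
    · have := hftan _ (hnegH P hP)
      rw [hvH' P hP]
      rwa [inner_neg_right, neg_eq_zero] at this
  · intro P hP
    rw [hunion] at hP
    rcases hP with hP | hP
    · rw [hvH P hP]; exact hfne P hP
    · rw [hvH' P hP]; exact hfne _ (hnegH P hP)

/-- The denominator of `d_ξ`. -/
def dDen {n : ℕ} (ξ x : Eu n) : ℝ := 1 + 2 * ⟪ξ, x⟫ + ‖x‖ ^ 2 * ‖ξ‖ ^ 2

/-- The conformal factor of `d_ξ`. -/
def dFac {n : ℕ} (ξ x : Eu n) : ℝ := (1 - ‖ξ‖ ^ 2) / dDen ξ x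

theorem dDen_pos {n : ℕ} {ξ x : Eu n} (hξ : ‖ξ‖ < 1) (hx : ‖x‖ ≤ 1) : 0 < dDen ξ x := by
  have h1 := abs_le.1 (abs_real_inner_le_norm ξ x)
  have h2 : ‖ξ‖ * ‖x‖ < 1 := by nlinarith [norm_nonneg ξ, norm_nonneg x]
  unfold dDen
  nlinarith [mul_self_pos.2 (sub_pos.2 h2).ne']

theorem one_sub_norm_sq_pos {n : ℕ} {ξ : Eu n} (hξ : ‖ξ‖ < 1) : 0 < 1 - ‖ξ‖ ^ 2 := by
  nlinarith [norm_nonneg ξ]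

theorem dFac_pos {n : ℕ} {ξ x : Eu n} (hξ : ‖ξ‖ < 1) (hx : ‖x‖ ≤ 1) : 0 < dFac ξ x :=
  div_pos (one_sub_norm_sq_pos hξ) (dDen_pos hξ hx)

theorem inner_dMap {n : ℕ} {ξ x : Eu n} (v : Eu n) :
    (⟪v, dMap ξ x⟫ : ℝ) = (dDen ξ x)⁻¹ *
      ((1 - ‖ξ‖ ^ 2) * ⟪v, x⟫ + (1 + 2 * ⟪ξ, x⟫ + ‖x‖ ^ 2) * ⟪v, ξ⟫) := by
  simp only [dMap, inner_smul_right, inner_add_right]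
  rfl

theorem inner_dMap_dMap {n : ℕ} {ξ x y : Eu n} :
    (⟪dMap ξ x, dMap ξ y⟫ : ℝ) = (dDen ξ x)⁻¹ * (dDen ξ y)⁻¹ *
      ((1 - ‖ξ‖ ^ 2) ^ 2 * ⟪x, y⟫ + (1 - ‖ξ‖ ^ 2) * (1 + 2 * ⟪ξ, y⟫ + ‖y‖ ^ 2) * ⟪ξ, x⟫
        + (1 - ‖ξ‖ ^ 2) * (1 + 2 * ⟪ξ, x⟫ + ‖x‖ ^ 2) * ⟪ξ, y⟫
        + (1 + 2 * ⟪ξ, x⟫ + ‖x‖ ^ 2) * (1 + 2 * ⟪ξ, y⟫ + ‖y‖ ^ 2) * ‖ξ‖ ^ 2) := by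
  rw [inner_dMap, real_inner_comm y, inner_dMap, real_inner_comm ξ (dMap ξ x), inner_dMap,
    real_inner_comm x y, real_inner_comm ξ y, real_inner_self_eq_norm_sq]
  ring

theorem one_sub_norm_dMap_sq {n : ℕ} {ξ x : Eu n} (hξ : ‖ξ‖ < 1) (hx : ‖x‖ ≤ 1) :
    1 - ‖dMap ξ x‖ ^ 2 = dFac ξ x * (1 - ‖x‖ ^ 2) := by
  have h := dDen_pos hξ hx
  rw [← real_inner_self_eq_norm_sq (dMap ξ x), inner_dMap_dMap, real_inner_self_eq_norm_sq, dFac]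
  field_simp
  unfold dDen
  ring

theorem norm_dMap_sub_dMap_sq {n : ℕ} {ξ x y : Eu n} (hξ : ‖ξ‖ < 1) (hx : ‖x‖ ≤ 1)
    (hy : ‖y‖ ≤ 1) :
    ‖dMap ξ x - dMap ξ y‖ ^ 2 = dFac ξ x * dFac ξ y * ‖x - y‖ ^ 2 := by
  have h1 := dDen_pos hξ hx
  have h2 := dDen_pos hξ hy
  have hx2 : ‖dMap ξ x‖ ^ 2 = 1 - dFac ξ x * (1 - ‖x‖ ^ 2) := by
    linarith [one_sub_norm_dMap_sq hξ hx]
  have hy2 : ‖dMap ξ y‖ ^ 2 = 1 - dFac ξ y * (1 - ‖y‖ ^ 2) := by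
    linarith [one_sub_norm_dMap_sq hξ hy]
  rw [norm_sub_sq_real, norm_sub_sq_real, inner_dMap_dMap, hx2, hy2]
  unfold dFac
  field_simp
  unfold dDen
  ring

theorem norm_dMap_le_one {n : ℕ} {ξ x : Eu n} (hξ : ‖ξ‖ < 1) (hx : ‖x‖ ≤ 1) :
    ‖dMap ξ x‖ ≤ 1 := by
  have h := one_sub_norm_dMap_sq hξ hx
  have h2 := mul_nonneg (dFac_pos hξ hx).le (show 0 ≤ 1 - ‖x‖ ^ 2 by nlinarith [norm_nonneg x])
  nlinarith [norm_nonneg (dMap ξ x)]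

theorem dMap_neg_dMap {n : ℕ} {ξ x : Eu n} (hξ : ‖ξ‖ < 1) (hx : ‖x‖ ≤ 1) :
    dMap (-ξ) (dMap ξ x) = x := by
  have h := dDen_pos hξ hx
  have ha := one_sub_norm_sq_pos hξ
  have hnorm := one_sub_norm_dMap_sq hξ hx
  have hN : ‖dMap ξ x‖ ^ 2 = 1 - dFac ξ x * (1 - ‖x‖ ^ 2) := by linarith
  have hin := inner_dMap (ξ := ξ) (x := x) ξ
  rw [real_inner_self_eq_norm_sq] at hin
  have hden : 1 + 2 * (⟪-ξ, dMap ξ x⟫ : ℝ) + ‖dMap ξ x‖ ^ 2 * ‖-ξ‖ ^ 2 =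
      (1 - ‖ξ‖ ^ 2) ^ 2 / dDen ξ x := by
    rw [inner_neg_left, hin, hN, norm_neg, dFac]
    field_simp
    unfold dDen
    ring
  have hco : 1 + 2 * (⟪-ξ, dMap ξ x⟫ : ℝ) + ‖dMap ξ x‖ ^ 2 =
      (1 - ‖ξ‖ ^ 2) * (1 + 2 * ⟪ξ, x⟫ + ‖x‖ ^ 2) / dDen ξ x := by
    rw [inner_neg_left, hin, hN, dFac]
    field_simp
    unfold dDen
    ring
  have hexp : dMap (-ξ) (dMap ξ x) = ((1 - ‖ξ‖ ^ 2) ^ 2 / dDen ξ x)⁻¹ •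
      ((1 - ‖ξ‖ ^ 2) • dMap ξ x +
        ((1 - ‖ξ‖ ^ 2) * (1 + 2 * ⟪ξ, x⟫ + ‖x‖ ^ 2) / dDen ξ x) • (-ξ)) := by
    rw [← hden, ← hco, dMap, norm_neg]
  have hd : dMap ξ x = (dDen ξ x)⁻¹ •
      ((1 - ‖ξ‖ ^ 2) • x + (1 + 2 * ⟪ξ, x⟫ + ‖x‖ ^ 2) • ξ) := rfl
  rw [hexp, hd]
  generalize (1 - ‖ξ‖ ^ 2) = a at *
  generalize (1 + 2 * ⟪ξ, x⟫ + ‖x‖ ^ 2 : ℝ) = b at *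
  generalize dDen ξ x = c at *
  simp only [smul_add, smul_smul, smul_neg]
  have e1 : (a ^ 2 / c)⁻¹ * (a * (c⁻¹ * a)) = 1 := by field_simp
  have e2 : (a ^ 2 / c)⁻¹ * (a * (c⁻¹ * b)) = (a ^ 2 / c)⁻¹ * (a * b / c) := by field_simp
  rw [e1, e2]
  simp

/-- A conformal transformation `T` of the closed unit ball with inverse `T'` and conformal factor
`l`. -/
structure IsMob {n : ℕ} (T T' : Eu n → Eu n) (l : Eu n → ℝ) : Prop where
  left_inv : ∀ x, ‖x‖ ≤ 1 → T' (T x) = x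
  right_inv : ∀ x, ‖x‖ ≤ 1 → T (T' x) = x
  norm_inv : ∀ x, ‖x‖ ≤ 1 → ‖T' x‖ ≤ 1
  pos : ∀ x, ‖x‖ ≤ 1 → 0 < l x
  norm_sq : ∀ x, ‖x‖ ≤ 1 → 1 - ‖T x‖ ^ 2 = l x * (1 - ‖x‖ ^ 2)
  dist_sq : ∀ x y, ‖x‖ ≤ 1 → ‖y‖ ≤ 1 → ‖T x - T y‖ ^ 2 = l x * l y * ‖x - y‖ ^ 2

namespace IsMob

variable {n : ℕ} {T T' S S' : Eu n → Eu n} {l k : Eu n → ℝ}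

theorem norm_le (h : IsMob T T' l) {x : Eu n} (hx : ‖x‖ ≤ 1) : ‖T x‖ ≤ 1 := by
  have h1 := h.norm_sq x hx
  have h2 := mul_nonneg (h.pos x hx).le (show 0 ≤ 1 - ‖x‖ ^ 2 by nlinarith [norm_nonneg x])
  nlinarith [norm_nonneg (T x)]

theorem norm_lt (h : IsMob T T' l) {x : Eu n} (hx : ‖x‖ < 1) : ‖T x‖ < 1 := by
  have h1 := h.norm_sq x hx.le
  have h2 := mul_pos (h.pos x hx.le) (one_sub_norm_sq_pos hx)
  nlinarith [norm_nonneg (T x)]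

theorem norm_eq (h : IsMob T T' l) {x : Eu n} (hx : ‖x‖ = 1) : ‖T x‖ = 1 := by
  have h1 := h.norm_sq x hx.le
  rw [hx] at h1
  have : ‖T x‖ ^ 2 = 1 := by linarith
  nlinarith [norm_nonneg (T x)]

theorem norm_inv_lt (h : IsMob T T' l) {x : Eu n} (hx : ‖x‖ < 1) : ‖T' x‖ < 1 := by
  have h0 := h.norm_inv x hx.le
  have h1 := h.norm_sq (T' x) h0
  rw [h.right_inv x hx.le] at h1
  have h2 := one_sub_norm_sq_pos hx
  rw [h1] at h2
  have h3 := (mul_pos_iff_of_pos_left (h.pos _ h0)).1 h2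
  nlinarith [norm_nonneg (T' x)]

theorem norm_inv_eq (h : IsMob T T' l) {x : Eu n} (hx : ‖x‖ = 1) : ‖T' x‖ = 1 := by
  have h0 := h.norm_inv x hx.le
  have h1 := h.norm_sq (T' x) h0
  rw [h.right_inv x hx.le, hx] at h1
  have h2 : 1 - ‖T' x‖ ^ 2 = 0 := by
    have := (h.pos _ h0).ne'
    have h3 : l (T' x) * (1 - ‖T' x‖ ^ 2) = 0 := by linarith
    simpa [this] using h3
  nlinarith [norm_nonneg (T' x)]

theorem comp (hS : IsMob S S' k) (hT : IsMob T T' l) :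
    IsMob (S ∘ T) (T' ∘ S') (fun x => k (T x) * l x) where
  left_inv x hx := by simp [hS.left_inv _ (hT.norm_le hx), hT.left_inv x hx]
  right_inv x hx := by simp [hT.right_inv _ (hS.norm_inv x hx), hS.right_inv x hx]
  norm_inv x hx := hT.norm_inv _ (hS.norm_inv x hx)
  pos x hx := mul_pos (hS.pos _ (hT.norm_le hx)) (hT.pos x hx)
  norm_sq x hx := by
    simp only [Function.comp_apply]
    rw [hS.norm_sq _ (hT.norm_le hx), hT.norm_sq x hx, mul_assoc]
  dist_sq x y hx hy := by
    simp only [Function.comp_apply]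
    rw [hS.dist_sq _ _ (hT.norm_le hx) (hT.norm_le hy), hT.dist_sq x y hx hy]
    ring

end IsMob

theorem isMob_dMap {n : ℕ} {ξ : Eu n} (hξ : ‖ξ‖ < 1) : IsMob (dMap ξ) (dMap (-ξ)) (dFac ξ) where
  left_inv x hx := dMap_neg_dMap hξ hx
  right_inv x hx := by
    have := dMap_neg_dMap (ξ := -ξ) (by rwa [norm_neg]) hx
    rwa [neg_neg] at this
  norm_inv x hx := norm_dMap_le_one (by rwa [norm_neg]) hx
  pos x hx := dFac_pos hξ hx
  norm_sq x hx := one_sub_norm_dMap_sq hξ hx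
  dist_sq x y hx hy := norm_dMap_sub_dMap_sq hξ hx hy

theorem Refl_Refl {n : ℕ} {p : Eu n} (hp : ‖p‖ = 1) (x : Eu n) : Refl p (Refl p x) = x := by
  simp only [Refl, inner_sub_right, inner_smul_right, real_inner_self_eq_norm_sq, hp]
  module

theorem norm_Refl {n : ℕ} {p : Eu n} (hp : ‖p‖ = 1) (x : Eu n) : ‖Refl p x‖ = ‖x‖ := by
  have : ‖Refl p x‖ ^ 2 = ‖x‖ ^ 2 := by
    rw [Refl, norm_sub_sq_real, inner_smul_right, norm_smul, hp, real_inner_comm, mul_one,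
      Real.norm_eq_abs, sq_abs]
    ring
  exact (sq_eq_sq₀ (norm_nonneg _) (norm_nonneg _)).1 this

theorem Refl_sub {n : ℕ} (p x y : Eu n) : Refl p (x - y) = Refl p x - Refl p y := by
  simp only [Refl, inner_sub_right]
  module

theorem isMob_Refl {n : ℕ} {p : Eu n} (hp : ‖p‖ = 1) :
    IsMob (Refl p) (Refl p) (fun _ => 1) where
  left_inv x _ := Refl_Refl hp x
  right_inv x _ := Refl_Refl hp x
  norm_inv x hx := by rwa [norm_Refl hp]
  pos _ _ := one_pos
  norm_sq x _ := by rw [norm_Refl hp, one_mul]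
  dist_sq x y _ _ := by rw [← Refl_sub, norm_Refl hp, one_mul, one_mul]

/-- The conformal factor of `τ_{a_{r,p}}`. -/
def tauFac {n : ℕ} (r : ℝ) (p x : Eu n) : ℝ :=
  dFac (r • p) (Refl p (dMap (-(r • p)) x)) * (1 * dFac (-(r • p)) x)

theorem norm_smul_lt_one {n : ℕ} {r : ℝ} (hr : r ∈ Ioo (-1 : ℝ) 1) {p : Eu n} (hp : ‖p‖ = 1) :
    ‖r • p‖ < 1 := by
  rw [norm_smul, hp, mul_one, Real.norm_eq_abs, abs_lt]
  exact hr

theorem isMob_tauMap {n : ℕ} {r : ℝ} (hr : r ∈ Ioo (-1 : ℝ) 1) {p : Eu n} (hp : ‖p‖ = 1) :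
    IsMob (tauMap r p) (tauMap r p) (tauFac r p) := by
  have h := norm_smul_lt_one hr hp
  have h1 := (isMob_dMap h).comp ((isMob_Refl hp).comp (isMob_dMap (ξ := -(r • p))
    (by rwa [norm_neg])))
  rw [neg_neg] at h1
  exact h1

section Renorm

variable {n : ℕ} {T T' : Eu n → Eu n} {l : Eu n → ℝ}

theorem dDen_of_norm_eq_one {ξ x : Eu n} (hx : ‖x‖ = 1) : dDen ξ x = ‖x + ξ‖ ^ 2 := by
  rw [norm_add_sq_real, dDen, hx, real_inner_comm]
  ring

theorem IsMob.dFac_mul (hT : IsMob T T' l) {ξ : Eu n} (hξ : ‖ξ‖ < 1) {x : Eu n}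
    (hx : ‖x‖ = 1) : dFac ξ (T x) * l x = dFac (-T' (-ξ)) x := by
  set ζ := -T' (-ξ) with hζ
  have hξ' : ‖-ξ‖ < 1 := by rwa [norm_neg]
  have hζ1 : ‖-ζ‖ < 1 := by rw [hζ, neg_neg]; exact hT.norm_inv_lt hξ'
  have hTζ : T (-ζ) = -ξ := by rw [hζ, neg_neg, hT.right_inv _ hξ'.le]
  have h1 := hT.dist_sq x (-ζ) hx.le hζ1.le
  rw [hTζ, sub_neg_eq_add, sub_neg_eq_add] at h1
  have h2 := hT.norm_sq (-ζ) hζ1.le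
  rw [hTζ, norm_neg, norm_neg] at h2
  have hζ2 : ‖ζ‖ < 1 := by rwa [norm_neg] at hζ1
  have hd : 0 < ‖x + ζ‖ ^ 2 := by
    rw [← dDen_of_norm_eq_one hx]; exact dDen_pos hζ2 hx.le
  have hl := hT.pos x hx.le
  have hl' := hT.pos (-ζ) hζ1.le
  rw [dFac, dFac, dDen_of_norm_eq_one (hT.norm_eq hx), dDen_of_norm_eq_one hx, h1, h2]
  field_simp

theorem inner_eq_of_norm_eq_one {x y : Eu n} (hx : ‖x‖ = 1) (hy : ‖y‖ = 1) :
    (⟪x, y⟫ : ℝ) = 1 - ‖x - y‖ ^ 2 / 2 := by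
  rw [norm_sub_sq_real, hx, hy]
  ring

theorem IsMob.inner_dMap_comp (hT : IsMob T T' l) {ξ : Eu n} (hξ : ‖ξ‖ < 1) {x y : Eu n}
    (hx : ‖x‖ = 1) (hy : ‖y‖ = 1) :
    (⟪dMap ξ (T x), dMap ξ (T y)⟫ : ℝ) = ⟪dMap (-T' (-ξ)) x, dMap (-T' (-ξ)) y⟫ := by
  have hζ : ‖-T' (-ξ)‖ < 1 := by rw [norm_neg]; exact hT.norm_inv_lt (by rwa [norm_neg])
  have h1 := (isMob_dMap hξ).comp hT
  change (⟪(dMap ξ ∘ T) x, (dMap ξ ∘ T) y⟫ : ℝ) = _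
  rw [inner_eq_of_norm_eq_one (h1.norm_eq hx) (h1.norm_eq hy),
    inner_eq_of_norm_eq_one ((isMob_dMap hζ).norm_eq hx) ((isMob_dMap hζ).norm_eq hy),
    norm_dMap_sub_dMap_sq hζ hx.le hy.le, h1.dist_sq x y hx.le hy.le, hT.dFac_mul hξ hx,
    hT.dFac_mul hξ hy]

theorem IsMob.inner_dMap_comp_eq (hT : IsMob T T' l) {ξ : Eu n} (hξ : ‖ξ‖ < 1) {x s : Eu n}
    (hx : ‖x‖ = 1) (hs : ‖s‖ = 1) :
    (⟪s, dMap ξ (T x)⟫ : ℝ) =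
      ⟪dMap (-T' (-ξ)) (T' (dMap (-ξ) s)), dMap (-T' (-ξ)) x⟫ := by
  have h1 : ‖T' (dMap (-ξ) s)‖ = 1 := hT.norm_inv_eq ((isMob_dMap hξ).norm_inv_eq hs)
  rw [← hT.inner_dMap_comp hξ h1 hx, hT.right_inv _ ((isMob_dMap hξ).norm_inv _ hs.le),
    (isMob_dMap hξ).right_inv _ hs.le]

end Renorm

section Caps

variable {n : ℕ}

theorem measurable_dMap (ξ : Eu n) : Measurable (dMap ξ) := by
  unfold dMap
  fun_prop

theorem measurable_Refl (p : Eu n) : Measurable (Refl p) := by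
  unfold Refl
  fun_prop

theorem measurable_tauMap (r : ℝ) (p : Eu n) : Measurable (tauMap r p) :=
  (measurable_dMap _).comp ((measurable_Refl p).comp (measurable_dMap _))

theorem continuousOn_dMap :
    ContinuousOn (fun q : Eu n × Eu n => dMap q.1 q.2) {q | ‖q.1‖ < 1 ∧ ‖q.2‖ ≤ 1} := by
  have h1 : Continuous fun q : Eu n × Eu n =>
      1 + 2 * (⟪q.1, q.2⟫ : ℝ) + ‖q.2‖ ^ 2 * ‖q.1‖ ^ 2 := by fun_prop
  have h2 : Continuous fun q : Eu n × Eu n =>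
      (1 - ‖q.1‖ ^ 2) • q.2 + (1 + 2 * (⟪q.1, q.2⟫ : ℝ) + ‖q.2‖ ^ 2) • q.1 := by fun_prop
  refine ContinuousOn.smul (h1.continuousOn.inv₀ ?_) h2.continuousOn
  rintro ⟨ξ, x⟩ h
  exact (dDen_pos h.1 h.2).ne'

/-- The function whose sign tells on which side of the boundary of `a_{r,p}` a point lies. -/
def side (r : ℝ) (p x : Eu n) : ℝ := (1 + r ^ 2) * ⟪p, x⟫ - 2 * r

theorem side_neg (r : ℝ) (p x : Eu n) : side (-r) (-p) x = -side r p x := by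
  simp only [side, inner_neg_left]
  ring

theorem continuous_side (r : ℝ) (p : Eu n) : Continuous (side r p) := by
  unfold side
  fun_prop

theorem inner_dMap_neg_smul (r : ℝ) {p x : Eu n} (hp : ‖p‖ = 1) (hx : ‖x‖ = 1) :
    (⟪p, dMap (-(r • p)) x⟫ : ℝ) = (dDen (-(r • p)) x)⁻¹ * side r p x := by
  rw [inner_dMap, side, norm_neg, norm_smul, hp, hx, inner_neg_right, inner_neg_left,
    inner_smul_right, inner_smul_left, real_inner_self_eq_norm_sq, hp, mul_one, Real.norm_eq_abs,
    sq_abs]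
  congr 1
  simp only [conj_trivial]
  ring

theorem inner_dMap_pos_iff {r : ℝ} (hr : r ∈ Ioo (-1 : ℝ) 1) {p x : Eu n} (hp : ‖p‖ = 1)
    (hx : ‖x‖ = 1) : 0 < (⟪p, dMap (-(r • p)) x⟫ : ℝ) ↔ 0 < side r p x := by
  have h := dDen_pos (ξ := -(r • p)) (by rw [norm_neg]; exact norm_smul_lt_one hr hp) hx.le
  rw [inner_dMap_neg_smul r hp hx, mul_pos_iff_of_pos_left (inv_pos.2 h)]

theorem inner_Refl_left {p : Eu n} (hp : ‖p‖ = 1) (x : Eu n) :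
    (⟪p, Refl p x⟫ : ℝ) = -⟪p, x⟫ := by
  rw [Refl, inner_sub_right, inner_smul_right, real_inner_self_eq_norm_sq, hp]
  ring

theorem side_tauMap_pos_iff {r : ℝ} (hr : r ∈ Ioo (-1 : ℝ) 1) {p x : Eu n} (hp : ‖p‖ = 1)
    (hx : ‖x‖ = 1) : 0 < side r p (tauMap r p x) ↔ side r p x < 0 := by
  have h0 : ‖-(r • p)‖ < 1 := by rw [norm_neg]; exact norm_smul_lt_one hr hp
  have h1 : ‖dMap (-(r • p)) x‖ ≤ 1 := norm_dMap_le_one h0 hx.le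
  have h2 := dDen_pos h0 hx.le
  have h3 : dMap (-(r • p)) (tauMap r p x) = Refl p (dMap (-(r • p)) x) := by
    rw [tauMap, Function.comp_apply, Function.comp_apply,
      dMap_neg_dMap (norm_smul_lt_one hr hp) (by rwa [norm_Refl hp])]
  rw [← inner_dMap_pos_iff hr hp ((isMob_tauMap hr hp).norm_eq hx), h3, inner_Refl_left hp,
    inner_dMap_neg_smul r hp hx, neg_pos, mul_neg_iff]
  have := inv_pos.2 h2
  constructor
  · rintro (h | h)
    · exact h.2
    · exact absurd h.1 this.le.not_gt
  · exact fun h => Or.inl ⟨this, h⟩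

theorem cap_eq {r : ℝ} (hr : r ∈ Ioo (-1 : ℝ) 1) {p : Eu n} (hp : ‖p‖ = 1) :
    cap n r p = {x | ‖x‖ = 1 ∧ 0 < side r p x} := by
  have hm := isMob_dMap (norm_smul_lt_one hr hp)
  ext x
  constructor
  · rintro ⟨y, ⟨hy1, hy2⟩, rfl⟩
    have hy : ‖y‖ = 1 := by simpa [sphSet] using hy1
    refine ⟨hm.norm_eq hy, (inner_dMap_pos_iff hr hp (hm.norm_eq hy)).1 ?_⟩
    rwa [hm.left_inv y hy.le]
  · rintro ⟨hx, hs⟩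
    refine ⟨dMap (-(r • p)) x, ⟨?_, (inner_dMap_pos_iff hr hp hx).2 hs⟩, hm.right_inv x hx.le⟩
    simpa [sphSet] using hm.norm_inv_eq hx

theorem tauMap_neg (r : ℝ) (p : Eu n) : tauMap (-r) (-p) = tauMap r p := by
  have h : Refl (-p) = Refl p := by
    ext1 x
    simp only [Refl, inner_neg_left]
    module
  rw [tauMap, tauMap, h, neg_smul_neg]

/-- The folding map of the sphere onto the cap `a_{r,p}`. -/
def fold (r : ℝ) (p x : Eu n) : Eu n := if 0 < side r p x then x else tauMap r p x

theorem measurable_fold (r : ℝ) (p : Eu n) : Measurable (fold r p) :=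
  Measurable.ite (measurableSet_lt measurable_const (continuous_side r p).measurable)
    measurable_id (measurable_tauMap r p)

theorem norm_fold {r : ℝ} (hr : r ∈ Ioo (-1 : ℝ) 1) {p x : Eu n} (hp : ‖p‖ = 1)
    (hx : ‖x‖ = 1) : ‖fold r p x‖ = 1 := by
  unfold fold
  split_ifs
  exacts [hx, (isMob_tauMap hr hp).norm_eq hx]

theorem fold_neg {r : ℝ} (hr : r ∈ Ioo (-1 : ℝ) 1) {p x : Eu n} (hp : ‖p‖ = 1)
    (hx : ‖x‖ = 1) (hs : side r p x ≠ 0) : fold (-r) (-p) x = tauMap r p (fold r p x) := by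
  unfold fold
  rw [side_neg, tauMap_neg]
  rcases hs.lt_or_gt with h | h
  · rw [if_pos (neg_pos.2 h), if_neg h.not_gt, (isMob_tauMap hr hp).left_inv x hx.le]
  · rw [if_neg (by linarith), if_pos h]

theorem testFun_eq {r : ℝ} (hr : r ∈ Ioo (-1 : ℝ) 1) {p x : Eu n} (hp : ‖p‖ = 1)
    (hx : ‖x‖ = 1) (ξ s : Eu n) : testFun n ξ r p s x = ⟪s, dMap ξ (fold r p x)⟫ := by
  unfold testFun fold
  simp only [inner_dMap_pos_iff hr hp hx, Xfun]
  split_ifs <;> rfl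

end Caps

section Measures

variable {n : ℕ}

instance : IsFiniteMeasure (sphMeasure n) := by
  unfold sphMeasure
  infer_instance

theorem ae_sphMeasure_norm : ∀ᵐ x ∂(sphMeasure n), ‖x‖ = 1 := by
  unfold sphMeasure
  rw [ae_map_iff measurable_subtype_coe.aemeasurable
    (measurableSet_eq_fun continuous_norm.measurable measurable_const)]
  exact ae_of_all _ fun x => by simp

theorem sphMeasure_apply_le {A : Set (Eu n)} (hA : MeasurableSet A) :
    sphMeasure n A ≤ (n + 1 : ℕ) *
      volume {y : Eu n | ∃ t ∈ Ioo (0 : ℝ) 1, ∃ x, ‖x‖ = 1 ∧ x ∈ A ∧ y = t • x} := by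
  unfold sphMeasure
  rw [Measure.map_apply measurable_subtype_coe hA,
    Measure.toSphere_apply' _ (measurable_subtype_coe hA)]
  simp only [finrank_euclideanSpace, Fintype.card_fin]
  gcongr
  rintro y ⟨t, ht, x, ⟨z, hz, rfl⟩, rfl⟩
  exact ⟨t, ht, z, by simp, hz, rfl⟩

theorem volume_cone_eq_zero {ρ : ℝ} (hρ : |ρ| < 1) {p : Eu n} (hp : ‖p‖ = 1) :
    volume {y : Eu n | (⟪p, y⟫ : ℝ) = ρ * ‖y‖} = 0 := by
  refine Measure.addHaar_eq_zero_of_disjoint_translates volume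
    (fun k : ℕ => ((k : ℝ) + 1)⁻¹ • p) ?_ ?_ ?_
  · refine (isBounded_closedBall (x := (0 : Eu n)) (r := 1)).subset ?_
    rintro _ ⟨k, rfl⟩
    have hk : (0 : ℝ) < k + 1 := by positivity
    rw [mem_closedBall_zero_iff, norm_smul, hp, mul_one, Real.norm_of_nonneg (by positivity)]
    exact inv_le_one_of_one_le₀ (by linarith [(Nat.cast_nonneg k : (0 : ℝ) ≤ k)])
  · intro j k hjk
    rw [Function.onFun, Set.disjoint_left]
    rintro y hj hk
    simp only [singleton_add, image_add_left, mem_preimage, mem_ofPred_eq] at hj hk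
    set a : ℝ := ((j : ℝ) + 1)⁻¹ with ha
    set b : ℝ := ((k : ℝ) + 1)⁻¹ with hb
    have hab : a ≠ b := by
      intro h
      rw [ha, hb, inv_inj] at h
      exact hjk (by exact_mod_cast (add_right_cancel h))
    have h1 : (⟪p, -(a • p) + y⟫ : ℝ) = -a + ⟪p, y⟫ := by
      rw [inner_add_right, inner_neg_right, inner_smul_right, real_inner_self_eq_norm_sq, hp]
      ring
    have h2 : (⟪p, -(b • p) + y⟫ : ℝ) = -b + ⟪p, y⟫ := by
      rw [inner_add_right, inner_neg_right, inner_smul_right, real_inner_self_eq_norm_sq, hp]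
      ring
    rw [h1] at hj
    rw [h2] at hk
    have h3 : |‖-(a • p) + y‖ - ‖-(b • p) + y‖| ≤ |b - a| := by
      refine (abs_norm_sub_norm_le _ _).trans ?_
      rw [show -(a • p) + y - (-(b • p) + y) = (b - a) • p by module, norm_smul, hp, mul_one,
        Real.norm_eq_abs]
    have h4 : b - a = ρ * (‖-(a • p) + y‖ - ‖-(b • p) + y‖) := by linarith
    have h5 : 0 < |b - a| := abs_pos.2 (sub_ne_zero.2 hab.symm)
    have h6 : |b - a| ≤ |ρ| * |b - a| := by
      conv_lhs => rw [h4, abs_mul]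
      gcongr
    nlinarith
  · exact measurableSet_eq_fun (by fun_prop) (by fun_prop)

theorem ae_side_ne_zero_of_mem_Ioo {r : ℝ} (hr : r ∈ Ioo (-1 : ℝ) 1) {p : Eu n}
    (hp : ‖p‖ = 1) : ∀ᵐ x ∂(sphMeasure n), side r p x ≠ 0 := by
  have hpos : 0 < 1 + r ^ 2 := by positivity
  have hA : MeasurableSet {x : Eu n | side r p x = 0} :=
    measurableSet_eq_fun (continuous_side r p).measurable measurable_const
  rw [ae_iff, ← nonpos_iff_eq_zero]
  simp only [ne_eq, not_not]
  refine (sphMeasure_apply_le hA).trans ?_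
  rw [nonpos_iff_eq_zero, mul_eq_zero]
  right
  refine measure_mono_null ?_ (volume_cone_eq_zero (ρ := 2 * r / (1 + r ^ 2)) ?_ hp)
  · rintro y ⟨t, ht, x, hx, hxs, rfl⟩
    have h1 : side r p x = 0 := hxs
    rw [side] at h1
    rw [mem_ofPred_eq, norm_smul, hx, inner_smul_right, Real.norm_of_nonneg ht.1.le]
    have h2 : (⟪p, x⟫ : ℝ) = 2 * r / (1 + r ^ 2) := by
      rw [eq_div_iff hpos.ne']
      linarith
    rw [h2]
    ring
  · rw [abs_div, abs_of_pos hpos, div_lt_one hpos, abs_lt]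
    constructor <;> nlinarith [hr.1, hr.2]

theorem exists_norm_eq_one_inner_eq_zero (hn : 2 ≤ n) (a : Eu n) :
    ∃ q : Eu n, ‖q‖ = 1 ∧ (⟪q, a⟫ : ℝ) = 0 := by
  have h1 : (ℝ ∙ a)ᗮ ≠ ⊥ := by
    intro h
    rw [Submodule.orthogonal_eq_bot_iff] at h
    have h2 := finrank_span_le_card (R := ℝ) ({a} : Set (Eu n))
    rw [Set.toFinset_singleton, Finset.card_singleton, h, finrank_top, finrank_euclideanSpace, Fintype.card_fin] at h2
    omega
  obtain ⟨b, hb, hb0⟩ := Submodule.exists_mem_ne_zero_of_ne_bot h1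
  refine ⟨‖b‖⁻¹ • b, norm_smul_inv_norm hb0, ?_⟩
  rw [inner_smul_left, real_inner_comm, Submodule.mem_orthogonal_singleton_iff_inner_right.1 hb,
    mul_zero]

theorem sphMeasure_singleton (hn : 2 ≤ n) (a : Eu n) : sphMeasure n {a} = 0 := by
  obtain ⟨q, hq, hqa⟩ := exists_norm_eq_one_inner_eq_zero hn a
  have h := ae_side_ne_zero_of_mem_Ioo (r := 0) (by norm_num) hq
  rw [ae_iff] at h
  refine measure_mono_null ?_ h
  rintro _ rfl
  simp [side, hqa]

theorem eq_of_inner_eq_one {p x : Eu n} (hp : ‖p‖ = 1) (hx : ‖x‖ = 1)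
    (h : (⟪p, x⟫ : ℝ) = 1) : x = p := by
  have h1 : ‖x - p‖ ^ 2 = 0 := by
    rw [norm_sub_sq_real, real_inner_comm, h, hp, hx]
    norm_num
  rwa [sq_eq_zero_iff, norm_eq_zero, sub_eq_zero] at h1

theorem ae_side_ne_zero (hn : 2 ≤ n) {r : ℝ} (hr : r ∈ Icc (-1 : ℝ) 1) {p : Eu n}
    (hp : ‖p‖ = 1) : ∀ᵐ x ∂(sphMeasure n), side r p x ≠ 0 := by
  have key : ∀ a : Eu n, ∀ᵐ x ∂(sphMeasure n), x ≠ a := fun a => by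
    rw [ae_iff]
    simpa using sphMeasure_singleton hn a
  rcases hr.1.eq_or_lt with rfl | h1
  · filter_upwards [key (-p), ae_sphMeasure_norm] with x hx hx1 h
    refine hx (eq_of_inner_eq_one (by rwa [norm_neg]) hx1 ?_)
    rw [side] at h
    rw [inner_neg_left]
    linarith
  rcases hr.2.eq_or_lt with rfl | h2
  · filter_upwards [key p, ae_sphMeasure_norm] with x hx hx1 h
    refine hx (eq_of_inner_eq_one hp hx1 ?_)
    rw [side] at h
    linarith
  · exact ae_side_ne_zero_of_mem_Ioo ⟨h1, h2⟩ hp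

theorem confMeasure_absolutelyContinuous (w : Eu n → ℝ) :
    confMeasure n w ≪ sphMeasure n :=
  withDensity_absolutelyContinuous _ _

theorem capMeasure_eq_map {w : Eu n → ℝ} {r : ℝ} (hr : r ∈ Ioo (-1 : ℝ) 1)
    {p : Eu n} (hp : ‖p‖ = 1) :
    capMeasure n w r p = Measure.map (fold r p) (confMeasure n w) := by
  have hac := confMeasure_absolutelyContinuous w
  have hC : MeasurableSet {x : Eu n | ‖x‖ = 1 ∧ 0 < side r p x} :=
    (measurableSet_eq_fun continuous_norm.measurable measurable_const).inter
      (measurableSet_lt measurable_const (continuous_side r p).measurable)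
  have hP : MeasurableSet {x : Eu n | 0 < side r p x} :=
    measurableSet_lt measurable_const (continuous_side r p).measurable
  ext A hA
  rw [capMeasure, cap_eq hr hp, Measure.restrict_apply hA, Measure.add_apply,
    Measure.map_apply (measurable_tauMap r p) (hA.inter hC), Measure.map_apply
    (measurable_fold r p) hA, ← measure_inter_add_sdiff (fold r p ⁻¹' A) hP]
  congr 1
  · refine measure_congr (eventuallyEq_set.2 ?_)
    filter_upwards [hac.ae_le ae_sphMeasure_norm] with x hx
    constructor
    · rintro ⟨h1, -, h2⟩
      refine ⟨?_, h2⟩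
      rw [mem_preimage, fold, if_pos h2]
      exact h1
    · rintro ⟨h1, h2⟩
      have h2' : 0 < side r p x := h2
      rw [mem_preimage, fold, if_pos h2'] at h1
      exact ⟨h1, hx, h2⟩
  · refine measure_congr (eventuallyEq_set.2 ?_)
    filter_upwards [hac.ae_le ae_sphMeasure_norm, hac.ae_le (ae_side_ne_zero_of_mem_Ioo hr hp)]
      with x hx hx0
    constructor
    · rintro ⟨h1, -, h2⟩
      have h3 := (side_tauMap_pos_iff hr hp hx).1 h2
      refine ⟨?_, h3.not_gt⟩
      rw [mem_preimage, fold, if_neg h3.not_gt]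
      exact h1
    · rintro ⟨h1, h2⟩
      have h2' : ¬ 0 < side r p x := h2
      rw [mem_preimage, fold, if_neg h2'] at h1
      exact ⟨h1, (isMob_tauMap hr hp).norm_eq hx,
        (side_tauMap_pos_iff hr hp hx).2 (lt_of_le_of_ne (not_lt.1 h2') hx0)⟩

end Measures

section Renormalization

variable {n : ℕ}

theorem inner_dMap_smul_ge {t : ℝ} (ht0 : 0 ≤ t) (ht1 : t < 1) {u x : Eu n} (hu : ‖u‖ = 1)
    (hx : ‖x‖ = 1) :
    (⟪u, x⟫ : ℝ) + t / 2 * (1 - ⟪u, x⟫ ^ 2) ≤ ⟪u, dMap (t • u) x⟫ := by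
  have hc := abs_le.1 (abs_real_inner_le_norm u x)
  rw [hu, hx, mul_one] at hc
  have hD := dDen_pos (ξ := t • u) (x := x) (by
    rw [norm_smul, hu, mul_one, Real.norm_of_nonneg ht0]; exact ht1) hx.le
  have hDe : dDen (t • u) x = 1 + 2 * t * ⟪u, x⟫ + t ^ 2 := by
    rw [dDen, norm_smul, hu, hx, inner_smul_left, Real.norm_of_nonneg ht0, conj_trivial]
    ring
  rw [inner_dMap, inner_smul_right, inner_smul_left, real_inner_self_eq_norm_sq, norm_smul, hu,
    hx, Real.norm_of_nonneg ht0, conj_trivial, inv_mul_eq_div, le_div_iff₀ hD, hDe]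
  rw [hDe] at hD
  generalize (⟪u, x⟫ : ℝ) = c at *
  have h1 : 0 ≤ 1 - c ^ 2 := by nlinarith
  have h2 : 1 + 2 * t * c + t ^ 2 ≤ 4 := by nlinarith
  have h3 : t / 2 * (1 - c ^ 2) * (1 + 2 * t * c + t ^ 2) ≤ t / 2 * (1 - c ^ 2) * 4 :=
    mul_le_mul_of_nonneg_left h2 (by positivity)
  nlinarith

theorem integrable_of_ae_norm_eq_one {ν : Measure (Eu n)} [IsFiniteMeasure ν]
    (hν : ∀ᵐ x ∂ν, ‖x‖ = 1) {f : Eu n → ℝ} (hf : Measurable f) (C : ℝ)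
    (hC : ∀ x, ‖x‖ = 1 → |f x| ≤ C) : Integrable f ν :=
  Integrable.of_bound hf.aestronglyMeasurable C (hν.mono fun x hx => hC x hx)

theorem abs_inner_le_one {u x : Eu n} (hu : ‖u‖ = 1) (hx : ‖x‖ = 1) : |(⟪u, x⟫ : ℝ)| ≤ 1 := by
  simpa [hu, hx] using abs_real_inner_le_norm u x

theorem norm_sub_or_add_of_inner_sq {u x : Eu n} (hu : ‖u‖ = 1) (hx : ‖x‖ = 1)
    (h : (⟪u, x⟫ : ℝ) ^ 2 = 1) : x = u ∨ x = -u := by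
  rcases sq_eq_sq_iff_eq_or_eq_neg.1 (h.trans (one_pow 2).symm) with h | h
  · exact Or.inl (eq_of_inner_eq_one hu hx h)
  · refine Or.inr (eq_of_inner_eq_one (by rwa [norm_neg]) hx ?_)
    rw [inner_neg_left, h, neg_neg]

theorem integral_one_sub_inner_sq_pos {ν : Measure (Eu n)} [IsProbabilityMeasure ν]
    (hν : ∀ᵐ x ∂ν, ‖x‖ = 1) (hat : ∀ a, ν {a} = 0) {u : Eu n} (hu : ‖u‖ = 1) :
    0 < ∫ x, (1 - (⟪u, x⟫ : ℝ) ^ 2) ∂ν := by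
  have hle : ∀ x : Eu n, ‖x‖ = 1 → (⟪u, x⟫ : ℝ) ^ 2 ≤ 1 := fun x hx =>
    (sq_le_one_iff_abs_le_one _).2 (abs_inner_le_one hu hx)
  have hn : ∀ᵐ x ∂ν, 0 ≤ 1 - (⟪u, x⟫ : ℝ) ^ 2 := hν.mono fun x hx => by linarith [hle x hx]
  have hi : Integrable (fun x => 1 - (⟪u, x⟫ : ℝ) ^ 2) ν :=
    integrable_of_ae_norm_eq_one hν (by fun_prop) 1 fun x hx => by
      rw [abs_le]; constructor <;> nlinarith [hle x hx, sq_nonneg (⟪u, x⟫ : ℝ)]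
  refine lt_of_le_of_ne (integral_nonneg_of_ae hn) fun h => ?_
  have h0 := (integral_eq_zero_iff_of_nonneg_ae hn hi).1 h.symm
  have key : ∀ a : Eu n, ∀ᵐ x ∂ν, x ≠ a := fun a => by
    rw [ae_iff]
    simpa using hat a
  have hF : ∀ᵐ x ∂ν, False := by
    filter_upwards [h0, hν, key u, key (-u)] with x h1 h2 h3 h4
    rcases norm_sub_or_add_of_inner_sq hu h2 (by
      have : 1 - (⟪u, x⟫ : ℝ) ^ 2 = 0 := h1
      linarith) with h | h
    exacts [h3 h, h4 h]
  rw [eventually_false_iff_eq_bot, ae_eq_bot] at hF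
  exact IsProbabilityMeasure.ne_zero ν hF

theorem abs_inner_dMap_le {ξ s x : Eu n} (hξ : ‖ξ‖ < 1) (hs : ‖s‖ = 1) (hx : ‖x‖ = 1) :
    |(⟪s, dMap ξ x⟫ : ℝ)| ≤ 1 := abs_inner_le_one hs ((isMob_dMap hξ).norm_eq hx)

theorem measurable_inner_dMap (ξ s : Eu n) : Measurable fun x => (⟪s, dMap ξ x⟫ : ℝ) :=
  measurable_const.inner (measurable_dMap ξ)

theorem norm_mul_integral_le {ν : Measure (Eu n)} [IsProbabilityMeasure ν]
    (hν : ∀ᵐ x ∂ν, ‖x‖ = 1) {ξ u : Eu n} (hξ : ‖ξ‖ < 1) (hu : ‖u‖ = 1) (hξu : ξ = ‖ξ‖ • u) :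
    ∫ x, (⟪u, x⟫ : ℝ) ∂ν + ‖ξ‖ / 2 * ∫ x, (1 - (⟪u, x⟫ : ℝ) ^ 2) ∂ν ≤
      ∫ x, (⟪u, dMap ξ x⟫ : ℝ) ∂ν := by
  have hle : ∀ x : Eu n, ‖x‖ = 1 → (⟪u, x⟫ : ℝ) ^ 2 ≤ 1 := fun x hx =>
    (sq_le_one_iff_abs_le_one _).2 (abs_inner_le_one hu hx)
  have hi : Integrable (fun x => 1 - (⟪u, x⟫ : ℝ) ^ 2) ν :=
    integrable_of_ae_norm_eq_one hν (by fun_prop) 1 fun x hx => by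
      rw [abs_le]; constructor <;> nlinarith [hle x hx, sq_nonneg (⟪u, x⟫ : ℝ)]
  have hi1 : Integrable (fun x => (⟪u, x⟫ : ℝ)) ν :=
    integrable_of_ae_norm_eq_one hν (by fun_prop) 1 fun x hx => abs_inner_le_one hu hx
  rw [← integral_const_mul, ← integral_add hi1 (hi.const_mul _)]
  refine integral_mono_ae (hi1.add (hi.const_mul _))
    (integrable_of_ae_norm_eq_one hν (measurable_inner_dMap ξ u) 1
      fun x hx => abs_inner_dMap_le hξ hu hx) (hν.mono fun x hx => ?_)
  have := inner_dMap_smul_ge (norm_nonneg ξ) hξ hu hx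
  rwa [← hξu] at this

theorem eq_zero_of_renormalizes {ν : Measure (Eu n)} [IsProbabilityMeasure ν]
    (hν : ∀ᵐ x ∂ν, ‖x‖ = 1) (hat : ∀ a, ν {a} = 0)
    (h0 : ∀ s ∈ sphSet n, ∫ x, (⟪s, x⟫ : ℝ) ∂ν = 0) {ξ : Eu n} (hξ : ‖ξ‖ < 1)
    (h : Renormalizes ξ ν) : ξ = 0 := by
  by_contra hne
  have hpos : 0 < ‖ξ‖ := norm_pos_iff.2 hne
  set u := ‖ξ‖⁻¹ • ξ with hu
  have hu1 : ‖u‖ = 1 := norm_smul_inv_norm hne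
  have hξu : ξ = ‖ξ‖ • u := by rw [hu, smul_smul, mul_inv_cancel₀ hpos.ne', one_smul]
  have hus : u ∈ sphSet n := by simpa [sphSet] using hu1
  have h1 := norm_mul_integral_le hν hξ hu1 hξu
  have h2 := h u hus
  simp only [Xfun] at h2
  rw [h0 u hus, h2] at h1
  have h3 := integral_one_sub_inner_sq_pos hν hat hu1
  nlinarith [mul_pos hpos h3]

theorem dMap_zero_right (ξ : Eu n) : dMap ξ 0 = ξ := by
  simp [dMap]

theorem renormalizes_unique {ν : Measure (Eu n)} [IsProbabilityMeasure ν]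
    (hν : ∀ᵐ x ∂ν, ‖x‖ = 1) (hat : ∀ a, ν {a} = 0) {ξ η : Eu n} (hξ : ‖ξ‖ < 1) (hη : ‖η‖ < 1)
    (h1 : Renormalizes ξ ν) (h2 : Renormalizes η ν) : ξ = η := by
  have hme := measurable_dMap η
  have hη' : ‖-η‖ < 1 := by rwa [norm_neg]
  have hξ' : ‖-ξ‖ < 1 := by rwa [norm_neg]
  have hmob := isMob_dMap hη
  have hmob' : IsMob (dMap (-η)) (dMap η) (dFac (-η)) := by
    simpa using isMob_dMap hη'
  have : IsProbabilityMeasure (ν.map (dMap η)) :=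
    Measure.isProbabilityMeasure_map hme.aemeasurable
  have hz : dMap η (-ξ) = 0 := by
    rw [← neg_eq_zero]
    refine eq_zero_of_renormalizes (ν := ν.map (dMap η)) ?_ ?_ ?_ ?_ ?_
    · rw [ae_map_iff hme.aemeasurable
        (measurableSet_eq_fun continuous_norm.measurable measurable_const)]
      exact hν.mono fun x hx => hmob.norm_eq hx
    · intro a
      rw [Measure.map_apply hme (measurableSet_singleton a)]
      have hk : ∀ᵐ x ∂ν, x ≠ dMap (-η) a := by
        rw [ae_iff]
        simpa using hat _
      have hk2 : ∀ᵐ x ∂ν, ¬ (dMap η x = a) := by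
        filter_upwards [hν, hk] with x hx hx1 hx2
        exact hx1 (by rw [← hx2, hmob.left_inv x hx.le])
      simp only [ae_iff, not_not] at hk2
      exact hk2
    · intro s hs
      rw [integral_map hme.aemeasurable (by fun_prop)]
      exact h2 s hs
    · rw [norm_neg]
      exact hmob.norm_lt hξ'
    · intro s hs
      have hs1 : ‖s‖ = 1 := by simpa [sphSet] using hs
      simp only [Xfun]
      rw [integral_map hme.aemeasurable (measurable_inner_dMap _ _).aestronglyMeasurable]
      set s' := dMap ξ (dMap (-η) (dMap (-(-dMap η (-ξ))) s)) with hs'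
      have hζ : ‖-dMap η (-ξ)‖ < 1 := by
        rw [norm_neg]
        exact hmob.norm_lt hξ'
      have key : ∀ x, ‖x‖ = 1 → (⟪s, dMap (-dMap η (-ξ)) (dMap η x)⟫ : ℝ) = ⟪s', dMap ξ x⟫ := by
        intro x hx
        rw [hmob.inner_dMap_comp_eq hζ hx hs1, neg_neg, hmob.left_inv _ hξ'.le, neg_neg]
        rw [hs', neg_neg]
      rw [integral_congr_ae (hν.mono fun x hx => key x hx)]
      refine h1 s' ?_
      have : ‖s'‖ = 1 := (isMob_dMap hξ).norm_eq (hmob'.norm_eq ((isMob_dMap hζ).norm_inv_eq hs1))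
      simpa [sphSet] using this
  have h3 := hmob.left_inv (-ξ) hξ'.le
  rw [hz, dMap_zero_right] at h3
  exact (neg_injective h3).symm

end Renormalization

section Reflected

variable {n : ℕ}

theorem mem_sphSet {x : Eu n} : x ∈ sphSet n ↔ ‖x‖ = 1 := by simp [sphSet]

theorem ae_confMeasure_norm (w : Eu n → ℝ) : ∀ᵐ x ∂(confMeasure n w), ‖x‖ = 1 :=
  (confMeasure_absolutelyContinuous w).ae_le ae_sphMeasure_norm

theorem ae_confMeasure_side (hn : 2 ≤ n) (w : Eu n → ℝ) {r : ℝ} (hr : r ∈ Icc (-1 : ℝ) 1)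
    {p : Eu n} (hp : ‖p‖ = 1) : ∀ᵐ x ∂(confMeasure n w), side r p x ≠ 0 :=
  (confMeasure_absolutelyContinuous w).ae_le (ae_side_ne_zero hn hr hp)

theorem confMeasure_singleton (hn : 2 ≤ n) (w : Eu n → ℝ) (a : Eu n) :
    confMeasure n w {a} = 0 :=
  confMeasure_absolutelyContinuous w (sphMeasure_singleton hn a)

theorem mem_Ioo_neg {r : ℝ} (hr : r ∈ Ioo (-1 : ℝ) 1) : -r ∈ Ioo (-1 : ℝ) 1 :=
  ⟨by linarith [hr.2], by linarith [hr.1]⟩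

/-- The renormalization point of the complementary cap. -/
def reflPt (r : ℝ) (p ξ : Eu n) : Eu n := -tauMap r p (-ξ)

/-- The direction which the complementary cap associates with `s`. -/
def reflDir (r : ℝ) (p ξ s : Eu n) : Eu n := dMap (reflPt r p ξ) (tauMap r p (dMap (-ξ) s))

theorem norm_reflPt {r : ℝ} (hr : r ∈ Ioo (-1 : ℝ) 1) {p : Eu n} (hp : ‖p‖ = 1) {ξ : Eu n}
    (hξ : ‖ξ‖ < 1) : ‖reflPt r p ξ‖ < 1 := by
  rw [reflPt, norm_neg]
  exact (isMob_tauMap hr hp).norm_lt (by rwa [norm_neg])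

theorem reflPt_reflPt {r : ℝ} (hr : r ∈ Ioo (-1 : ℝ) 1) {p : Eu n} (hp : ‖p‖ = 1) {ξ : Eu n}
    (hξ : ‖ξ‖ < 1) : reflPt (-r) (-p) (reflPt r p ξ) = ξ := by
  rw [reflPt, reflPt, tauMap_neg, neg_neg,
    (isMob_tauMap hr hp).left_inv _ (by rw [norm_neg]; exact hξ.le), neg_neg]

theorem norm_reflDir {r : ℝ} (hr : r ∈ Ioo (-1 : ℝ) 1) {p : Eu n} (hp : ‖p‖ = 1) {ξ s : Eu n}
    (hξ : ‖ξ‖ < 1) (hs : ‖s‖ = 1) : ‖reflDir r p ξ s‖ = 1 :=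
  (isMob_dMap (norm_reflPt hr hp hξ)).norm_eq
    ((isMob_tauMap hr hp).norm_eq ((isMob_dMap hξ).norm_inv_eq hs))

theorem inner_dMap_tauMap {r : ℝ} (hr : r ∈ Ioo (-1 : ℝ) 1) {p : Eu n} (hp : ‖p‖ = 1)
    {ξ s : Eu n} (hξ : ‖ξ‖ < 1) (hs : ‖s‖ = 1) {x : Eu n} (hx : ‖x‖ = 1) :
    (⟪s, dMap ξ (tauMap r p x)⟫ : ℝ) = ⟪reflDir r p ξ s, dMap (reflPt r p ξ) x⟫ :=
  (isMob_tauMap hr hp).inner_dMap_comp_eq hξ hx hs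

theorem inner_dMap_fold {r : ℝ} (hr : r ∈ Ioo (-1 : ℝ) 1) {p : Eu n} (hp : ‖p‖ = 1)
    {ξ s : Eu n} (hξ : ‖ξ‖ < 1) (hs : ‖s‖ = 1) {x : Eu n} (hx : ‖x‖ = 1)
    (hsx : side r p x ≠ 0) :
    (⟪s, dMap ξ (fold r p x)⟫ : ℝ) =
      ⟪reflDir r p ξ s, dMap (reflPt r p ξ) (fold (-r) (-p) x)⟫ := by
  rw [fold_neg hr hp hx hsx, ← inner_dMap_tauMap hr hp hξ hs
    ((isMob_tauMap hr hp).norm_eq (norm_fold hr hp hx)),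
    (isMob_tauMap hr hp).left_inv _ (norm_fold hr hp hx).le]

theorem inner_dMap_fold_neg {r : ℝ} (hr : r ∈ Ioo (-1 : ℝ) 1) {p : Eu n} (hp : ‖p‖ = 1)
    {ξ s : Eu n} (hξ : ‖ξ‖ < 1) (hs : ‖s‖ = 1) {x : Eu n} (hx : ‖x‖ = 1)
    (hsx : side r p x ≠ 0) :
    (⟪s, dMap (reflPt r p ξ) (fold (-r) (-p) x)⟫ : ℝ) =
      ⟪reflDir (-r) (-p) (reflPt r p ξ) s, dMap ξ (fold r p x)⟫ := by
  have hp' : ‖-p‖ = 1 := by rwa [norm_neg]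
  have h := inner_dMap_fold (mem_Ioo_neg hr) hp' (norm_reflPt hr hp hξ) hs hx
    (by rwa [side_neg, neg_ne_zero])
  rwa [reflPt_reflPt hr hp hξ, neg_neg, neg_neg] at h

variable {w : Eu n → ℝ}

theorem integral_capMeasure {r : ℝ} (hr : r ∈ Ioo (-1 : ℝ) 1) {p : Eu n} (hp : ‖p‖ = 1)
    {f : Eu n → ℝ} (hf : Measurable f) :
    ∫ x, f x ∂(capMeasure n w r p) = ∫ x, f (fold r p x) ∂(confMeasure n w) := by
  rw [capMeasure_eq_map hr hp, integral_map (measurable_fold r p).aemeasurable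
    hf.aestronglyMeasurable]

theorem Qform_map_capMeasure {r : ℝ} (hr : r ∈ Ioo (-1 : ℝ) 1) {p : Eu n} (hp : ‖p‖ = 1)
    (ξ s : Eu n) : Qform (Measure.map (dMap ξ) (capMeasure n w r p)) s =
      ∫ x, (⟪s, dMap ξ (fold r p x)⟫ : ℝ) ^ 2 ∂(confMeasure n w) := by
  rw [Qform, integral_map (measurable_dMap ξ).aemeasurable (by fun_prop),
    integral_capMeasure hr hp ((measurable_inner_dMap ξ s).pow_const 2)]

theorem capMeasure_properties (hn : 2 ≤ n) (hvol : confMeasure n w univ = 1) {r : ℝ}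
    (hr : r ∈ Ioo (-1 : ℝ) 1) {p : Eu n} (hp : ‖p‖ = 1) :
    IsProbabilityMeasure (capMeasure n w r p) ∧ (∀ᵐ x ∂(capMeasure n w r p), ‖x‖ = 1) ∧
      ∀ a, capMeasure n w r p {a} = 0 := by
  have : IsProbabilityMeasure (confMeasure n w) := ⟨hvol⟩
  have hm := measurable_fold r p
  rw [capMeasure_eq_map hr hp]
  refine ⟨Measure.isProbabilityMeasure_map hm.aemeasurable, ?_, fun a => ?_⟩
  · rw [ae_map_iff hm.aemeasurable
        (measurableSet_eq_fun continuous_norm.measurable measurable_const)]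
    exact (ae_confMeasure_norm w).mono fun x hx => norm_fold hr hp hx
  · rw [Measure.map_apply hm (measurableSet_singleton a)]
    have key : ∀ a : Eu n, ∀ᵐ x ∂(confMeasure n w), x ≠ a := fun a => by
      rw [ae_iff]
      simpa using confMeasure_singleton hn w a
    have hk2 : ∀ᵐ x ∂(confMeasure n w), ¬ (fold r p x = a) := by
      filter_upwards [ae_confMeasure_norm w, key a, key (tauMap r p a)] with x hx h1 h2 h3
      unfold fold at h3
      split_ifs at h3
      · exact h1 h3
      · exact h2 (by rw [← h3, (isMob_tauMap hr hp).left_inv x hx.le])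
    simp only [ae_iff, not_not] at hk2
    exact hk2

theorem renormalizes_reflPt (hn : 2 ≤ n) {r : ℝ} (hr : r ∈ Ioo (-1 : ℝ) 1) {p : Eu n}
    (hp : ‖p‖ = 1) {ξ : Eu n} (hξ : ‖ξ‖ < 1) (h : Renormalizes ξ (capMeasure n w r p)) :
    Renormalizes (reflPt r p ξ) (capMeasure n w (-r) (-p)) := by
  have hp' : ‖-p‖ = 1 := by rwa [norm_neg]
  have hr' := mem_Ioo_neg hr
  intro s hs
  rw [mem_sphSet] at hs
  have h1 := h _ (mem_sphSet.2 (norm_reflDir hr' hp' (norm_reflPt hr hp hξ) hs))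
  simp only [Xfun] at h1 ⊢
  rw [integral_capMeasure hr hp (measurable_inner_dMap _ _)] at h1
  rw [integral_capMeasure hr' hp' (measurable_inner_dMap _ _), ← h1]
  refine integral_congr_ae ?_
  filter_upwards [ae_confMeasure_norm w, ae_confMeasure_side hn w (Ioo_subset_Icc_self hr) hp]
    with x hx hx0
  rw [inner_dMap_fold_neg hr hp hξ hs hx hx0]

theorem Qform_reflDir (hn : 2 ≤ n) {r : ℝ} (hr : r ∈ Ioo (-1 : ℝ) 1) {p : Eu n}
    (hp : ‖p‖ = 1) {ξ s : Eu n} (hξ : ‖ξ‖ < 1) (hs : ‖s‖ = 1) :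
    Qform (Measure.map (dMap (reflPt r p ξ)) (capMeasure n w (-r) (-p))) (reflDir r p ξ s) =
      Qform (Measure.map (dMap ξ) (capMeasure n w r p)) s := by
  have hp' : ‖-p‖ = 1 := by rwa [norm_neg]
  have hr' := mem_Ioo_neg hr
  rw [Qform_map_capMeasure hr hp, Qform_map_capMeasure hr' hp']
  refine integral_congr_ae ?_
  filter_upwards [ae_confMeasure_norm w, ae_confMeasure_side hn w (Ioo_subset_Icc_self hr) hp]
    with x hx hx0
  rw [inner_dMap_fold hr hp hξ hs hx hx0]

theorem maxEig_reflPt (hn : 2 ≤ n) {r : ℝ} (hr : r ∈ Ioo (-1 : ℝ) 1) {p : Eu n}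
    (hp : ‖p‖ = 1) {ξ : Eu n} (hξ : ‖ξ‖ < 1) :
    maxEig n (Measure.map (dMap (reflPt r p ξ)) (capMeasure n w (-r) (-p))) =
      maxEig n (Measure.map (dMap ξ) (capMeasure n w r p)) := by
  have hp' : ‖-p‖ = 1 := by rwa [norm_neg]
  have hr' := mem_Ioo_neg hr
  unfold maxEig
  congr 1
  ext q
  constructor
  · rintro ⟨s, hs, rfl⟩
    refine ⟨reflDir (-r) (-p) (reflPt r p ξ) s, ?_, ?_⟩
    · exact norm_reflDir hr' hp' (norm_reflPt hr hp hξ) hs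
    · have := Qform_reflDir (w := w) hn hr' hp' (norm_reflPt hr hp hξ) hs
      rw [reflPt_reflPt hr hp hξ, neg_neg, neg_neg] at this
      exact this.symm
  · rintro ⟨s, hs, rfl⟩
    exact ⟨reflDir r p ξ s, norm_reflDir hr hp hξ hs, (Qform_reflDir hn hr hp hξ hs).symm⟩

theorem IsMaxDir.reflDir_eq (hn : 2 ≤ n) {r : ℝ} (hr : r ∈ Ioo (-1 : ℝ) 1) {p : Eu n}
    (hp : ‖p‖ = 1) {ξ s s' : Eu n} (hξ : ‖ξ‖ < 1)
    (h : IsMaxDir (Measure.map (dMap ξ) (capMeasure n w r p)) s)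
    (h' : IsMaxDir (Measure.map (dMap (reflPt r p ξ)) (capMeasure n w (-r) (-p))) s') :
    reflDir r p ξ s = s' ∨ reflDir r p ξ s = -s' := by
  have hN := norm_reflDir hr hp hξ h.1
  obtain ⟨c, hc⟩ := (h'.2 (reflDir r p ξ s)).1 (by
    rw [Qform_reflDir hn hr hp hξ h.1, maxEig_reflPt hn hr hp hξ, hN, (h.2 s).2 ⟨1, by simp⟩,
      h.1])
  rw [hc, norm_smul, h'.1, mul_one, Real.norm_eq_abs] at hN
  rw [hc]
  rcases (abs_eq zero_le_one).1 hN with rfl | rfl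
  · left; simp
  · right; simp

end Reflected

section Sign

variable {n : ℕ} {w : Eu n → ℝ} {ξfun sfun : ℝ → Eu n → Eu n}

theorem reflPt_eq (hn : 2 ≤ n) (hvol : confMeasure n w univ = 1)
    (hξ : ∀ r ∈ Set.Ioo (-1 : ℝ) 1, ∀ p ∈ sphSet n,
      ‖ξfun r p‖ < 1 ∧ Renormalizes (ξfun r p) (capMeasure n w r p))
    {r : ℝ} (hr : r ∈ Ioo (-1 : ℝ) 1) {p : Eu n} (hp : ‖p‖ = 1) :
    reflPt r p (ξfun r p) = ξfun (-r) (-p) := by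
  have hp' : ‖-p‖ = 1 := by rwa [norm_neg]
  have hr' := mem_Ioo_neg hr
  obtain ⟨h1, h2⟩ := hξ r hr p (mem_sphSet.2 hp)
  obtain ⟨h3, h4⟩ := hξ (-r) hr' (-p) (mem_sphSet.2 hp')
  obtain ⟨i1, i2, i3⟩ := capMeasure_properties hn hvol hr' hp'
  exact renormalizes_unique i2 i3 (norm_reflPt hr hp h1) h3 (renormalizes_reflPt hn hr hp h1 h2) h4

theorem reflPt_zero (p ξ : Eu n) :
    reflPt 0 p ξ = Refl p ξ := by
  have h0 : ∀ x : Eu n, dMap 0 x = x := fun x => by simp [dMap]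
  have h1 : Refl p (-ξ) = -Refl p ξ := by
    simp only [Refl, inner_neg_right]
    module
  simp [reflPt, tauMap, h0, h1]

theorem reflDir_zero (p ξ s : Eu n) (hp : ‖p‖ = 1) (hξ : ‖ξ‖ < 1) (hs : ‖s‖ = 1) :
    reflDir 0 p ξ s = Refl p s := by
  have h0 : ∀ x : Eu n, dMap 0 x = x := fun x => by simp [dMap]
  have hdR : ∀ x, dMap (Refl p ξ) (Refl p x) = Refl p (dMap ξ x) := by
    intro x
    have hin : (⟪Refl p ξ, Refl p x⟫ : ℝ) = ⟪ξ, x⟫ := by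
      simp only [Refl, inner_sub_right, inner_sub_left, inner_smul_right, inner_smul_left,
        real_inner_self_eq_norm_sq, hp, conj_trivial, real_inner_comm p ξ]
      ring
    simp only [dMap, norm_Refl hp, hin]
    simp only [Refl, inner_add_right, inner_smul_right]
    module
  rw [reflDir, reflPt_zero p ξ]
  simp only [tauMap, Function.comp_apply, zero_smul, neg_zero, h0]
  rw [hdR, (isMob_dMap hξ).right_inv s hs.le]

theorem continuousOn_reflDir
    (hξ : ∀ r ∈ Set.Ioo (-1 : ℝ) 1, ∀ p ∈ sphSet n, ‖ξfun r p‖ < 1)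
    (hs : ∀ r ∈ Set.Ioo (-1 : ℝ) 1, ∀ p ∈ sphSet n, ‖sfun r p‖ = 1)
    (hξcont : ContinuousOn (fun q : ℝ × Eu n => ξfun q.1 q.2) (Set.Ioo (-1 : ℝ) 1 ×ˢ sphSet n))
    (hscont : ContinuousOn (fun q : ℝ × Eu n => sfun q.1 q.2) (Set.Ioo (-1 : ℝ) 1 ×ˢ sphSet n)) :
    ContinuousOn (fun q : ℝ × Eu n => reflDir q.1 q.2 (ξfun q.1 q.2) (sfun q.1 q.2))
      (Set.Ioo (-1 : ℝ) 1 ×ˢ sphSet n) := by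
  have hd : ∀ f g : ℝ × Eu n → Eu n, ContinuousOn f (Set.Ioo (-1 : ℝ) 1 ×ˢ sphSet n) →
      ContinuousOn g (Set.Ioo (-1 : ℝ) 1 ×ˢ sphSet n) →
      (∀ q ∈ Set.Ioo (-1 : ℝ) 1 ×ˢ sphSet n, ‖f q‖ < 1) →
      (∀ q ∈ Set.Ioo (-1 : ℝ) 1 ×ˢ sphSet n, ‖g q‖ ≤ 1) →
      ContinuousOn (fun q => dMap (f q) (g q)) (Set.Ioo (-1 : ℝ) 1 ×ˢ sphSet n) :=
    fun f g hf hg h1 h2 => by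
      have hm : MapsTo (fun q => (f q, g q)) (Set.Ioo (-1 : ℝ) 1 ×ˢ sphSet n)
          {q : Eu n × Eu n | ‖q.1‖ < 1 ∧ ‖q.2‖ ≤ 1} := by
        intro q hq
        rw [mem_ofPred_eq]
        exact ⟨h1 q hq, h2 q hq⟩
      exact ContinuousOn.comp (f := fun q => (f q, g q)) continuousOn_dMap (hf.prodMk hg) hm
  have hR : ∀ g : ℝ × Eu n → Eu n, ContinuousOn g (Set.Ioo (-1 : ℝ) 1 ×ˢ sphSet n) →
      ContinuousOn (fun q => Refl q.2 (g q)) (Set.Ioo (-1 : ℝ) 1 ×ˢ sphSet n) := by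
    intro g hg
    unfold Refl
    fun_prop
  have hrp : ∀ q ∈ Set.Ioo (-1 : ℝ) 1 ×ˢ sphSet n, ‖q.1 • q.2‖ < 1 := fun q hq =>
    norm_smul_lt_one hq.1 (mem_sphSet.1 hq.2)
  have hτ : ∀ g : ℝ × Eu n → Eu n, ContinuousOn g (Set.Ioo (-1 : ℝ) 1 ×ˢ sphSet n) →
      (∀ q ∈ Set.Ioo (-1 : ℝ) 1 ×ˢ sphSet n, ‖g q‖ ≤ 1) →
      ContinuousOn (fun q => tauMap q.1 q.2 (g q)) (Set.Ioo (-1 : ℝ) 1 ×ˢ sphSet n) := by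
    intro g hg h1
    have h2 : ∀ q ∈ Set.Ioo (-1 : ℝ) 1 ×ˢ sphSet n, ‖-(q.1 • q.2)‖ < 1 := fun q hq => by
      rw [norm_neg]; exact hrp q hq
    have h3 : Continuous fun q : ℝ × Eu n => q.1 • q.2 := by fun_prop
    have h4 := hR (fun q => dMap (-(q.1 • q.2)) (g q))
      (hd (fun q => -(q.1 • q.2)) g h3.neg.continuousOn hg h2 h1)
    exact hd (fun q => q.1 • q.2) (fun q => Refl q.2 (dMap (-(q.1 • q.2)) (g q)))
      h3.continuousOn h4 hrp fun q hq => by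
        rw [norm_Refl (mem_sphSet.1 hq.2)]
        exact norm_dMap_le_one (h2 q hq) (h1 q hq)
  have hξ1 : ∀ q ∈ Set.Ioo (-1 : ℝ) 1 ×ˢ sphSet n, ‖-ξfun q.1 q.2‖ < 1 := fun q hq => by
    rw [norm_neg]; exact hξ q.1 hq.1 q.2 hq.2
  have hs1 : ∀ q ∈ Set.Ioo (-1 : ℝ) 1 ×ˢ sphSet n, ‖sfun q.1 q.2‖ ≤ 1 := fun q hq =>
    (hs q.1 hq.1 q.2 hq.2).le
  have h1 := hτ (fun q => -ξfun q.1 q.2) hξcont.neg fun q hq => (hξ1 q hq).le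
  have h2 := hd (fun q => -ξfun q.1 q.2) (fun q => sfun q.1 q.2) hξcont.neg hscont hξ1 hs1
  have h3 := hτ (fun q => dMap (-ξfun q.1 q.2) (sfun q.1 q.2)) h2
    fun q hq => norm_dMap_le_one (hξ1 q hq) (hs1 q hq)
  refine hd (fun q => -tauMap q.1 q.2 (-ξfun q.1 q.2))
    (fun q => tauMap q.1 q.2 (dMap (-ξfun q.1 q.2) (sfun q.1 q.2))) h1.neg h3 ?_ ?_
  · exact fun q hq => norm_reflPt hq.1 (mem_sphSet.1 hq.2) (hξ q.1 hq.1 q.2 hq.2)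
  · exact fun q hq => (isMob_tauMap hq.1 (mem_sphSet.1 hq.2)).norm_le
      (norm_dMap_le_one (hξ1 q hq) (hs1 q hq))

theorem IsPreconnected.eq_one_of_sq_eq_one {X : Type*} [TopologicalSpace X] {A : Set X}
    (hA : IsPreconnected A) {f : X → ℝ} (hf : ContinuousOn f A)
    (h : ∀ x ∈ A, f x = 1 ∨ f x = -1) {a : X} (ha : a ∈ A) (hfa : f a = 1) {x : X} (hx : x ∈ A) :
    f x = 1 := by
  refine (h x hx).resolve_right fun hx1 => ?_
  obtain ⟨z, hz, hz0⟩ := hA.intermediate_value hx ha hf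
    (show (0 : ℝ) ∈ Icc _ _ from ⟨by rw [hx1]; norm_num, by rw [hfa]; norm_num⟩)
  rcases h z hz with h | h <;> rw [h] at hz0 <;> norm_num at hz0

theorem reflDir_eq_neg (hn : 2 ≤ n) (hvol : confMeasure n w univ = 1)
    (hξ : ∀ r ∈ Set.Ioo (-1 : ℝ) 1, ∀ p ∈ sphSet n,
      ‖ξfun r p‖ < 1 ∧ Renormalizes (ξfun r p) (capMeasure n w r p))
    (hξcont : ContinuousOn (fun q : ℝ × Eu n => ξfun q.1 q.2)
      (Set.Ioo (-1 : ℝ) 1 ×ˢ sphSet n))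
    (hmax : ∀ r ∈ Set.Ioo (-1 : ℝ) 1, ∀ p ∈ sphSet n,
      IsMaxDir (Measure.map (dMap (ξfun r p)) (capMeasure n w r p)) (sfun r p))
    (hscont : ContinuousOn (fun q : ℝ × Eu n => sfun q.1 q.2)
      (Set.Ico (-1 : ℝ) 1 ×ˢ sphSet n))
    (hinit : ∀ p ∈ sphSet n, sfun (-1) p = -(e1 n))
    {r : ℝ} (hr : r ∈ Ioo (-1 : ℝ) 1) {p : Eu n} (hp : ‖p‖ = 1) :
    reflDir r p (ξfun r p) (sfun r p) = -sfun (-r) (-p) := by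
  have hs1 : ∀ r ∈ Set.Ioo (-1 : ℝ) 1, ∀ p ∈ sphSet n, ‖sfun r p‖ = 1 := fun r hr p hp =>
    (hmax r hr p hp).1
  have hsc : ContinuousOn (fun q : ℝ × Eu n => sfun q.1 q.2) (Set.Ioo (-1 : ℝ) 1 ×ˢ sphSet n) :=
    hscont.mono (prod_mono_left Ioo_subset_Ico_self)
  have hneg : ∀ q ∈ Set.Ioo (-1 : ℝ) 1 ×ˢ sphSet n,
      -q.1 ∈ Set.Ioo (-1 : ℝ) 1 ∧ -q.2 ∈ sphSet n := fun q hq =>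
    ⟨mem_Ioo_neg hq.1, mem_sphSet.2 (by rw [norm_neg]; exact mem_sphSet.1 hq.2)⟩
  have hsc' : ContinuousOn (fun q : ℝ × Eu n => sfun (-q.1) (-q.2))
      (Set.Ioo (-1 : ℝ) 1 ×ˢ sphSet n) :=
    ContinuousOn.comp (f := fun q : ℝ × Eu n => (-q.1, -q.2)) hsc
      (Continuous.continuousOn (by fun_prop)) fun q hq => hneg q hq
  have hc : ContinuousOn (fun q : ℝ × Eu n =>
      (⟪reflDir q.1 q.2 (ξfun q.1 q.2) (sfun q.1 q.2), sfun (-q.1) (-q.2)⟫ : ℝ))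
      (Set.Ioo (-1 : ℝ) 1 ×ˢ sphSet n) := (continuousOn_reflDir (fun r hr p hp => (hξ r hr p hp).1) hs1 hξcont hsc).inner
    (𝕜 := ℝ) hsc'
  have hor : ∀ q ∈ Set.Ioo (-1 : ℝ) 1 ×ˢ sphSet n,
      reflDir q.1 q.2 (ξfun q.1 q.2) (sfun q.1 q.2) = sfun (-q.1) (-q.2) ∨
      reflDir q.1 q.2 (ξfun q.1 q.2) (sfun q.1 q.2) = -sfun (-q.1) (-q.2) := by
    rintro ⟨r, p⟩ hq
    have hp := mem_sphSet.1 hq.2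
    refine (hmax r hq.1 p hq.2).reflDir_eq hn hq.1 hp (hξ r hq.1 p hq.2).1 ?_
    rw [reflPt_eq hn hvol hξ hq.1 hp]
    exact hmax _ (hneg _ hq).1 _ (hneg _ hq).2
  have hns : ∀ q ∈ Set.Ioo (-1 : ℝ) 1 ×ˢ sphSet n,
      (⟪sfun (-q.1) (-q.2), sfun (-q.1) (-q.2)⟫ : ℝ) = 1 := fun q hq => by
    rw [real_inner_self_eq_norm_sq, hs1 _ (hneg _ hq).1 _ (hneg _ hq).2, one_pow]
  have hconn : IsPreconnected (Set.Ioo (-1 : ℝ) 1 ×ˢ sphSet n) := by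
    refine isPreconnected_Ioo.prod (isPreconnected_sphere ?_ _ _)
    rw [← Module.finrank_eq_rank, finrank_euclideanSpace, Fintype.card_fin]
    exact_mod_cast (by omega : 1 < n + 1)
  by_contra hcon
  have hmem : ((r, p) : ℝ × Eu n) ∈ Set.Ioo (-1 : ℝ) 1 ×ˢ sphSet n := ⟨hr, mem_sphSet.2 hp⟩
  have hpm : ∀ q ∈ Set.Ioo (-1 : ℝ) 1 ×ˢ sphSet n,
      (⟪reflDir q.1 q.2 (ξfun q.1 q.2) (sfun q.1 q.2), sfun (-q.1) (-q.2)⟫ : ℝ) = 1 ∨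
      (⟪reflDir q.1 q.2 (ξfun q.1 q.2) (sfun q.1 q.2), sfun (-q.1) (-q.2)⟫ : ℝ) = -1 := by
    intro q hq
    rcases hor q hq with h | h
    · left; rw [h, hns q hq]
    · right; rw [h, inner_neg_left, hns q hq]
  have hrp : (⟪reflDir r p (ξfun r p) (sfun r p), sfun (-r) (-p)⟫ : ℝ) = 1 := by
    rw [(hor (r, p) hmem).resolve_right hcon]
    exact hns (r, p) hmem
  have hall : ∀ q ∈ Set.Ioo (-1 : ℝ) 1 ×ˢ sphSet n,
      reflDir q.1 q.2 (ξfun q.1 q.2) (sfun q.1 q.2) = sfun (-q.1) (-q.2) := by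
    intro q hq
    refine (hor q hq).resolve_right fun h => ?_
    have h1 := hconn.eq_one_of_sq_eq_one (f := fun q : ℝ × Eu n =>
      (⟪reflDir q.1 q.2 (ξfun q.1 q.2) (sfun q.1 q.2), sfun (-q.1) (-q.2)⟫ : ℝ)) hc
      (fun z hz => by simpa only using hpm z hz) hmem (by simpa only using hrp) hq
    rw [h, inner_neg_left, hns q hq] at h1
    norm_num at h1
  have he : ‖e1 n‖ = 1 := by simp [e1]
  refine no_reflection_equivariant_homotopy sfun (-(e1 n)) (hscont.mono ?_) ?_ ?_ hinit ?_
  · exact prod_mono_left fun t ht => ⟨ht.1, by linarith [ht.2]⟩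
  · intro t ht q hq h0
    have : ‖sfun t q‖ = 1 := by
      rcases ht.1.eq_or_lt with rfl | h
      · rw [hinit q hq, norm_neg, he]
      · exact hs1 t ⟨h, by linarith [ht.2]⟩ q hq
    rw [h0, norm_zero] at this
    exact zero_ne_one this
  · rw [← norm_pos_iff, norm_neg, he]
    exact one_pos
  · intro q hq
    have h0 : (0 : ℝ) ∈ Ioo (-1 : ℝ) 1 := by norm_num
    have h := hall (0, q) ⟨h0, hq⟩
    simp only [neg_zero] at h
    rw [← h, reflDir_zero q _ _ (mem_sphSet.1 hq) (hξ 0 h0 q hq).1 (hs1 0 h0 q hq)]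
    rfl

end Sign

section Limits

variable {n : ℕ} {w : Eu n → ℝ}

theorem eventually_side_pos_iff {r₀ : ℝ} {p x : Eu n} (h : side r₀ p x ≠ 0) :
    ∀ᶠ r in 𝓝 r₀, (0 < side r p x ↔ 0 < side r₀ p x) := by
  have hc : Continuous fun r => side r p x := by unfold side; fun_prop
  rcases h.lt_or_gt with h | h
  · filter_upwards [hc.continuousAt.eventually_lt continuousAt_const h] with r hr
    exact ⟨fun h' => absurd h' hr.not_gt, fun h' => absurd h' h.not_gt⟩
  · filter_upwards [continuousAt_const.eventually_lt hc.continuousAt h] with r hr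
    exact ⟨fun _ => h, fun _ => hr⟩

/-- The indicator function of the cap `a_{r,p}` on the sphere. -/
def capInd (r : ℝ) (p x : Eu n) : ℝ := if 0 < side r p x then 1 else 0

theorem measurable_capInd (r : ℝ) (p : Eu n) : Measurable (capInd r p) :=
  Measurable.ite (measurableSet_lt measurable_const (continuous_side r p).measurable)
    measurable_const measurable_const

theorem capInd_nonneg (r : ℝ) (p x : Eu n) : 0 ≤ capInd r p x := by
  unfold capInd; split_ifs <;> norm_num

theorem capInd_le_one (r : ℝ) (p x : Eu n) : capInd r p x ≤ 1 := by
  unfold capInd; split_ifs <;> norm_num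

theorem abs_capInd_le (r : ℝ) (p x : Eu n) : |capInd r p x| ≤ 1 := by
  rw [abs_of_nonneg (capInd_nonneg r p x)]
  exact capInd_le_one r p x

theorem ae_tendsto_capInd (hn : 2 ≤ n) {r₀ : ℝ} (hr : r₀ ∈ Icc (-1 : ℝ) 1) {p : Eu n}
    (hp : ‖p‖ = 1) :
    ∀ᵐ x ∂(sphMeasure n), Tendsto (fun r => capInd r p x) (𝓝 r₀) (𝓝 (capInd r₀ p x)) := by
  filter_upwards [ae_side_ne_zero hn hr hp] with x hx
  refine tendsto_const_nhds.congr' ?_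
  filter_upwards [eventually_side_pos_iff hx] with r h
  simp only [capInd, h]

theorem capInd_neg_one (hn : 2 ≤ n) {p : Eu n} (hp : ‖p‖ = 1) :
    ∀ᵐ x ∂(sphMeasure n), capInd (-1) p x = 1 := by
  filter_upwards [ae_side_ne_zero hn (r := -1) (by norm_num) hp, ae_sphMeasure_norm] with x h hx
  rw [capInd, if_pos]
  refine lt_of_le_of_ne ?_ h.symm
  rw [side]
  linarith [(abs_le.1 (abs_inner_le_one hp hx)).1]

theorem capInd_one {p x : Eu n} (hp : ‖p‖ = 1) (hx : ‖x‖ = 1) : capInd 1 p x = 0 := by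
  rw [capInd, if_neg]
  rw [side]
  linarith [(abs_le.1 (abs_inner_le_one hp hx)).2]

theorem tendsto_integral_capInd (hn : 2 ≤ n) {ν : Measure (Eu n)} [IsFiniteMeasure ν]
    (hν : ν ≪ sphMeasure n) {r₀ : ℝ} (hr : r₀ ∈ Icc (-1 : ℝ) 1) {p : Eu n} (hp : ‖p‖ = 1) :
    Tendsto (fun r => ∫ x, capInd r p x ∂ν) (𝓝 r₀) (𝓝 (∫ x, capInd r₀ p x ∂ν)) := by
  refine tendsto_integral_filter_of_dominated_convergence (fun _ => 1) ?_ ?_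
    (integrable_const _) (hν.ae_le (ae_tendsto_capInd hn hr hp))
  · exact Eventually.of_forall fun r => (measurable_capInd r p).aestronglyMeasurable
  · exact Eventually.of_forall fun r => ae_of_all _ fun x => abs_capInd_le r p x

theorem Qform_le_maxEig {ν : Measure (Eu n)} [IsProbabilityMeasure ν]
    (hν : ∀ᵐ x ∂ν, ‖x‖ = 1) {s : Eu n} (hs : ‖s‖ = 1) : Qform ν s ≤ maxEig n ν := by
  refine le_csSup ⟨1, ?_⟩ ⟨s, hs, rfl⟩
  rintro _ ⟨u, hu, rfl⟩
  have h1 : ∀ᵐ x ∂ν, (⟪u, x⟫ : ℝ) ^ 2 ≤ 1 := hν.mono fun x hx =>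
    (sq_le_one_iff_abs_le_one _).2 (abs_inner_le_one hu hx)
  have := integral_mono_of_nonneg (ae_of_all ν fun x => sq_nonneg (⟪u, x⟫ : ℝ))
    (integrable_const (1 : ℝ)) h1
  simpa [Qform] using this

theorem norm_le_of_renormalizes (hn : 2 ≤ n) (hvol : confMeasure n w univ = 1)
    (hmean : ∀ t : Eu n, ∫ x, (⟪t, x⟫ : ℝ) ∂(confMeasure n w) = 0)
    {e : Eu n} (hmax : IsMaxDir (confMeasure n w) e) {r : ℝ} (hr : r ∈ Ioo (-1 : ℝ) 1) {p : Eu n}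
    (hp : ‖p‖ = 1) {ξ : Eu n} (hξ : ‖ξ‖ < 1) (h : Renormalizes ξ (capMeasure n w r p)) :
    ‖ξ‖ * (∫ x, (1 - (⟪e, x⟫ : ℝ) ^ 2) ∂(confMeasure n w)) ≤
      5 * (1 - ∫ x, capInd r p x ∂(confMeasure n w)) := by
  have : IsProbabilityMeasure (confMeasure n w) := ⟨hvol⟩
  set m := confMeasure n w with hm
  have hmn := ae_confMeasure_norm w
  obtain ⟨i1, i2, i3⟩ := capMeasure_properties hn hvol hr hp
  have hci : Integrable (capInd r p) m := integrable_of_ae_norm_eq_one hmn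
    (measurable_capInd r p) 1 fun x _ => abs_capInd_le r p x
  have hε : ∫ x, (1 - capInd r p x) ∂m = 1 - ∫ x, capInd r p x ∂m := by
    rw [integral_sub (integrable_const _) hci]
    simp
  have hε0 : 0 ≤ ∫ x, (1 - capInd r p x) ∂m :=
    integral_nonneg fun x => by
      show 0 ≤ 1 - capInd r p x
      linarith [capInd_le_one r p x]
  have hεi : Integrable (fun x => 1 - capInd r p x) m := (integrable_const _).sub hci
  rw [← hε]
  by_cases hne : ξ = 0
  · rw [hne, norm_zero, zero_mul]
    linarith
  have hpos : 0 < ‖ξ‖ := norm_pos_iff.2 hne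
  set u := ‖ξ‖⁻¹ • ξ with hu
  have hu1 : ‖u‖ = 1 := norm_smul_inv_norm hne
  have hξu : ξ = ‖ξ‖ • u := by rw [hu, smul_smul, mul_inv_cancel₀ hpos.ne', one_smul]
  have h1 := norm_mul_integral_le i2 hξ hu1 hξu
  have h2 := h u (mem_sphSet.2 hu1)
  simp only [Xfun] at h2
  rw [h2, integral_capMeasure hr hp (by fun_prop), integral_capMeasure hr hp (by fun_prop)] at h1
  have hsq : ∀ {v x : Eu n}, ‖v‖ = 1 → ‖x‖ = 1 → (⟪v, x⟫ : ℝ) ^ 2 ≤ 1 := fun hv hx =>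
    (sq_le_one_iff_abs_le_one _).2 (abs_inner_le_one hv hx)
  have hmf := measurable_fold r p
  have hq : ∀ {v : Eu n}, ‖v‖ = 1 → Integrable (fun x => 1 - (⟪v, x⟫ : ℝ) ^ 2) m := fun {v} hv =>
    integrable_of_ae_norm_eq_one hmn (by fun_prop) 1 fun x hx => by
      rw [abs_le]; constructor <;> nlinarith [hsq hv hx, sq_nonneg (⟪v, x⟫ : ℝ)]
  have hqf : Integrable (fun x => 1 - (⟪u, fold r p x⟫ : ℝ) ^ 2) m :=
    integrable_of_ae_norm_eq_one hmn (by fun_prop) 1 fun x hx => by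
      have := hsq hu1 (norm_fold hr hp hx)
      rw [abs_le]; constructor <;> nlinarith [sq_nonneg (⟪u, fold r p x⟫ : ℝ)]
  have hl : Integrable (fun x => (⟪u, x⟫ : ℝ)) m :=
    integrable_of_ae_norm_eq_one hmn (by fun_prop) 1 fun x hx => abs_inner_le_one hu1 hx
  have hlf : Integrable (fun x => (⟪u, fold r p x⟫ : ℝ)) m :=
    integrable_of_ae_norm_eq_one hmn (by fun_prop) 1 fun x hx =>
      abs_inner_le_one hu1 (norm_fold hr hp hx)
  have h3 : ∫ x, (⟪u, x⟫ : ℝ) ∂m - 2 * ∫ x, (1 - capInd r p x) ∂m ≤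
      ∫ x, (⟪u, fold r p x⟫ : ℝ) ∂m := by
    rw [← integral_const_mul, ← integral_sub hl (hεi.const_mul 2)]
    refine integral_mono_ae (hl.sub (hεi.const_mul 2)) hlf (hmn.mono fun x hx => ?_)
    show (⟪u, x⟫ : ℝ) - 2 * (1 - capInd r p x) ≤ ⟪u, fold r p x⟫
    unfold capInd
    split_ifs with hs
    · rw [fold, if_pos hs]; linarith
    · linarith [(abs_le.1 (abs_inner_le_one hu1 hx)).2,
        (abs_le.1 (abs_inner_le_one hu1 (norm_fold hr hp hx))).1]
  have h4 : ∫ x, (1 - (⟪u, x⟫ : ℝ) ^ 2) ∂m - ∫ x, (1 - capInd r p x) ∂m ≤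
      ∫ x, (1 - (⟪u, fold r p x⟫ : ℝ) ^ 2) ∂m := by
    rw [← integral_sub (hq hu1) hεi]
    refine integral_mono_ae ((hq hu1).sub hεi) hqf (hmn.mono fun x hx => ?_)
    show 1 - (⟪u, x⟫ : ℝ) ^ 2 - (1 - capInd r p x) ≤ 1 - (⟪u, fold r p x⟫ : ℝ) ^ 2
    unfold capInd
    split_ifs with hs
    · rw [fold, if_pos hs]; linarith
    · linarith [hsq hu1 (norm_fold hr hp hx), sq_nonneg (⟪u, x⟫ : ℝ)]
  have hQ : ∀ {v : Eu n}, ‖v‖ = 1 → ∫ x, (1 - (⟪v, x⟫ : ℝ) ^ 2) ∂m = 1 - Qform m v := by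
    intro v hv
    have hi : Integrable (fun x => (⟪v, x⟫ : ℝ) ^ 2) m :=
      integrable_of_ae_norm_eq_one hmn (by fun_prop) 1 fun x hx => by
        rw [abs_of_nonneg (sq_nonneg _)]; exact hsq hv hx
    rw [integral_sub (integrable_const _) hi, Qform]
    simp
  have h5 : ∫ x, (1 - (⟪e, x⟫ : ℝ) ^ 2) ∂m ≤ ∫ x, (1 - (⟪u, x⟫ : ℝ) ^ 2) ∂m := by
    rw [hQ hu1, hQ hmax.1, (hmax.2 e).2 ⟨1, (one_smul ℝ e).symm⟩, hmax.1]
    linarith [Qform_le_maxEig hmn hu1]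
  rw [hmean u] at h3
  set ε := ∫ x, (1 - capInd r p x) ∂m
  nlinarith [mul_le_mul_of_nonneg_left (h5.trans (sub_le_iff_le_add.1 h4)) hpos.le]

theorem tendsto_renormPt (hn : 2 ≤ n) (hvol : confMeasure n w univ = 1)
    (hmean : ∀ t : Eu n, ∫ x, (⟪t, x⟫ : ℝ) ∂(confMeasure n w) = 0)
    {e : Eu n} (hmax : IsMaxDir (confMeasure n w) e) {ξfun : ℝ → Eu n} {p : Eu n} (hp : ‖p‖ = 1)
    (hξ : ∀ r ∈ Set.Ioo (-1 : ℝ) 1,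
      ‖ξfun r‖ < 1 ∧ Renormalizes (ξfun r) (capMeasure n w r p)) :
    Tendsto ξfun (𝓝[Ioo (-1) 1] (-1)) (𝓝 0) := by
  have : IsProbabilityMeasure (confMeasure n w) := ⟨hvol⟩
  have hκ := integral_one_sub_inner_sq_pos (ae_confMeasure_norm w)
    (fun a => confMeasure_singleton hn w a) hmax.1
  set κ := ∫ x, (1 - (⟪e, x⟫ : ℝ) ^ 2) ∂(confMeasure n w)
  have h1 := tendsto_integral_capInd hn (confMeasure_absolutelyContinuous w) (r₀ := -1)
    (by norm_num) hp
  rw [integral_congr_ae ((confMeasure_absolutelyContinuous w).ae_le (capInd_neg_one hn hp))] at h1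
  simp only [integral_const, probReal_univ, smul_eq_mul, mul_one] at h1
  have h2 : Tendsto (fun r => 5 * (1 - ∫ x, capInd r p x ∂(confMeasure n w)) / κ)
      (𝓝[Ioo (-1) 1] (-1)) (𝓝 0) := by
    have := (((tendsto_const_nhds (x := (1 : ℝ))).sub h1).const_mul 5).div_const κ
    simp only [sub_self, mul_zero, zero_div] at this
    exact this.mono_left nhdsWithin_le_nhds
  refine squeeze_zero_norm' ?_ h2
  filter_upwards [self_mem_nhdsWithin] with r hr
  rw [le_div_iff₀ hκ]
  exact norm_le_of_renormalizes hn hvol hmean hmax hr hp (hξ r hr).1 (hξ r hr).2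

end Limits

section Derivatives

variable {n : ℕ}

/-- The derivative at a point `x` of the sphere, along the tangent vector `t`, of
`y ↦ ⟪s, d_ξ y⟫`. -/
def dMapDeriv (ξ s x t : Eu n) : ℝ :=
  dFac ξ x * (⟪s, t⟫ - 2 * ⟪ξ, t⟫ / dDen ξ x * ⟪s, x + ξ⟫)

theorem dMapDeriv_neg (ξ s x t : Eu n) : dMapDeriv ξ (-s) x t = -dMapDeriv ξ s x t := by
  simp only [dMapDeriv, inner_neg_left]
  ring

theorem dMapDeriv_zero (s t : Eu n) (x : Eu n) : dMapDeriv 0 s x t = ⟪s, t⟫ := by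
  simp [dMapDeriv, dFac, dDen]

theorem abs_dMapDeriv_le {ξ s x t : Eu n} (hξ : ‖ξ‖ < 1) (hx : ‖x‖ = 1)
    (hxt : (⟪x, t⟫ : ℝ) = 0) : |dMapDeriv ξ s x t| ≤ dFac ξ x * (‖s‖ * ‖t‖) := by
  have hD := dDen_pos hξ hx.le
  have hD' := dDen_of_norm_eq_one (ξ := ξ) hx
  have h1 : (⟪ξ, t⟫ : ℝ) = ⟪x + ξ, t⟫ := by rw [inner_add_left, hxt, zero_add]
  set u := x + ξ with hu
  have h2 : (⟪s, t⟫ : ℝ) - 2 * ⟪ξ, t⟫ / dDen ξ x * ⟪s, u⟫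
      = ⟪s, t - (2 * ⟪u, t⟫ / dDen ξ x) • u⟫ := by
    rw [h1, inner_sub_right, inner_smul_right]
  have h3 : ‖t - (2 * (⟪u, t⟫ : ℝ) / dDen ξ x) • u‖ = ‖t‖ := by
    rw [← sq_eq_sq₀ (norm_nonneg _) (norm_nonneg _), @norm_sub_sq_real, inner_smul_right, norm_smul,
      mul_pow, ← hD', Real.norm_eq_abs, sq_abs, real_inner_comm u t]
    field_simp
    ring
  rw [dMapDeriv, h2, abs_mul, abs_of_pos (dFac_pos hξ hx.le)]
  refine mul_le_mul_of_nonneg_left ?_ (dFac_pos hξ hx.le).le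
  rw [← h3]
  exact abs_real_inner_le_norm _ _

theorem differentiableAt_dMap {ξ x : Eu n} (hξ : ‖ξ‖ < 1) (hx : ‖x‖ ≤ 1) :
    DifferentiableAt ℝ (dMap ξ) x := by
  have h := (dDen_pos hξ hx).ne'
  have h0 : DifferentiableAt ℝ (fun y : Eu n => ‖y‖ ^ 2) x := differentiableAt_id.norm_sq ℝ
  have h1 : DifferentiableAt ℝ (fun y : Eu n => (⟪ξ, y⟫ : ℝ)) x :=
    (differentiableAt_const ξ).inner ℝ differentiableAt_id
  have h2 : DifferentiableAt ℝ (fun y : Eu n => 1 + 2 * (⟪ξ, y⟫ : ℝ) + ‖y‖ ^ 2 * ‖ξ‖ ^ 2) x := by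
    fun_prop
  refine DifferentiableAt.smul (DifferentiableAt.inv h2 h) (by fun_prop)

theorem differentiableAt_Refl (p x : Eu n) : DifferentiableAt ℝ (Refl p) x := by
  have h1 : DifferentiableAt ℝ (fun y : Eu n => (⟪p, y⟫ : ℝ)) x :=
    (differentiableAt_const p).inner ℝ differentiableAt_id
  unfold Refl
  fun_prop

theorem differentiableAt_tauMap {r : ℝ} (hr : r ∈ Ioo (-1 : ℝ) 1) {p : Eu n} (hp : ‖p‖ = 1)
    {x : Eu n} (hx : ‖x‖ = 1) : DifferentiableAt ℝ (tauMap r p) x := by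
  have h0 := norm_smul_lt_one hr hp
  have h1 : ‖-(r • p)‖ < 1 := by rwa [norm_neg]
  have h2 : ‖dMap (-(r • p)) x‖ = 1 := (isMob_dMap h1).norm_eq hx
  refine DifferentiableAt.comp x (g := dMap (r • p)) (differentiableAt_dMap h0 ?_)
    (DifferentiableAt.comp x (g := Refl p) (differentiableAt_Refl _ _)
      (differentiableAt_dMap h1 hx.le))
  rw [Function.comp_apply, norm_Refl hp, h2]

theorem fderiv_inner_dMap {ξ s x t : Eu n} (hξ : ‖ξ‖ < 1) (hx : ‖x‖ = 1)
    (hxt : (⟪x, t⟫ : ℝ) = 0) :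
    fderiv ℝ (fun y => (⟪s, dMap ξ y⟫ : ℝ)) x t = dMapDeriv ξ s x t := by
  have hdiff : DifferentiableAt ℝ (fun y => (⟪s, dMap ξ y⟫ : ℝ)) x :=
    (differentiableAt_const s).inner ℝ (differentiableAt_dMap hξ hx.le)
  have hD := (dDen_pos hξ hx.le)
  have hline := hdiff.hasFDerivAt.hasLineDerivAt t
  unfold HasLineDerivAt at hline
  refine hline.unique ?_
  have hnorm : ∀ θ : ℝ, ‖x + θ • t‖ ^ 2 = 1 + θ ^ 2 * ‖t‖ ^ 2 := by
    intro θ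
    rw [@norm_add_sq_real, inner_smul_right, hxt, norm_smul, hx, mul_pow, Real.norm_eq_abs, sq_abs]
    ring
  have hden : HasDerivAt (fun θ : ℝ => 1 + 2 * ((⟪ξ, x⟫ : ℝ) + θ * ⟪ξ, t⟫)
      + (1 + θ ^ 2 * ‖t‖ ^ 2) * ‖ξ‖ ^ 2) (2 * ⟪ξ, t⟫) 0 := by
    have := ((((hasDerivAt_id (0 : ℝ)).mul_const (⟪ξ, t⟫ : ℝ)).const_add (⟪ξ, x⟫ : ℝ)).const_mul
      2).const_add 1 |>.add
      (((((hasDerivAt_id (0 : ℝ)).pow 2).mul_const (‖t‖ ^ 2)).const_add 1).mul_const (‖ξ‖ ^ 2))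
    exact this.congr_deriv (by simp)
  have hnum : HasDerivAt (fun θ : ℝ => (1 - ‖ξ‖ ^ 2) * ((⟪s, x⟫ : ℝ) + θ * ⟪s, t⟫)
      + (1 + 2 * ((⟪ξ, x⟫ : ℝ) + θ * ⟪ξ, t⟫) + (1 + θ ^ 2 * ‖t‖ ^ 2)) * ⟪s, ξ⟫)
      ((1 - ‖ξ‖ ^ 2) * ⟪s, t⟫ + 2 * ⟪ξ, t⟫ * ⟪s, ξ⟫) 0 := by
    have := (((hasDerivAt_id (0 : ℝ)).mul_const (⟪s, t⟫ : ℝ)).const_add (⟪s, x⟫ : ℝ)).const_mul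
      (1 - ‖ξ‖ ^ 2) |>.add
      ((((((hasDerivAt_id (0 : ℝ)).mul_const (⟪ξ, t⟫ : ℝ)).const_add (⟪ξ, x⟫ : ℝ)).const_mul
      2).const_add 1 |>.add
      ((((hasDerivAt_id (0 : ℝ)).pow 2).mul_const (‖t‖ ^ 2)).const_add 1)).mul_const (⟪s, ξ⟫ : ℝ))
    exact this.congr_deriv (by simp)
  have hD1 : dDen ξ x = 1 + 2 * ⟪ξ, x⟫ + ‖ξ‖ ^ 2 := by rw [dDen, hx]; ring
  have hq := (hden.inv (by simp; rw [← hD1]; exact hD.ne')).mul hnum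
  have hfun : (fun θ : ℝ => (⟪s, dMap ξ (x + θ • t)⟫ : ℝ)) = fun θ : ℝ =>
      (1 + 2 * ((⟪ξ, x⟫ : ℝ) + θ * ⟪ξ, t⟫) + (1 + θ ^ 2 * ‖t‖ ^ 2) * ‖ξ‖ ^ 2)⁻¹ *
      ((1 - ‖ξ‖ ^ 2) * ((⟪s, x⟫ : ℝ) + θ * ⟪s, t⟫)
      + (1 + 2 * ((⟪ξ, x⟫ : ℝ) + θ * ⟪ξ, t⟫) + (1 + θ ^ 2 * ‖t‖ ^ 2)) * ⟪s, ξ⟫) := by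
    ext θ
    rw [inner_dMap, dDen, hnorm]
    simp only [inner_add_right, inner_smul_right]
  rw [hfun]
  refine (HasDerivAt.congr_deriv hq ?_)
  have hD2 : (⟪ξ, x⟫ : ℝ) = (dDen ξ x - 1 - ‖ξ‖ ^ 2) / 2 := by rw [hD1]; ring
  simp only [dMapDeriv, dFac, inner_add_right]
  simp only [zero_mul, add_zero, ne_eq, OfNat.ofNat_ne_zero, not_false_eq_true, zero_pow,
    one_mul, hD2, Pi.inv_apply]
  have hD3 : 1 + 2 * ((dDen ξ x - 1 - ‖ξ‖ ^ 2) / 2) + ‖ξ‖ ^ 2 = dDen ξ x := by ring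
  rw [hD3]
  field_simp
  ring

theorem fderiv_congr_sphere {f h : Eu n → ℝ} {x t : Eu n} (hf : DifferentiableAt ℝ f x)
    (hh : DifferentiableAt ℝ h x) (hfh : ∀ y, ‖y‖ = 1 → f y = h y) (hx : ‖x‖ = 1)
    (hxt : (⟪x, t⟫ : ℝ) = 0) : fderiv ℝ f x t = fderiv ℝ h x t := by
  set γ : ℝ → Eu n := fun θ => (√(1 + θ ^ 2 * ‖t‖ ^ 2))⁻¹ • (x + θ • t) with hγ
  have hγ0 : γ 0 = x := by simp [hγ]
  have hγn : ∀ θ, ‖γ θ‖ = 1 := by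
    intro θ
    have h0 : 0 < 1 + θ ^ 2 * ‖t‖ ^ 2 := by positivity
    have h1 : ‖x + θ • t‖ = √(1 + θ ^ 2 * ‖t‖ ^ 2) := by
      rw [← Real.sqrt_sq (norm_nonneg _), @norm_add_sq_real, inner_smul_right, hxt, norm_smul, hx,
        mul_pow, Real.norm_eq_abs, sq_abs]
      ring_nf
    rw [hγ]
    simp only
    rw [norm_smul, h1, norm_inv, Real.norm_of_nonneg (Real.sqrt_nonneg _),
      inv_mul_cancel₀ (Real.sqrt_pos.2 h0).ne']
  have hγd : HasDerivAt γ t 0 := by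
    have h1 : HasDerivAt (fun θ : ℝ => 1 + θ ^ 2 * ‖t‖ ^ 2) 0 0 := by
      have := (((hasDerivAt_id (0 : ℝ)).pow 2).mul_const (‖t‖ ^ 2)).const_add 1
      exact this.congr_deriv (by simp)
    have h2 := (h1.sqrt (by simp)).inv (by simp)
    have h3 : HasDerivAt (fun θ : ℝ => x + θ • t) t 0 := by
      simpa using ((hasDerivAt_id (0 : ℝ)).smul_const t).const_add x
    have h4 := h2.smul h3
    exact h4.congr_deriv (by simp)
  have e1 := (hγ0.symm ▸ hf.hasFDerivAt : HasFDerivAt f (fderiv ℝ f x) (γ 0)).comp_hasDerivAt 0 hγd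
  have e2 := (hγ0.symm ▸ hh.hasFDerivAt : HasFDerivAt h (fderiv ℝ h x) (γ 0)).comp_hasDerivAt 0 hγd
  have e3 : f ∘ γ = h ∘ γ := by
    ext θ
    exact hfh _ (hγn θ)
  rw [e3] at e1
  exact e1.unique e2

/-- The derivative of the test function away from the boundary of the cap. -/
theorem fderiv_testFun {r : ℝ} (hr : r ∈ Ioo (-1 : ℝ) 1) {p : Eu n} (hp : ‖p‖ = 1)
    {ξ s x t : Eu n} (hξ : ‖ξ‖ < 1) (hs : ‖s‖ = 1) (hx : ‖x‖ = 1) (hxt : (⟪x, t⟫ : ℝ) = 0)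
    (hside : side r p x ≠ 0) :
    fderiv ℝ (testFun n ξ r p s) x t = capInd r p x * dMapDeriv ξ s x t +
      capInd (-r) (-p) x * dMapDeriv (reflPt r p ξ) (reflDir r p ξ s) x t := by
  have h0 : ‖-(r • p)‖ < 1 := by rw [norm_neg]; exact norm_smul_lt_one hr hp
  have hcont : ContinuousAt (fun y => (⟪p, dMap (-(r • p)) y⟫ : ℝ)) x :=
    continuousAt_const.inner (differentiableAt_dMap h0 hx.le).continuousAt
  have hinner := inner_dMap_neg_smul r hp hx
  have hDinv := inv_pos.2 (dDen_pos h0 hx.le)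
  simp only [capInd, side_neg]
  rcases hside.lt_or_gt with hlt | hgt
  · rw [if_neg hlt.not_gt, if_pos (neg_pos.2 hlt), zero_mul, one_mul, zero_add,
      ← fderiv_inner_dMap (norm_reflPt hr hp hξ) hx hxt]
    have hneg : (⟪p, dMap (-(r • p)) x⟫ : ℝ) < 0 := by
      rw [hinner]; exact mul_neg_of_pos_of_neg hDinv hlt
    have hev : testFun n ξ r p s =ᶠ[𝓝 x] fun y => (⟪s, dMap ξ (tauMap r p y)⟫ : ℝ) := by
      filter_upwards [hcont.eventually_lt_const hneg] with y hy
      simp only [testFun, if_neg hy.not_gt, Xfun]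
    rw [hev.fderiv_eq]
    refine fderiv_congr_sphere ?_ ?_ (fun y hy => inner_dMap_tauMap hr hp hξ hs hy) hx hxt
    · refine (differentiableAt_const s).inner ℝ ?_
      exact DifferentiableAt.comp x (g := dMap ξ)
        (differentiableAt_dMap hξ ((isMob_tauMap hr hp).norm_eq hx).le)
        (differentiableAt_tauMap hr hp hx)
    · exact (differentiableAt_const _).inner ℝ
        (differentiableAt_dMap (norm_reflPt hr hp hξ) hx.le)
  · rw [if_pos hgt, if_neg (by linarith), zero_mul, one_mul, add_zero,
      ← fderiv_inner_dMap hξ hx hxt]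
    have hpos : 0 < (⟪p, dMap (-(r • p)) x⟫ : ℝ) := (inner_dMap_pos_iff hr hp hx).2 hgt
    have hev : testFun n ξ r p s =ᶠ[𝓝 x] fun y => (⟪s, dMap ξ y⟫ : ℝ) := by
      filter_upwards [hcont.eventually_const_lt hpos] with y hy
      simp only [testFun, if_pos hy, Xfun]
    rw [hev.fderiv_eq]

theorem testFun_eq_capInd {r : ℝ} (hr : r ∈ Ioo (-1 : ℝ) 1) {p : Eu n} (hp : ‖p‖ = 1)
    {ξ s x : Eu n} (hξ : ‖ξ‖ < 1) (hs : ‖s‖ = 1) (hx : ‖x‖ = 1)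
    (hside : side r p x ≠ 0) :
    testFun n ξ r p s x = capInd r p x * ⟪s, dMap ξ x⟫ +
      capInd (-r) (-p) x * ⟪reflDir r p ξ s, dMap (reflPt r p ξ) x⟫ := by
  rw [testFun_eq hr hp hx]
  simp only [capInd, side_neg, fold]
  rcases hside.lt_or_gt with hlt | hgt
  · rw [if_neg hlt.not_gt, if_neg hlt.not_gt, if_pos (neg_pos.2 hlt),
      inner_dMap_tauMap hr hp hξ hs hx]
    ring
  · rw [if_pos hgt, if_pos hgt, if_neg (by linarith)]
    ring

/-- The tangential part of the first coordinate vector. -/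
def tvec (x : Eu n) : Eu n := e1 n - (⟪e1 n, x⟫ : ℝ) • x

theorem norm_e1 : ‖e1 n‖ = 1 := by simp [e1]

theorem continuous_tvec : Continuous (tvec (n := n)) := by
  unfold tvec
  fun_prop

theorem inner_tvec {x : Eu n} (hx : ‖x‖ = 1) : (⟪x, tvec x⟫ : ℝ) = 0 := by
  rw [tvec, inner_sub_right, inner_smul_right, real_inner_self_eq_norm_sq, hx, real_inner_comm]
  ring

theorem norm_tvec_sq {x : Eu n} (hx : ‖x‖ = 1) : ‖tvec x‖ ^ 2 = 1 - (⟪e1 n, x⟫ : ℝ) ^ 2 := by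
  rw [tvec, @norm_sub_sq_real, inner_smul_right, norm_smul, norm_e1, hx, mul_one, Real.norm_eq_abs,
    sq_abs]
  ring

theorem inner_e1_tvec (x : Eu n) : (⟪e1 n, tvec x⟫ : ℝ) = 1 - (⟪e1 n, x⟫ : ℝ) ^ 2 := by
  rw [tvec, inner_sub_right, inner_smul_right, real_inner_self_eq_norm_sq, norm_e1]
  ring

theorem norm_tvec_le {x : Eu n} (hx : ‖x‖ = 1) : ‖tvec x‖ ≤ 1 := by
  rw [← sq_le_one_iff₀ (norm_nonneg _), norm_tvec_sq hx]
  linarith [sq_nonneg (⟪e1 n, x⟫ : ℝ)]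

theorem gradS_Xfun (s x : Eu n) : gradS (Xfun s) x = s - (⟪s, x⟫ : ℝ) • x := by
  have h : gradient (Xfun s) x = s := by
    have h1 : HasFDerivAt (Xfun s) (InnerProductSpace.toDual ℝ (Eu n) s) x :=
      (InnerProductSpace.toDual ℝ (Eu n) s).hasFDerivAt
    have h2 : HasGradientAt (Xfun s) s x := h1
    exact h2.gradient
  rw [gradS, h]

theorem inner_gradS (f : Eu n → ℝ) {x t : Eu n} (hxt : (⟪x, t⟫ : ℝ) = 0) :
    (⟪gradS f x, t⟫ : ℝ) = fderiv ℝ f x t := by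
  rw [gradS, inner_sub_left, inner_smul_left, hxt, mul_zero, sub_zero, gradient,
    InnerProductSpace.toDual_symm_apply]

end Derivatives

section CapEstimate

variable {n : ℕ}

theorem exists_sphMeasure_ball_le (hn : 2 ≤ n) : ∃ C : ℝ, 0 ≤ C ∧ ∀ q : Eu n, ‖q‖ = 1 →
    ∀ t ∈ Ioc (0 : ℝ) 1, sphMeasure n {x | ‖x - q‖ < t} ≤ ENNReal.ofReal (C * t ^ 2) := by
  set V : ℝ := (volume (ball (0 : Eu n) 1)).toReal with hV
  have hV0 : 0 ≤ V := ENNReal.toReal_nonneg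
  refine ⟨(n + 1 : ℕ) * (3 * 2 ^ (n + 1) * V), by positivity, fun q hq t ht => ?_⟩
  have hmeas : MeasurableSet {x : Eu n | ‖x - q‖ < t} :=
    measurableSet_lt (by fun_prop) measurable_const
  refine (sphMeasure_apply_le hmeas).trans ?_
  set N : ℕ := ⌈1 / t⌉₊ with hN
  have hN1 : 1 / t ≤ N := Nat.le_ceil _
  have hN2 : (N : ℝ) < 1 / t + 1 := Nat.ceil_lt_add_one (by have := ht.1; positivity)
  have hN0 : (0 : ℝ) < N := lt_of_lt_of_le (by have := ht.1; positivity) hN1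
  have hNt : 1 / (N : ℝ) ≤ t := by
    rw [div_le_iff₀ hN0]
    rw [div_le_iff₀ ht.1] at hN1
    linarith
  have hsub : {y : Eu n | ∃ s ∈ Ioo (0 : ℝ) 1, ∃ x, ‖x‖ = 1 ∧ x ∈ {x : Eu n | ‖x - q‖ < t} ∧
      y = s • x} ⊆ ⋃ k ∈ Finset.range (N + 1), ball (((k : ℝ) / N) • q) (2 * t) := by
    rintro y ⟨s, hs, x, hx, hxq, rfl⟩
    have hxq' : ‖x - q‖ < t := hxq
    simp only [mem_iUnion, Finset.mem_range]
    refine ⟨⌊s * N⌋₊, ?_, ?_⟩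
    · have h1 : ((⌊s * N⌋₊ : ℕ) : ℝ) ≤ s * N := Nat.floor_le (by have := hs.1; positivity)
      have h2 : s * N < N := by nlinarith [hs.2]
      have : ((⌊s * N⌋₊ : ℕ) : ℝ) < ((N + 1 : ℕ) : ℝ) := by push_cast; linarith
      exact_mod_cast this
    · rw [mem_ball, dist_eq_norm]
      have h1 : ((⌊s * N⌋₊ : ℕ) : ℝ) ≤ s * N := Nat.floor_le (by have := hs.1; positivity)
      have h2 : s * N < ⌊s * N⌋₊ + 1 := Nat.lt_floor_add_one _
      have h3 : |s - (⌊s * N⌋₊ : ℝ) / N| ≤ 1 / N := by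
        rw [abs_of_nonneg, sub_le_iff_le_add, ← add_div, le_div_iff₀ hN0]
        · linarith
        · rw [sub_nonneg, div_le_iff₀ hN0]
          exact h1
      have h4 : s • x - ((⌊s * N⌋₊ : ℝ) / N) • q = s • (x - q) + (s - (⌊s * N⌋₊ : ℝ) / N) • q := by
        module
      rw [h4]
      refine (norm_add_le _ _).trans_lt ?_
      rw [norm_smul, norm_smul, hq, mul_one, Real.norm_of_nonneg hs.1.le, Real.norm_eq_abs]
      nlinarith [norm_nonneg (x - q), hs.2, hs.1]
  have hball : ∀ c : Eu n, volume (ball c (2 * t)) = ENNReal.ofReal ((2 * t) ^ (n + 1) * V) := by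
    intro c
    rw [Measure.addHaar_ball _ _ (by linarith [ht.1]), finrank_euclideanSpace, Fintype.card_fin,
      ENNReal.ofReal_mul (by have := ht.1; positivity), hV, ENNReal.ofReal_toReal]
    exact measure_ball_lt_top.ne
  have hvol : volume {y : Eu n | ∃ s ∈ Ioo (0 : ℝ) 1, ∃ x, ‖x‖ = 1 ∧
      x ∈ {x : Eu n | ‖x - q‖ < t} ∧ y = s • x} ≤ ENNReal.ofReal (3 * 2 ^ (n + 1) * V * t ^ 2) := by
    refine (measure_mono hsub).trans ((measure_biUnion_finset_le _ _).trans ?_)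
    simp only [hball, Finset.sum_const, Finset.card_range, nsmul_eq_mul]
    rw [← ENNReal.ofReal_natCast, ← ENNReal.ofReal_mul (by positivity)]
    refine ENNReal.ofReal_le_ofReal ?_
    have h1 : ((N + 1 : ℕ) : ℝ) * t ≤ 3 := by
      push_cast
      have : (1 / t) * t = 1 := by field_simp [ht.1.ne']
      nlinarith [ht.1, ht.2]
    have h2 : t ^ n ≤ t ^ 2 := pow_le_pow_of_le_one ht.1.le ht.2 hn
    calc ((N + 1 : ℕ) : ℝ) * ((2 * t) ^ (n + 1) * V)
        = (((N + 1 : ℕ) : ℝ) * t) * (2 ^ (n + 1) * V * t ^ n) := by rw [mul_pow, pow_succ t]; ring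
      _ ≤ 3 * (2 ^ (n + 1) * V * t ^ 2) := by
        have := ht.1
        gcongr
      _ = 3 * 2 ^ (n + 1) * V * t ^ 2 := by ring
  calc ((n + 1 : ℕ) : ℝ≥0∞) * _
      ≤ ((n + 1 : ℕ) : ℝ≥0∞) * ENNReal.ofReal (3 * 2 ^ (n + 1) * V * t ^ 2) := by gcongr
    _ = ENNReal.ofReal ((n + 1 : ℕ) * (3 * 2 ^ (n + 1) * V) * t ^ 2) := by
        rw [← ENNReal.ofReal_natCast, ← ENNReal.ofReal_mul (by positivity)]
        congr 1
        ring

theorem norm_sub_lt_of_lt_dFac {ξ x : Eu n} (hξ : ‖ξ‖ < 1) (hx : ‖x‖ = 1) {t : ℝ} (ht : 3 ≤ t)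
    (h : t < dFac ξ x) : ξ ≠ 0 ∧ ‖x - (-(‖ξ‖⁻¹ • ξ))‖ < 2 / t := by
  have hD := dDen_pos hξ hx.le
  rw [dFac, lt_div_iff₀ hD] at h
  have hD1 : dDen ξ x = 1 + 2 * ⟪ξ, x⟫ + ‖ξ‖ ^ 2 := by rw [dDen, hx]; ring
  have hinner : -‖ξ‖ ≤ (⟪ξ, x⟫ : ℝ) := by
    have := abs_real_inner_le_norm ξ x
    rw [hx, mul_one] at this
    exact (abs_le.1 this).1
  have h0 := norm_nonneg ξ
  have hlow : (1 - ‖ξ‖) ^ 2 ≤ dDen ξ x := by rw [hD1]; nlinarith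
  have hhalf : 1 / 2 < ‖ξ‖ := by
    by_contra! hle
    nlinarith
  have hξ0 : ξ ≠ 0 := by
    rintro rfl
    norm_num at hhalf
  refine ⟨hξ0, ?_⟩
  set d := ‖x - (-(‖ξ‖⁻¹ • ξ))‖ with hd
  have hd2 : ‖ξ‖ * d ^ 2 = dDen ξ x - (1 - ‖ξ‖) ^ 2 := by
    rw [hd, sub_neg_eq_add, @norm_add_sq_real, inner_smul_right, norm_smul, norm_inv, norm_norm, hx,
      inv_mul_cancel₀ (norm_ne_zero_iff.2 hξ0), hD1, real_inner_comm]
    field_simp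
    ring
  have hd0 : 0 ≤ d := norm_nonneg _
  rw [lt_div_iff₀ (by linarith)]
  have h1 : (1 - ‖ξ‖) * d ≤ dDen ξ x := by
    nlinarith [sq_nonneg ((1 - ‖ξ‖) - d / 2), sq_nonneg d]
  by_contra! hcon
  have h2 : 0 < 1 - ‖ξ‖ := by linarith
  have h3 : d * (t * dDen ξ x) ≥ 2 * dDen ξ x := by nlinarith
  have hdpos : 0 < d := by
    by_contra! h'
    have : d = 0 := le_antisymm h' hd0
    rw [this] at hcon
    norm_num at hcon
  have h4 : d * (t * dDen ξ x) < d * (1 - ‖ξ‖ ^ 2) := mul_lt_mul_of_pos_left h hdpos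
  nlinarith

theorem exists_sphMeasure_dFac_le (hn : 2 ≤ n) : ∃ C : ℝ, 0 ≤ C ∧ ∀ ξ : Eu n, ‖ξ‖ < 1 →
    ∀ t : ℝ, 3 ≤ t → sphMeasure n {x | t < dFac ξ x} ≤ ENNReal.ofReal (C * t ^ (-2 : ℝ)) := by
  obtain ⟨C, hC, h⟩ := exists_sphMeasure_ball_le hn
  refine ⟨4 * C, by positivity, fun ξ hξ t ht => ?_⟩
  have ht0 : 0 < t := by linarith
  by_cases hξ0 : ξ = 0
  · have : sphMeasure n {x | t < dFac ξ x} = 0 := by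
      have : ∀ᵐ x ∂(sphMeasure n), ¬ t < dFac ξ x := ae_sphMeasure_norm.mono fun x hx hx' =>
        (norm_sub_lt_of_lt_dFac hξ hx ht hx').1 hξ0
      simp only [ae_iff, not_not] at this
      exact this
    rw [this]
    exact zero_le
  · have hq : ‖-(‖ξ‖⁻¹ • ξ)‖ = 1 := by
      rw [norm_neg, norm_smul, norm_inv, norm_norm, inv_mul_cancel₀ (norm_ne_zero_iff.2 hξ0)]
    have h1 : sphMeasure n {x | t < dFac ξ x} ≤
        sphMeasure n {x | ‖x - (-(‖ξ‖⁻¹ • ξ))‖ < 2 / t} := by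
      refine measure_mono_ae ?_
      filter_upwards [ae_sphMeasure_norm (n := n)] with x hx hx'
      exact (norm_sub_lt_of_lt_dFac hξ hx ht hx').2
    refine h1.trans ((h _ hq (2 / t) ⟨by positivity, ?_⟩).trans (le_of_eq ?_))
    · rw [div_le_one ht0]; linarith
    · rw [Real.rpow_neg ht0.le, Real.rpow_two]
      congr 1
      field_simp
      norm_num

theorem measurable_dFac (ξ : Eu n) : Measurable (dFac ξ) := by
  unfold dFac dDen
  fun_prop

theorem exists_setLIntegral_dFac_le (hn : 2 ≤ n) : ∃ C : ℝ, 0 ≤ C ∧ ∀ ξ : Eu n, ‖ξ‖ < 1 →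
    ∀ M : ℝ, 3 ≤ M → ∀ A : Set (Eu n),
    ∫⁻ x in A, ENNReal.ofReal (dFac ξ x) ∂(sphMeasure n) ≤
      ENNReal.ofReal M * sphMeasure n A + ENNReal.ofReal (C / M) := by
  obtain ⟨C, hC, h⟩ := exists_sphMeasure_dFac_le hn
  refine ⟨C, hC, fun ξ hξ M hM A => ?_⟩
  have hM0 : 0 < M := by linarith
  rw [lintegral_eq_lintegral_meas_lt _ (ae_restrict_of_ae (ae_sphMeasure_norm.mono fun x hx =>
    (dFac_pos hξ hx.le).le)) (measurable_dFac ξ).aemeasurable,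
    ← Ioc_union_Ioi_eq_Ioi hM0.le]
  refine (lintegral_union_le _ _ _).trans (add_le_add ?_ ?_)
  · calc ∫⁻ t in Ioc 0 M, (sphMeasure n).restrict A {a | t < dFac ξ a}
        ≤ ∫⁻ _ in Ioc 0 M, sphMeasure n A := by
          refine lintegral_mono fun t => (measure_mono (subset_univ _)).trans ?_
          simp
      _ = ENNReal.ofReal M * sphMeasure n A := by simp [mul_comm]
  · calc ∫⁻ t in Ioi M, (sphMeasure n).restrict A {a | t < dFac ξ a}
        ≤ ∫⁻ t in Ioi M, ENNReal.ofReal (C * t ^ (-2 : ℝ)) := by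
          refine setLIntegral_mono' measurableSet_Ioi fun t ht => ?_
          have ht' : M < t := ht
          exact (Measure.restrict_apply_le _ _).trans (h ξ hξ t (by linarith))
      _ = ENNReal.ofReal (C / M) := by
          rw [← ofReal_integral_eq_lintegral_ofReal]
          · rw [integral_const_mul, integral_Ioi_rpow_of_lt (by norm_num) hM0]
            congr 1
            norm_num
            rw [Real.rpow_neg hM0.le, Real.rpow_one]
            rfl
          · exact (integrableOn_Ioi_rpow_of_lt (by norm_num) hM0).const_mul C
          · refine (ae_restrict_mem measurableSet_Ioi).mono fun t ht => ?_
            have ht' : M < t := ht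
            have : 0 < t := by linarith
            positivity

theorem tendsto_integral_capInd_mul_dFac (hn : 2 ≤ n) {l : Filter ℝ} {p : Eu n}
    {ξ : ℝ → Eu n} (hξ : ∀ᶠ r in l, ‖ξ r‖ < 1)
    (hl : Tendsto (fun r => ∫ x, capInd r p x ∂(sphMeasure n)) l (𝓝 0)) :
    Tendsto (fun r => ∫ x, capInd r p x * dFac (ξ r) x ∂(sphMeasure n)) l (𝓝 0) := by
  obtain ⟨C, hC, h⟩ := exists_setLIntegral_dFac_le hn
  have hbound : ∀ r, ‖ξ r‖ < 1 → ∀ M : ℝ, 3 ≤ M →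
      ∫ x, capInd r p x * dFac (ξ r) x ∂(sphMeasure n) ≤
        M * ∫ x, capInd r p x ∂(sphMeasure n) + C / M := by
    intro r hr M hM
    have hM0 : 0 < M := by linarith
    have hA : MeasurableSet {x : Eu n | 0 < side r p x} :=
      measurableSet_lt measurable_const (continuous_side r p).measurable
    have h1 : ∫ x, capInd r p x ∂(sphMeasure n) = (sphMeasure n {x | 0 < side r p x}).toReal := by
      have : capInd r p = indicator {x | 0 < side r p x} (fun _ => (1 : ℝ)) := by
        ext x
        simp [capInd, indicator, mem_ofPred_eq]
      rw [this, integral_indicator hA]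
      simp [Measure.real]
    have h2 : ∫ x, capInd r p x * dFac (ξ r) x ∂(sphMeasure n) =
        ∫ x in {x | 0 < side r p x}, dFac (ξ r) x ∂(sphMeasure n) := by
      rw [← integral_indicator hA]
      congr 1
      ext x
      simp [capInd, indicator, mem_ofPred_eq]
    rw [h1, h2, integral_eq_lintegral_of_nonneg_ae (ae_restrict_of_ae
      (ae_sphMeasure_norm.mono fun x hx => (dFac_pos hr hx.le).le))
      (measurable_dFac _).aestronglyMeasurable]
    refine (ENNReal.toReal_mono ?_ (h (ξ r) hr M hM _)).trans (le_of_eq ?_)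
    · exact ENNReal.add_ne_top.2 ⟨ENNReal.mul_ne_top ENNReal.ofReal_ne_top (measure_ne_top _ _),
        ENNReal.ofReal_ne_top⟩
    · rw [ENNReal.toReal_add (ENNReal.mul_ne_top ENNReal.ofReal_ne_top (measure_ne_top _ _))
        ENNReal.ofReal_ne_top, ENNReal.toReal_mul, ENNReal.toReal_ofReal hM0.le,
        ENNReal.toReal_ofReal (by positivity)]
  have hnonneg : ∀ᶠ r in l, 0 ≤ ∫ x, capInd r p x * dFac (ξ r) x ∂(sphMeasure n) := by
    filter_upwards [hξ] with r hr
    exact integral_nonneg_of_ae (ae_sphMeasure_norm.mono fun x hx =>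
      mul_nonneg (capInd_nonneg _ _ _) (dFac_pos hr hx.le).le)
  refine tendsto_order.2 ⟨fun a ha => hnonneg.mono fun r hr => ha.trans_le hr, fun ε hε => ?_⟩
  set M : ℝ := 3 + 2 * C / ε with hM
  have hM3 : 3 ≤ M := by rw [hM]; have : 0 ≤ 2 * C / ε := by positivity
                         linarith
  have hM0 : 0 < M := by linarith
  have h1 : Tendsto (fun r => M * ∫ x, capInd r p x ∂(sphMeasure n) + C / M) l
      (𝓝 (M * 0 + C / M)) := (hl.const_mul M).add_const _
  have h2 : M * 0 + C / M < ε := by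
    rw [mul_zero, zero_add, div_lt_iff₀ hM0, hM]
    field_simp
    nlinarith
  filter_upwards [hξ, h1.eventually_lt_const h2] with r hr hr'
  exact (hbound r hr M hM3).trans_lt hr'

end CapEstimate

section Kernels

variable {n : ℕ} {w : Eu n → ℝ} {ξfun sfun : ℝ → Eu n → Eu n} {G : Eu n → Eu n → Eu n → ℝ}

/-- The integrands `G ξ s x` whose integrals over the cap `a` with `ξ = ξ(a)` and `s = s(a)` can be
controlled as `a` degenerates. -/
structure IsKernel (G : Eu n → Eu n → Eu n → ℝ) : Prop where
  measurable : ∀ ξ s, Measurable (G ξ s)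
  bound : ∃ C : ℝ, 0 ≤ C ∧ ∀ ξ s x, ‖ξ‖ < 1 → ‖s‖ = 1 → ‖x‖ = 1 → |G ξ s x| ≤ C * (1 + dFac ξ x)
  continuousOn : ∀ x, ‖x‖ = 1 → ContinuousOn (fun q : Eu n × Eu n => G q.1 q.2 x) {q | ‖q.1‖ < 1}
  neg : ∀ ξ s x, G ξ (-s) x = -G ξ s x

theorem dFac_le {ξ x : Eu n} (hx : ‖x‖ = 1) {ρ : ℝ} (hξ : ‖ξ‖ ≤ ρ) (hρ : ρ < 1) :
    dFac ξ x ≤ 2 / (1 - ρ) := by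
  have hξ1 : ‖ξ‖ < 1 := hξ.trans_lt hρ
  have hlow : (1 - ‖ξ‖) ^ 2 ≤ dDen ξ x := by
    rw [dDen, hx]
    have := abs_real_inner_le_norm ξ x
    rw [hx, mul_one] at this
    nlinarith [(abs_le.1 this).1]
  have h0 := norm_nonneg ξ
  rw [dFac, div_le_div_iff₀ (dDen_pos hξ1 hx.le) (by linarith)]
  have h1 : (1 - ‖ξ‖ ^ 2) * (1 - ρ) ≤ (1 - ‖ξ‖ ^ 2) * (1 - ‖ξ‖) :=
    mul_le_mul_of_nonneg_left (by linarith) (one_sub_norm_sq_pos hξ1).le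
  have h2 : (1 - ‖ξ‖ ^ 2) * (1 - ‖ξ‖) ≤ 2 * (1 - ‖ξ‖) ^ 2 := by
    nlinarith [sq_nonneg (1 - ‖ξ‖)]
  linarith

namespace IsKernel

theorem exists_bound (hG : IsKernel G) {ρ : ℝ} (hρ : ρ < 1) : ∃ C : ℝ, ∀ ξ s x, ‖ξ‖ ≤ ρ →
    ‖s‖ = 1 → ‖x‖ = 1 → ∀ r p, |capInd r p x * G ξ s x| ≤ C := by
  obtain ⟨C, hC, h⟩ := hG.bound
  refine ⟨C * (1 + 2 / (1 - ρ)), fun ξ s x hξ hs hx r p => ?_⟩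
  rw [abs_mul]
  calc |capInd r p x| * |G ξ s x| ≤ 1 * |G ξ s x| :=
        mul_le_mul_of_nonneg_right (abs_capInd_le r p x) (abs_nonneg _)
    _ ≤ C * (1 + dFac ξ x) := by rw [one_mul]; exact h ξ s x (hξ.trans_lt hρ) hs hx
    _ ≤ C * (1 + 2 / (1 - ρ)) := by
        have := dFac_le hx hξ hρ
        gcongr

theorem integrable (hG : IsKernel G) {ξ s : Eu n} (hξ : ‖ξ‖ < 1) (hs : ‖s‖ = 1) (r : ℝ)
    (p : Eu n) : Integrable (fun x => capInd r p x * G ξ s x) (sphMeasure n) := by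
  obtain ⟨C, hC⟩ := hG.exists_bound hξ
  exact integrable_of_ae_norm_eq_one ae_sphMeasure_norm
    ((measurable_capInd r p).mul (hG.measurable ξ s)) C
    fun x hx => hC ξ s x le_rfl hs hx r p

theorem tendsto_integral (hG : IsKernel G) (hn : 2 ≤ n) {l : Filter ℝ} [l.IsCountablyGenerated]
    {r₀ : ℝ} (hl : l ≤ 𝓝 r₀) (hr₀ : r₀ ∈ Icc (-1 : ℝ) 1) {p : Eu n} (hp : ‖p‖ = 1)
    {ξ s : ℝ → Eu n} {ξ₀ s₀ : Eu n} (hξ₀ : ‖ξ₀‖ < 1) (hξ : Tendsto ξ l (𝓝 ξ₀))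
    (hs : Tendsto s l (𝓝 s₀)) (hs1 : ∀ᶠ r in l, ‖s r‖ = 1) :
    Tendsto (fun r => ∫ x, capInd r p x * G (ξ r) (s r) x ∂(sphMeasure n)) l
      (𝓝 (∫ x, capInd r₀ p x * G ξ₀ s₀ x ∂(sphMeasure n))) := by
  obtain ⟨ρ, hρ1, hρ2⟩ := exists_between hξ₀
  obtain ⟨C, hC⟩ := hG.exists_bound hρ2
  refine tendsto_integral_filter_of_dominated_convergence (fun _ => C) ?_ ?_
    (integrable_const _) ?_
  · exact Eventually.of_forall fun r =>
      ((measurable_capInd r p).mul (hG.measurable _ _)).aestronglyMeasurable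
  · filter_upwards [hs1, hξ.norm.eventually_lt_const hρ1] with r h1 h2
    exact ae_sphMeasure_norm.mono fun x hx => hC _ _ x h2.le h1 hx r p
  · filter_upwards [ae_tendsto_capInd hn hr₀ hp, ae_sphMeasure_norm] with x h1 hx
    refine (h1.mono_left hl).mul ?_
    have hopen : IsOpen {q : Eu n × Eu n | ‖q.1‖ < 1} :=
      isOpen_lt (by fun_prop) continuous_const
    have hmem : ((ξ₀, s₀) : Eu n × Eu n) ∈ {q : Eu n × Eu n | ‖q.1‖ < 1} := hξ₀
    have hat := (hG.continuousOn x hx).continuousAt (hopen.mem_nhds hmem)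
    exact hat.tendsto.comp (hξ.prodMk_nhds hs)

theorem tendsto_integral_zero (hG : IsKernel G) (hn : 2 ≤ n) {l : Filter ℝ} (hl : l ≤ 𝓝 1)
    {p : Eu n} (hp : ‖p‖ = 1) {ξ s : ℝ → Eu n} (hξ : ∀ᶠ r in l, ‖ξ r‖ < 1)
    (hs : ∀ᶠ r in l, ‖s r‖ = 1) :
    Tendsto (fun r => ∫ x, capInd r p x * G (ξ r) (s r) x ∂(sphMeasure n)) l (𝓝 0) := by
  obtain ⟨C, hC, h⟩ := hG.bound
  have h0 : ∫ x, capInd 1 p x ∂(sphMeasure n) = 0 :=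
    integral_eq_zero_of_ae (ae_sphMeasure_norm.mono fun x hx => capInd_one hp hx)
  have h1 : Tendsto (fun r => ∫ x, capInd r p x ∂(sphMeasure n)) l (𝓝 0) := by
    rw [← h0]
    exact (tendsto_integral_capInd hn Measure.AbsolutelyContinuous.rfl (r₀ := 1)
      (by norm_num) hp).mono_left hl
  have h2 := tendsto_integral_capInd_mul_dFac hn hξ h1
  have h3 : Tendsto (fun r => C * (∫ x, capInd r p x ∂(sphMeasure n) +
      ∫ x, capInd r p x * dFac (ξ r) x ∂(sphMeasure n))) l (𝓝 0) := by
    simpa using (h1.add h2).const_mul C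
  refine squeeze_zero_norm' ?_ h3
  filter_upwards [hξ, hs] with r hr1 hr2
  have i1 : Integrable (capInd r p) (sphMeasure n) :=
    integrable_of_ae_norm_eq_one ae_sphMeasure_norm (measurable_capInd r p) 1
      fun x _ => abs_capInd_le r p x
  have i2 : Integrable (fun x => capInd r p x * dFac (ξ r) x) (sphMeasure n) := by
    refine integrable_of_ae_norm_eq_one ae_sphMeasure_norm
      ((measurable_capInd r p).mul (measurable_dFac _)) (2 / (1 - ‖ξ r‖)) fun x hx => ?_
    rw [abs_mul, abs_of_pos (dFac_pos hr1 hx.le)]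
    have h4 := abs_capInd_le r p x
    have h5 := (dFac_pos hr1 hx.le).le
    have h6 := dFac_le hx le_rfl hr1
    nlinarith
  rw [← integral_add i1 i2, ← integral_const_mul]
  refine norm_integral_le_of_norm_le ((i1.add i2).const_mul C) ?_
  filter_upwards [ae_sphMeasure_norm] with x hx
  rw [Real.norm_eq_abs, abs_mul, abs_of_nonneg (capInd_nonneg _ _ _)]
  calc capInd r p x * |G (ξ r) (s r) x| ≤ capInd r p x * (C * (1 + dFac (ξ r) x)) :=
        mul_le_mul_of_nonneg_left (h _ _ x hr1 hr2 hx) (capInd_nonneg _ _ _)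
    _ = C * (capInd r p x + capInd r p x * dFac (ξ r) x) := by ring

end IsKernel

/-- The integral of `G` over the cap `a_{r,p}`. -/
def capIntegral (G : Eu n → Eu n → Eu n → ℝ) (ξfun sfun : ℝ → Eu n → Eu n) (r : ℝ) (p : Eu n) :
    ℝ :=
  ∫ x, capInd r p x * G (ξfun r p) (sfun r p) x ∂(sphMeasure n)

/-- The signed sum of the integrals of `G` over the cap `a_{r,p}` and the dual cap. -/
def capDiff (G : Eu n → Eu n → Eu n → ℝ) (ξfun sfun : ℝ → Eu n → Eu n) (p : Eu n) (r : ℝ) : ℝ :=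
  capIntegral G ξfun sfun r p - capIntegral G ξfun sfun (-r) (-p)

theorem tendsto_neg_Ioo {a : ℝ} :
    Tendsto (fun r : ℝ => -r) (𝓝[Ioo (-1) 1] a) (𝓝[Ioo (-1) 1] (-a)) :=
  tendsto_nhdsWithin_iff.2 ⟨(continuous_neg.tendsto a).mono_left nhdsWithin_le_nhds,
    (eventually_mem_nhdsWithin).mono fun _ hr => mem_Ioo_neg hr⟩

theorem continuousOn_capIntegral (hG : IsKernel G) (hn : 2 ≤ n)
    (hξ : ∀ r ∈ Set.Ioo (-1 : ℝ) 1, ∀ p ∈ sphSet n, ‖ξfun r p‖ < 1)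
    (hs : ∀ r ∈ Set.Ioo (-1 : ℝ) 1, ∀ p ∈ sphSet n, ‖sfun r p‖ = 1)
    (hξcont : ContinuousOn (fun q : ℝ × Eu n => ξfun q.1 q.2) (Set.Ioo (-1 : ℝ) 1 ×ˢ sphSet n))
    (hscont : ContinuousOn (fun q : ℝ × Eu n => sfun q.1 q.2) (Set.Ico (-1 : ℝ) 1 ×ˢ sphSet n))
    {p : Eu n} (hp : ‖p‖ = 1) :
    ContinuousOn (fun r => capIntegral G ξfun sfun r p) (Ioo (-1) 1) := by
  have hmaps : MapsTo (fun r : ℝ => (r, p)) (Ioo (-1) 1) (Ioo (-1 : ℝ) 1 ×ˢ sphSet n) :=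
    fun r hr => ⟨hr, mem_sphSet.2 hp⟩
  have hmaps' : MapsTo (fun r : ℝ => (r, p)) (Ioo (-1) 1) (Ico (-1 : ℝ) 1 ×ˢ sphSet n) :=
    fun r hr => ⟨Ioo_subset_Ico_self hr, mem_sphSet.2 hp⟩
  have hpair : ContinuousOn (fun r : ℝ => (r, p)) (Ioo (-1) 1) := by fun_prop
  intro r₀ hr₀
  exact hG.tendsto_integral hn nhdsWithin_le_nhds (Ioo_subset_Icc_self hr₀) hp
    (hξ r₀ hr₀ p (mem_sphSet.2 hp)) (hξcont.comp hpair hmaps r₀ hr₀)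
    (hscont.comp hpair hmaps' r₀ hr₀)
    (eventually_mem_nhdsWithin.mono fun r hr => hs r hr p (mem_sphSet.2 hp))

theorem tendsto_capIntegral_one (hG : IsKernel G) (hn : 2 ≤ n)
    (hξ : ∀ r ∈ Set.Ioo (-1 : ℝ) 1, ∀ p ∈ sphSet n, ‖ξfun r p‖ < 1)
    (hs : ∀ r ∈ Set.Ioo (-1 : ℝ) 1, ∀ p ∈ sphSet n, ‖sfun r p‖ = 1)
    {p : Eu n} (hp : ‖p‖ = 1) :
    Tendsto (fun r => capIntegral G ξfun sfun r p) (𝓝[Ioo (-1) 1] 1) (𝓝 0) :=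
  hG.tendsto_integral_zero hn nhdsWithin_le_nhds hp
    (eventually_mem_nhdsWithin.mono fun r hr => hξ r hr p (mem_sphSet.2 hp))
    (eventually_mem_nhdsWithin.mono fun r hr => hs r hr p (mem_sphSet.2 hp))

theorem tendsto_capIntegral_neg_one (hG : IsKernel G) (hn : 2 ≤ n)
    (hξ : ∀ p : Eu n, ‖p‖ = 1 →
      Tendsto (fun r => ξfun r p) (𝓝[Ioo (-1) 1] (-1)) (𝓝 0))
    (hs : ∀ r ∈ Set.Ioo (-1 : ℝ) 1, ∀ p ∈ sphSet n, ‖sfun r p‖ = 1)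
    (hscont : ContinuousOn (fun q : ℝ × Eu n => sfun q.1 q.2) (Set.Ico (-1 : ℝ) 1 ×ˢ sphSet n))
    (hinit : ∀ p ∈ sphSet n, sfun (-1) p = -(e1 n)) {p : Eu n} (hp : ‖p‖ = 1) :
    Tendsto (fun r => capIntegral G ξfun sfun r p) (𝓝[Ioo (-1) 1] (-1))
      (𝓝 (-∫ x, G 0 (e1 n) x ∂(sphMeasure n))) := by
  have hmaps' : MapsTo (fun r : ℝ => (r, p)) (Ico (-1) 1) (Ico (-1 : ℝ) 1 ×ˢ sphSet n) :=
    fun r hr => ⟨hr, mem_sphSet.2 hp⟩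
  have hpair : ContinuousOn (fun r : ℝ => (r, p)) (Ico (-1) 1) := by fun_prop
  have h1 : Tendsto (fun r => sfun r p) (𝓝[Ioo (-1) 1] (-1)) (𝓝 (-(e1 n))) := by
    rw [← hinit p (mem_sphSet.2 hp)]
    have := hscont.comp hpair hmaps' (-1) (by norm_num)
    exact this.tendsto.mono_left (nhdsWithin_mono _ Ioo_subset_Ico_self)
  have h2 := hG.tendsto_integral hn (l := 𝓝[Ioo (-1) 1] (-1)) (r₀ := -1) nhdsWithin_le_nhds
    (by norm_num) hp (by simp) (hξ p hp) h1
    (eventually_mem_nhdsWithin.mono fun r hr => hs r hr p (mem_sphSet.2 hp))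
  have h3 : ∫ x, capInd (-1) p x * G 0 (-(e1 n)) x ∂(sphMeasure n) =
      -∫ x, G 0 (e1 n) x ∂(sphMeasure n) := by
    rw [← integral_neg]
    refine integral_congr_ae ?_
    filter_upwards [capInd_neg_one hn hp] with x hx
    rw [hx, one_mul, hG.neg]
  rw [h3] at h2
  exact h2

theorem continuousOn_capDiff (hG : IsKernel G) (hn : 2 ≤ n)
    (hξ : ∀ r ∈ Set.Ioo (-1 : ℝ) 1, ∀ p ∈ sphSet n, ‖ξfun r p‖ < 1)
    (hs : ∀ r ∈ Set.Ioo (-1 : ℝ) 1, ∀ p ∈ sphSet n, ‖sfun r p‖ = 1)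
    (hξcont : ContinuousOn (fun q : ℝ × Eu n => ξfun q.1 q.2) (Set.Ioo (-1 : ℝ) 1 ×ˢ sphSet n))
    (hscont : ContinuousOn (fun q : ℝ × Eu n => sfun q.1 q.2) (Set.Ico (-1 : ℝ) 1 ×ˢ sphSet n))
    {p : Eu n} (hp : ‖p‖ = 1) :
    ContinuousOn (capDiff G ξfun sfun p) (Ioo (-1) 1) :=
  (continuousOn_capIntegral hG hn hξ hs hξcont hscont hp).sub
    ((continuousOn_capIntegral hG hn hξ hs hξcont hscont (p := -p) (by rwa [norm_neg])).comp
      continuous_neg.continuousOn fun _ hr => mem_Ioo_neg hr)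

theorem tendsto_capDiff_one (hG : IsKernel G) (hn : 2 ≤ n)
    (hξ : ∀ r ∈ Set.Ioo (-1 : ℝ) 1, ∀ p ∈ sphSet n, ‖ξfun r p‖ < 1)
    (hξ0 : ∀ p : Eu n, ‖p‖ = 1 →
      Tendsto (fun r => ξfun r p) (𝓝[Ioo (-1) 1] (-1)) (𝓝 0))
    (hs : ∀ r ∈ Set.Ioo (-1 : ℝ) 1, ∀ p ∈ sphSet n, ‖sfun r p‖ = 1)
    (hscont : ContinuousOn (fun q : ℝ × Eu n => sfun q.1 q.2) (Set.Ico (-1 : ℝ) 1 ×ˢ sphSet n))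
    (hinit : ∀ p ∈ sphSet n, sfun (-1) p = -(e1 n)) {p : Eu n} (hp : ‖p‖ = 1) :
    Tendsto (capDiff G ξfun sfun p) (𝓝[Ioo (-1) 1] 1)
      (𝓝 (∫ x, G 0 (e1 n) x ∂(sphMeasure n))) := by
  have h1 := tendsto_capIntegral_one hG hn hξ hs hp
  have h2 := (tendsto_capIntegral_neg_one hG hn hξ0 hs hscont hinit (p := -p)
    (by rwa [norm_neg])).comp (tendsto_neg_Ioo (a := 1))
  have h3 := h1.sub h2
  rwa [zero_sub, neg_neg] at h3

theorem tendsto_capDiff_neg_one (hG : IsKernel G) (hn : 2 ≤ n)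
    (hξ : ∀ r ∈ Set.Ioo (-1 : ℝ) 1, ∀ p ∈ sphSet n, ‖ξfun r p‖ < 1)
    (hξ0 : ∀ p : Eu n, ‖p‖ = 1 →
      Tendsto (fun r => ξfun r p) (𝓝[Ioo (-1) 1] (-1)) (𝓝 0))
    (hs : ∀ r ∈ Set.Ioo (-1 : ℝ) 1, ∀ p ∈ sphSet n, ‖sfun r p‖ = 1)
    (hscont : ContinuousOn (fun q : ℝ × Eu n => sfun q.1 q.2) (Set.Ico (-1 : ℝ) 1 ×ˢ sphSet n))
    (hinit : ∀ p ∈ sphSet n, sfun (-1) p = -(e1 n)) {p : Eu n} (hp : ‖p‖ = 1) :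
    Tendsto (capDiff G ξfun sfun p) (𝓝[Ioo (-1) 1] (-1))
      (𝓝 (-∫ x, G 0 (e1 n) x ∂(sphMeasure n))) := by
  have h1 := tendsto_capIntegral_neg_one hG hn hξ0 hs hscont hinit hp
  have h0 := tendsto_neg_Ioo (a := -1)
  rw [neg_neg] at h0
  have h2 := (tendsto_capIntegral_one hG hn hξ hs (p := -p) (by rwa [norm_neg])).comp h0
  have h3 := h1.sub h2
  rwa [sub_zero] at h3

theorem integral_eq_capDiff (hG : IsKernel G)
    (hξ : ∀ r ∈ Set.Ioo (-1 : ℝ) 1, ∀ p ∈ sphSet n, ‖ξfun r p‖ < 1)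
    (hs : ∀ r ∈ Set.Ioo (-1 : ℝ) 1, ∀ p ∈ sphSet n, ‖sfun r p‖ = 1)
    {p : Eu n} (hp : ‖p‖ = 1) {r : ℝ} (hr : r ∈ Ioo (-1 : ℝ) 1) {f : Eu n → ℝ}
    (hf : ∀ᵐ x ∂(sphMeasure n), f x = capInd r p x * G (ξfun r p) (sfun r p) x +
      capInd (-r) (-p) x * G (ξfun (-r) (-p)) (-sfun (-r) (-p)) x) :
    ∫ x, f x ∂(sphMeasure n) = capDiff G ξfun sfun p r := by
  have hr' := mem_Ioo_neg hr
  have hp' : -p ∈ sphSet n := mem_sphSet.2 (by rwa [norm_neg])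
  rw [capDiff, capIntegral, capIntegral, ← integral_sub
    (hG.integrable (hξ r hr p (mem_sphSet.2 hp)) (hs r hr p (mem_sphSet.2 hp)) r p)
    (hG.integrable (hξ (-r) hr' _ hp') (hs (-r) hr' _ hp') (-r) (-p))]
  refine integral_congr_ae (hf.mono fun x hx => ?_)
  simp only [hx, hG.neg]
  ring

end Kernels

section Balance

variable {n : ℕ} {w : Eu n → ℝ}

theorem IsConformalFactor.exists_bound (hw : IsConformalFactor n w) :
    ∃ W : ℝ, 0 ≤ W ∧ ∀ x, ‖x‖ = 1 → |w x| ≤ W := by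
  obtain ⟨W, hW⟩ := (isCompact_sphere (0 : Eu n) 1).exists_bound_of_continuousOn
    hw.1.continuous.continuousOn
  exact ⟨max W 0, le_max_right _ _, fun x hx => (hW x (by simpa using hx)).trans (le_max_left _ _)⟩

theorem integral_confMeasure (hw : IsConformalFactor n w) (f : Eu n → ℝ) :
    ∫ x, f x ∂(confMeasure n w) = ∫ x, w x ^ n * f x ∂(sphMeasure n) := by
  have hmeas : Measurable fun x => ENNReal.ofReal (w x ^ n) :=
    ENNReal.measurable_ofReal.comp (hw.1.continuous.pow n).measurable
  rw [confMeasure, integral_withDensity_eq_integral_toReal_smul hmeas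
    (ae_of_all _ fun _ => ENNReal.ofReal_lt_top)]
  refine integral_congr_ae (ae_sphMeasure_norm.mono fun x hx => ?_)
  have h0 : 0 < w x := hw.2 x (mem_sphSet.2 hx)
  simp only
  rw [ENNReal.toReal_ofReal (by positivity), smul_eq_mul]

/-- The kernel of the mixed Dirichlet energy. -/
def gradKernel (w : Eu n → ℝ) (ξ s x : Eu n) : ℝ := w x ^ (n - 2) * dMapDeriv ξ s x (tvec x)

/-- The kernel of the mixed `L²` product. -/
def massKernel (w : Eu n → ℝ) (ξ s x : Eu n) : ℝ := w x ^ n * (⟪e1 n, x⟫ * ⟪s, dMap ξ x⟫)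

theorem isKernel_gradKernel (hw : IsConformalFactor n w) : IsKernel (gradKernel w) where
  measurable ξ s := by
    have h1 := hw.1.continuous.measurable
    have h2 := (continuous_tvec (n := n)).measurable
    have h3 := measurable_dFac ξ
    unfold gradKernel dMapDeriv dDen
    fun_prop
  bound := by
    obtain ⟨W, hW, h⟩ := hw.exists_bound
    refine ⟨W ^ (n - 2), by positivity, fun ξ s x hξ hs hx => ?_⟩
    rw [gradKernel, abs_mul, abs_pow]
    have h1 := dFac_pos hξ hx.le
    have h2 := abs_dMapDeriv_le (s := s) hξ hx (inner_tvec hx)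
    rw [hs, one_mul] at h2
    have h3 : dFac ξ x * ‖tvec x‖ ≤ dFac ξ x * 1 :=
      mul_le_mul_of_nonneg_left (norm_tvec_le hx) h1.le
    have h4 := h x hx
    gcongr
    linarith
  continuousOn x hx := by
    have h1 : Continuous fun q : Eu n × Eu n => dDen q.1 x := by unfold dDen; fun_prop
    have h0 : ∀ q ∈ {q : Eu n × Eu n | ‖q.1‖ < 1}, dDen q.1 x ≠ 0 :=
      fun q hq => (dDen_pos hq hx.le).ne'
    have h2 : ContinuousOn (fun q : Eu n × Eu n => dFac q.1 x) {q | ‖q.1‖ < 1} := by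
      unfold dFac
      exact ContinuousOn.div (by fun_prop) h1.continuousOn h0
    have h3 : ContinuousOn (fun q : Eu n × Eu n => 2 * (⟪q.1, tvec x⟫ : ℝ) / dDen q.1 x)
        {q | ‖q.1‖ < 1} :=
      ContinuousOn.div (by fun_prop) h1.continuousOn h0
    unfold gradKernel dMapDeriv
    fun_prop
  neg ξ s x := by rw [gradKernel, gradKernel, dMapDeriv_neg, mul_neg]

theorem isKernel_massKernel (hw : IsConformalFactor n w) : IsKernel (massKernel w) where
  measurable ξ s := by
    have h1 := hw.1.continuous.measurable
    have h2 := measurable_inner_dMap ξ s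
    unfold massKernel
    fun_prop
  bound := by
    obtain ⟨W, hW, h⟩ := hw.exists_bound
    refine ⟨W ^ n, by positivity, fun ξ s x hξ hs hx => ?_⟩
    rw [massKernel, abs_mul, abs_pow, abs_mul]
    have h1 := dFac_pos hξ hx.le
    have h2 := abs_inner_dMap_le hξ hs hx
    have h3 := abs_inner_le_one norm_e1 hx
    have h4 := h x hx
    have h5 : |(⟪e1 n, x⟫ : ℝ)| * |(⟪s, dMap ξ x⟫ : ℝ)| ≤ 1 :=
      mul_le_one₀ h3 (abs_nonneg _) h2
    gcongr
    linarith
  continuousOn x hx := by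
    have h1 : ContinuousOn (fun q : Eu n × Eu n => dMap q.1 x) {q | ‖q.1‖ < 1} :=
      continuousOn_dMap.comp (f := fun q : Eu n × Eu n => (q.1, x)) (by fun_prop)
        fun q hq => ⟨hq, hx.le⟩
    have h2 : ContinuousOn (fun q : Eu n × Eu n => (⟪q.2, dMap q.1 x⟫ : ℝ)) {q | ‖q.1‖ < 1} :=
      continuousOn_snd.inner h1
    unfold massKernel
    fun_prop
  neg ξ s x := by
    simp only [massKernel, inner_neg_left]
    ring

theorem integral_gradKernel_zero (w : Eu n → ℝ) :
    ∫ x, gradKernel w 0 (e1 n) x ∂(sphMeasure n) = dirichlet n w (Xfun (e1 n)) := by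
  refine integral_congr_ae (ae_sphMeasure_norm.mono fun x hx => ?_)
  simp only [gradKernel, dMapDeriv_zero, inner_e1_tvec]
  rw [gradS_Xfun, ← tvec, norm_tvec_sq hx]

theorem integral_massKernel_zero (hw : IsConformalFactor n w) :
    ∫ x, massKernel w 0 (e1 n) x ∂(sphMeasure n) =
      ∫ x, Xfun (e1 n) x ^ 2 ∂(confMeasure n w) := by
  rw [integral_confMeasure hw]
  refine integral_congr_ae (ae_of_all _ fun x => ?_)
  have h0 : dMap 0 x = x := by simp [dMap]
  simp only [massKernel, h0, Xfun]
  ring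

theorem integral_inner_gradS_testFun (hn : 2 ≤ n) (hw : IsConformalFactor n w)
    {ξfun sfun : ℝ → Eu n → Eu n}
    (hξ : ∀ r ∈ Set.Ioo (-1 : ℝ) 1, ∀ p ∈ sphSet n, ‖ξfun r p‖ < 1)
    (hs : ∀ r ∈ Set.Ioo (-1 : ℝ) 1, ∀ p ∈ sphSet n, ‖sfun r p‖ = 1)
    {p : Eu n} (hp : ‖p‖ = 1) {r : ℝ} (hr : r ∈ Ioo (-1 : ℝ) 1)
    (hpt : reflPt r p (ξfun r p) = ξfun (-r) (-p))
    (hdir : reflDir r p (ξfun r p) (sfun r p) = -sfun (-r) (-p)) :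
    ∫ x, w x ^ (n - 2) *
      (⟪gradS (testFun n (ξfun r p) r p (sfun r p)) x, gradS (Xfun (e1 n)) x⟫ : ℝ)
        ∂(sphMeasure n) = capDiff (gradKernel w) ξfun sfun p r := by
  refine integral_eq_capDiff (isKernel_gradKernel hw) hξ hs hp hr ?_
  filter_upwards [ae_sphMeasure_norm,
    ae_side_ne_zero hn (Ioo_subset_Icc_self hr) hp] with x hx hside
  have hp' := mem_sphSet.2 hp
  rw [gradS_Xfun, ← tvec, inner_gradS _ (inner_tvec hx), fderiv_testFun hr hp (hξ r hr p hp')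
    (hs r hr p hp') hx (inner_tvec hx) hside, hpt, hdir, gradKernel, gradKernel]
  ring

theorem integral_mul_testFun (hn : 2 ≤ n) (hw : IsConformalFactor n w)
    {ξfun sfun : ℝ → Eu n → Eu n}
    (hξ : ∀ r ∈ Set.Ioo (-1 : ℝ) 1, ∀ p ∈ sphSet n, ‖ξfun r p‖ < 1)
    (hs : ∀ r ∈ Set.Ioo (-1 : ℝ) 1, ∀ p ∈ sphSet n, ‖sfun r p‖ = 1)
    {p : Eu n} (hp : ‖p‖ = 1) {r : ℝ} (hr : r ∈ Ioo (-1 : ℝ) 1)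
    (hpt : reflPt r p (ξfun r p) = ξfun (-r) (-p))
    (hdir : reflDir r p (ξfun r p) (sfun r p) = -sfun (-r) (-p)) :
    ∫ x, Xfun (e1 n) x * testFun n (ξfun r p) r p (sfun r p) x ∂(confMeasure n w) =
      capDiff (massKernel w) ξfun sfun p r := by
  rw [integral_confMeasure hw]
  refine integral_eq_capDiff (isKernel_massKernel hw) hξ hs hp hr ?_
  filter_upwards [ae_sphMeasure_norm,
    ae_side_ne_zero hn (Ioo_subset_Icc_self hr) hp] with x hx hside
  have hp' := mem_sphSet.2 hp
  rw [testFun_eq_capInd hr hp (hξ r hr p hp') (hs r hr p hp') hx hside, hpt, hdir, massKernel,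
    massKernel, Xfun]
  ring

/-- Young's inequality in the form used to compare Dirichlet energies. -/
theorem pow_mul_sq_le (hn : 2 ≤ n) {a T A : ℝ} (ha : 0 < a) (hT : 0 ≤ T) (hA : 0 < A) :
    a ^ (n - 2) * T ^ 2 ≤
      A ^ ((2 : ℝ) / n) * ((((n : ℝ) - 2) / n) * a ^ n + (2 / n) * (T ^ n / A)) := by
  have hn0 : (0 : ℝ) < n := by positivity
  have hn2 : (2 : ℝ) ≤ n := by exact_mod_cast hn
  have h0 : 0 ≤ ((n : ℝ) - 2) / n := div_nonneg (by linarith) hn0.le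
  have h0' : 0 ≤ (2 : ℝ) / n := by positivity
  have hsum : ((n : ℝ) - 2) / n + 2 / n = 1 := by field_simp; ring
  have h1 := Real.geom_mean_le_arith_mean2_weighted h0 h0' (pow_nonneg ha.le n)
    (div_nonneg (pow_nonneg hT n) hA.le) hsum
  have h2 : (a ^ n) ^ (((n : ℝ) - 2) / n) = a ^ (n - 2) := by
    rw [← Real.rpow_natCast a n, ← Real.rpow_mul ha.le, mul_div_cancel₀ _ hn0.ne',
      ← Real.rpow_natCast a (n - 2), Nat.cast_sub hn, Nat.cast_ofNat]
  have h3 : (T ^ n / A) ^ ((2 : ℝ) / n) = T ^ 2 / A ^ ((2 : ℝ) / n) := by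
    rw [Real.div_rpow (by positivity) hA.le, ← Real.rpow_natCast T n, ← Real.rpow_mul hT,
      mul_div_cancel₀ _ hn0.ne', Real.rpow_two]
  rw [h2, h3] at h1
  have h4 : 0 < A ^ ((2 : ℝ) / n) := Real.rpow_pos_of_pos hA _
  calc a ^ (n - 2) * T ^ 2
      = A ^ ((2 : ℝ) / n) * (a ^ (n - 2) * (T ^ 2 / A ^ ((2 : ℝ) / n))) := by field_simp
    _ ≤ _ := mul_le_mul_of_nonneg_left h1 h4.le

/-- The first coordinate function has normalized Dirichlet energy at most one. -/
theorem dirichlet_div_le_one (hn : 2 ≤ n) (hw : IsConformalFactor n w)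
    (hvol : confMeasure n w univ = 1) :
    dirichlet n w (Xfun (e1 n)) /
      (∫ x, ‖gradS (Xfun (e1 n)) x‖ ^ n ∂(sphMeasure n)) ^ ((2 : ℝ) / n) ≤ 1 := by
  have hn0 : (0 : ℝ) < n := by positivity
  have hgrad : ∀ x : Eu n, gradS (Xfun (e1 n)) x = tvec x := fun x => by rw [gradS_Xfun, tvec]
  simp only [dirichlet, hgrad]
  set A := ∫ x : Eu n, ‖tvec x‖ ^ n ∂(sphMeasure n) with hA
  have hA0 : 0 ≤ A := integral_nonneg fun x => by positivity
  rcases hA0.eq_or_lt with hA1 | hA1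
  · rw [← hA1, Real.zero_rpow (by positivity), div_zero]
    exact zero_le_one
  obtain ⟨W, hW, hwb⟩ := hw.exists_bound
  have hwm := hw.1.continuous.measurable
  have htm := (continuous_tvec (n := n)).measurable
  have iw : Integrable (fun x => w x ^ n) (sphMeasure n) := by
    refine integrable_of_ae_norm_eq_one ae_sphMeasure_norm (by fun_prop) (W ^ n) fun x hx => ?_
    rw [abs_pow]
    exact pow_le_pow_left₀ (abs_nonneg _) (hwb x hx) n
  have it : Integrable (fun x : Eu n => ‖tvec x‖ ^ n) (sphMeasure n) := by
    refine integrable_of_ae_norm_eq_one ae_sphMeasure_norm (by fun_prop) 1 fun x hx => ?_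
    rw [abs_pow, abs_norm]
    exact pow_le_one₀ (norm_nonneg _) (norm_tvec_le hx)
  have hone : ∫ x, w x ^ n ∂(sphMeasure n) = 1 := by
    have h1 := integral_confMeasure hw (fun _ => 1)
    simp only [mul_one] at h1
    rw [← h1]
    simp [Measure.real, hvol]
  rw [div_le_one (Real.rpow_pos_of_pos hA1 _)]
  have hkey : ∀ᵐ x ∂(sphMeasure n), w x ^ (n - 2) * ‖tvec x‖ ^ 2 ≤
      A ^ ((2 : ℝ) / n) * ((((n : ℝ) - 2) / n) * w x ^ n + (2 / n) * (‖tvec x‖ ^ n / A)) := by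
    filter_upwards [ae_sphMeasure_norm] with x hx
    have h0 : 0 < w x := hw.2 x (mem_sphSet.2 hx)
    exact pow_mul_sq_le hn h0 (norm_nonneg _) hA1
  have hint : Integrable (fun x => A ^ ((2 : ℝ) / n) *
      ((((n : ℝ) - 2) / n) * w x ^ n + (2 / n) * (‖tvec x‖ ^ n / A))) (sphMeasure n) :=
    ((iw.const_mul _).add ((it.div_const A).const_mul _)).const_mul _
  have hval : ∫ x, A ^ ((2 : ℝ) / n) *
      ((((n : ℝ) - 2) / n) * w x ^ n + (2 / n) * (‖tvec x‖ ^ n / A)) ∂(sphMeasure n) =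
      A ^ ((2 : ℝ) / n) := by
    rw [integral_const_mul, integral_add (iw.const_mul _) ((it.div_const A).const_mul _),
      integral_const_mul, integral_const_mul, integral_div, hone, ← hA, div_self hA1.ne']
    field_simp
    ring
  rw [← hval]
  refine integral_mono_of_nonneg ?_ hint hkey
  filter_upwards [ae_sphMeasure_norm] with x hx
  have h0 : 0 < w x := hw.2 x (mem_sphSet.2 hx)
  simp only [Pi.zero_apply]
  positivity

/-- A maximal direction of a probability measure on the sphere carries at least the average mass. -/
theorem one_le_mul_integral_sq {ν : Measure (Eu n)} [IsProbabilityMeasure ν]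
    (hν : ∀ᵐ x ∂ν, ‖x‖ = 1) {s : Eu n} (hs : IsMaxDir ν s) :
    1 ≤ (n + 1 : ℝ) * ∫ x, Xfun s x ^ 2 ∂ν := by
  have hmax : Qform ν s = maxEig n ν := by
    have := (hs.2 s).2 ⟨1, (one_smul ℝ s).symm⟩
    rwa [hs.1, one_pow, mul_one] at this
  have hcoord : ∀ i : Fin (n + 1), Qform ν (EuclideanSpace.single i 1) ≤ Qform ν s := fun i => by
    rw [hmax]
    exact Qform_le_maxEig hν (by simp)
  have hint : ∀ i : Fin (n + 1), Integrable
      (fun x => (⟪(EuclideanSpace.single i 1 : Eu n), x⟫ : ℝ) ^ 2) ν := fun i => by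
    refine integrable_of_ae_norm_eq_one hν (by fun_prop) 1 fun x hx => ?_
    rw [abs_pow]
    exact pow_le_one₀ (abs_nonneg _) (abs_inner_le_one (by simp) hx)
  have hsum : ∑ i : Fin (n + 1), Qform ν (EuclideanSpace.single i 1) = 1 := by
    simp only [Qform]
    rw [← integral_finsetSum _ fun i _ => hint i]
    have : ∀ᵐ x ∂ν, ∑ i : Fin (n + 1), (⟪(EuclideanSpace.single i 1 : Eu n), x⟫ : ℝ) ^ 2 = 1 := by
      filter_upwards [hν] with x hx
      have h1 := EuclideanSpace.real_norm_sq_eq x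
      rw [hx, one_pow] at h1
      simpa only [EuclideanSpace.inner_single_left, map_one, one_mul] using h1.symm
    rw [integral_congr_ae this]
    simp
  calc (1 : ℝ) = ∑ i : Fin (n + 1), Qform ν (EuclideanSpace.single i 1) := hsum.symm
    _ ≤ ∑ _i : Fin (n + 1), Qform ν s := Finset.sum_le_sum fun i _ => hcoord i
    _ = (n + 1 : ℝ) * ∫ x, Xfun s x ^ 2 ∂ν := by
      simp [Qform, Xfun]

theorem exists_eq_zero_of_tendsto {f : ℝ → ℝ} {a b : ℝ} (hf : ContinuousOn f (Ioo (-1) 1))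
    (h1 : Tendsto f (𝓝[Ioo (-1) 1] 1) (𝓝 a)) (ha : a < 0)
    (h2 : Tendsto f (𝓝[Ioo (-1) 1] (-1)) (𝓝 b)) (hb : 0 < b) : ∃ r ∈ Ioo (-1 : ℝ) 1, f r = 0 := by
  have n1 : (𝓝[Ioo (-1 : ℝ) 1] 1).NeBot := by
    rw [← mem_closure_iff_nhdsWithin_neBot, closure_Ioo (by norm_num)]
    norm_num
  have n2 : (𝓝[Ioo (-1 : ℝ) 1] (-1)).NeBot := by
    rw [← mem_closure_iff_nhdsWithin_neBot, closure_Ioo (by norm_num)]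
    norm_num
  obtain ⟨x, hx, hx'⟩ := ((h1.eventually_lt_const ha).and eventually_mem_nhdsWithin).exists
  obtain ⟨y, hy, hy'⟩ := ((h2.eventually_const_lt hb).and eventually_mem_nhdsWithin).exists
  obtain ⟨r, hr, hr'⟩ := isPreconnected_Ioo.intermediate_value hx' hy' hf ⟨hx.le, hy.le⟩
  exact ⟨r, hr, hr'⟩

end Balance

/-- With `φ = X_{e₁}`, `ψ_r = u_{a_{r,e₁}}^{s(a_{r,e₁})}`,
`α_r = ∫ g(∇ψ_r,∇φ) dv_g / (∫ |∇φ|^n dv_g)^{2/n}` and `β_r = (n+1) ∫ φ ψ_r dv_g`, there is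
`r ∈ (-1,1)` with `α_r - 2^{2/n} β_r = 0`; more precisely `r ↦ α_r - 2^{2/n} β_r` is continuous
on `(-1,1)`, tends to `σ - 2^{2/n} I < 0` as `r → 1` and to `2^{2/n} I - σ > 0` as `r → -1`. -/
theorem exists_balanced_test_function (n : ℕ) (hn : 2 ≤ n)
    (w : Eu n → ℝ) (hw : IsConformalFactor n w) (hvol : confMeasure n w Set.univ = 1)
    (hmean : ∀ t : Eu n, ∫ x, (⟪t, x⟫ : ℝ) ∂(confMeasure n w) = 0)
    (hsimple : IsMaxDir (confMeasure n w) (e1 n))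
    (ξfun : ℝ → Eu n → Eu n) (sfun : ℝ → Eu n → Eu n)
    (hξ : ∀ r ∈ Set.Ioo (-1 : ℝ) 1, ∀ p ∈ sphSet n,
      ‖ξfun r p‖ < 1 ∧ Renormalizes (ξfun r p) (capMeasure n w r p))
    (hξcont : ContinuousOn (fun q : ℝ × Eu n => ξfun q.1 q.2)
      (Set.Ioo (-1 : ℝ) 1 ×ˢ sphSet n))
    (hmax : ∀ r ∈ Set.Ioo (-1 : ℝ) 1, ∀ p ∈ sphSet n,
      IsMaxDir (Measure.map (dMap (ξfun r p)) (capMeasure n w r p)) (sfun r p))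
    (hscont : ContinuousOn (fun q : ℝ × Eu n => sfun q.1 q.2)
      (Set.Ico (-1 : ℝ) 1 ×ˢ sphSet n))
    (hinit : ∀ p ∈ sphSet n, sfun (-1) p = -(e1 n)) :
    letI ψ : ℝ → Eu n → ℝ := fun r => testFun n (ξfun r (e1 n)) r (e1 n) (sfun r (e1 n))
    letI En : ℝ := (∫ x, ‖gradS (Xfun (e1 n)) x‖ ^ n ∂(sphMeasure n)) ^ ((2 : ℝ) / n)
    letI α : ℝ → ℝ := fun r =>
      (∫ x, w x ^ (n - 2) * (⟪gradS (ψ r) x, gradS (Xfun (e1 n)) x⟫ : ℝ) ∂(sphMeasure n)) / En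
    letI β : ℝ → ℝ := fun r => (n + 1 : ℝ) * ∫ x, Xfun (e1 n) x * ψ r x ∂(confMeasure n w)
    letI σc : ℝ := (dirichlet n w (Xfun (e1 n))) / En
    letI Ic : ℝ := (n + 1 : ℝ) * ∫ x, (Xfun (e1 n) x) ^ 2 ∂(confMeasure n w)
    (∃ r ∈ Set.Ioo (-1 : ℝ) 1, α r - 2 ^ ((2 : ℝ) / n) * β r = 0) ∧
    ContinuousOn (fun r => α r - 2 ^ ((2 : ℝ) / n) * β r) (Set.Ioo (-1 : ℝ) 1) ∧
    Filter.Tendsto (fun r => α r - 2 ^ ((2 : ℝ) / n) * β r)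
      (nhdsWithin (1 : ℝ) (Set.Ioo (-1 : ℝ) 1)) (nhds (σc - 2 ^ ((2 : ℝ) / n) * Ic)) ∧
    σc - 2 ^ ((2 : ℝ) / n) * Ic < 0 ∧
    Filter.Tendsto (fun r => α r - 2 ^ ((2 : ℝ) / n) * β r)
      (nhdsWithin (-1 : ℝ) (Set.Ioo (-1 : ℝ) 1)) (nhds (2 ^ ((2 : ℝ) / n) * Ic - σc)) ∧
    0 < 2 ^ ((2 : ℝ) / n) * Ic - σc := by
  have : IsProbabilityMeasure (confMeasure n w) := ⟨hvol⟩
  have he : ‖e1 n‖ = 1 := norm_e1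
  have hξ1 : ∀ r ∈ Set.Ioo (-1 : ℝ) 1, ∀ p ∈ sphSet n, ‖ξfun r p‖ < 1 := fun r hr p hp =>
    (hξ r hr p hp).1
  have hs1 : ∀ r ∈ Set.Ioo (-1 : ℝ) 1, ∀ p ∈ sphSet n, ‖sfun r p‖ = 1 := fun r hr p hp =>
    (hmax r hr p hp).1
  have hξ0 : ∀ p : Eu n, ‖p‖ = 1 → Tendsto (fun r => ξfun r p) (𝓝[Ioo (-1) 1] (-1)) (𝓝 0) :=
    fun p hp => tendsto_renormPt hn hvol hmean hsimple hp fun r hr => hξ r hr p (mem_sphSet.2 hp)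
  set En : ℝ := (∫ x, ‖gradS (Xfun (e1 n)) x‖ ^ n ∂(sphMeasure n)) ^ ((2 : ℝ) / n) with hEn
  set Φ : ℝ → ℝ := fun r => capDiff (gradKernel w) ξfun sfun (e1 n) r / En -
    2 ^ ((2 : ℝ) / n) * ((n + 1 : ℝ) * capDiff (massKernel w) ξfun sfun (e1 n) r) with hΦ
  have hgk := isKernel_gradKernel hw
  have hmk := isKernel_massKernel hw
  have heq : EqOn (fun r => (∫ x, w x ^ (n - 2) *
      (⟪gradS (testFun n (ξfun r (e1 n)) r (e1 n) (sfun r (e1 n))) x,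
        gradS (Xfun (e1 n)) x⟫ : ℝ) ∂(sphMeasure n)) / En -
      2 ^ ((2 : ℝ) / n) * ((n + 1 : ℝ) * ∫ x, Xfun (e1 n) x *
        testFun n (ξfun r (e1 n)) r (e1 n) (sfun r (e1 n)) x ∂(confMeasure n w))) Φ
      (Ioo (-1) 1) := by
    intro r hr
    have hpt := reflPt_eq hn hvol hξ hr he
    have hdir := reflDir_eq_neg hn hvol hξ hξcont hmax hscont hinit hr he
    simp only [hΦ, integral_inner_gradS_testFun hn hw hξ1 hs1 he hr hpt hdir,
      integral_mul_testFun hn hw hξ1 hs1 he hr hpt hdir]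
  have hcont : ContinuousOn Φ (Ioo (-1) 1) :=
    ((continuousOn_capDiff hgk hn hξ1 hs1 hξcont hscont he).div_const En).sub
      (((continuousOn_capDiff hmk hn hξ1 hs1 hξcont hscont he).const_mul _).const_mul _)
  have hone : Tendsto Φ (𝓝[Ioo (-1) 1] 1) (𝓝 (dirichlet n w (Xfun (e1 n)) / En -
      2 ^ ((2 : ℝ) / n) * ((n + 1 : ℝ) * ∫ x, Xfun (e1 n) x ^ 2 ∂(confMeasure n w)))) := by
    rw [← integral_gradKernel_zero, ← integral_massKernel_zero hw]
    exact ((tendsto_capDiff_one hgk hn hξ1 hξ0 hs1 hscont hinit he).div_const En).sub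
      (((tendsto_capDiff_one hmk hn hξ1 hξ0 hs1 hscont hinit he).const_mul _).const_mul _)
  have hneg : Tendsto Φ (𝓝[Ioo (-1) 1] (-1)) (𝓝 (2 ^ ((2 : ℝ) / n) *
      ((n + 1 : ℝ) * ∫ x, Xfun (e1 n) x ^ 2 ∂(confMeasure n w)) -
        dirichlet n w (Xfun (e1 n)) / En)) := by
    rw [← integral_gradKernel_zero, ← integral_massKernel_zero hw]
    have h := ((tendsto_capDiff_neg_one hgk hn hξ1 hξ0 hs1 hscont hinit he).div_const En).sub
      (((tendsto_capDiff_neg_one hmk hn hξ1 hξ0 hs1 hscont hinit he).const_mul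
        (n + 1 : ℝ)).const_mul (2 ^ ((2 : ℝ) / n)))
    convert h using 2
    ring
  have hlt : dirichlet n w (Xfun (e1 n)) / En -
      2 ^ ((2 : ℝ) / n) * ((n + 1 : ℝ) * ∫ x, Xfun (e1 n) x ^ 2 ∂(confMeasure n w)) < 0 := by
    have h1 : dirichlet n w (Xfun (e1 n)) / En ≤ 1 := dirichlet_div_le_one hn hw hvol
    have h2 := one_le_mul_integral_sq (ae_confMeasure_norm w) hsimple
    have h3 : (1 : ℝ) < 2 ^ ((2 : ℝ) / n) := Real.one_lt_rpow (by norm_num) (by positivity)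
    nlinarith
  have hev : ∀ a : ℝ, ∀ᶠ r in 𝓝[Ioo (-1 : ℝ) 1] a, r ∈ Ioo (-1 : ℝ) 1 := fun _ =>
    eventually_mem_nhdsWithin
  obtain ⟨r, hr, hr0⟩ := exists_eq_zero_of_tendsto hcont hone hlt hneg (by linarith)
  exact ⟨⟨r, hr, (heq hr).trans hr0⟩, hcont.congr heq,
    hone.congr' ((hev 1).mono fun r hr => (heq hr).symm), hlt,
    hneg.congr' ((hev (-1)).mono fun r hr => (heq hr).symm), by linarith⟩

end
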